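/- arXiv:2602.11344 — 2 statements merged into one kernel-verified Lean document; each statement's English description precedes it below -/
import Mathlib

section
/- For every integer k ≥ 2 there exist a probability space (X, B, μ), an invertible ergodic measure-preserving transformation T : X → X, and a function f ∈ L¹(X, μ) such that the set of points x ∈ X at which the averages (1/N) Σ_{n=1}^{N} f(T^{n^k} x) converge as N → ∞ does not have full μ-measure; that is, pointwise almost everywhere convergence of the ergodic averages along k-th powers fails on L¹. -/
open MeasureTheory Filter
open scoped ENNReal

section CharacterSums
open Finset

variable {p : ℕ} [Fact p.Prime]

/-- The additive character sum over `R` at frequency `b`. -/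
noncomputable def zmodCharSum (R : Finset (ZMod p)) (b : ZMod p) : ℂ :=
  ∑ u ∈ R, ZMod.stdAddChar (b * u)

lemma sum_stdAddChar_mul_normSq_zmodCharSum (R : Finset (ZMod p)) (s : ZMod p) :
    ∑ b, ZMod.stdAddChar (b * s) * ((‖zmodCharSum R b‖ ^ 2 : ℝ) : ℂ) =
      p * (#{u ∈ R | u + s ∈ R} : ℂ) := by
  have key : ∀ b : ZMod p, ZMod.stdAddChar (b * s) * ((‖zmodCharSum R b‖ ^ 2 : ℝ) : ℂ) =
      ∑ u ∈ R, ∑ v ∈ R, ZMod.stdAddChar (b * (u + s - v)) := by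
    intro b
    rw [Complex.ofReal_pow, ← Complex.mul_conj', zmodCharSum, map_sum, sum_mul_sum, mul_sum]
    refine sum_congr rfl fun u _ => ?_
    rw [mul_sum]
    refine sum_congr rfl fun v _ => ?_
    rw [← AddChar.map_neg_eq_conj, ← AddChar.map_add_eq_mul, ← AddChar.map_add_eq_mul]
    congr 1
    ring
  simp_rw [key]
  rw [sum_comm]
  simp_rw [sum_comm (s := univ) (t := R),
    AddChar.sum_mulShift _ (ZMod.isPrimitive_stdAddChar p), sub_eq_zero]
  rw [Finset.card_filter]
  push_cast
  rw [mul_sum]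
  refine sum_congr rfl fun u _ => ?_
  simp [ZMod.card]

lemma sum_normSq_zmodCharSum (R : Finset (ZMod p)) :
    ∑ b, ‖zmodCharSum R b‖ ^ 2 = p * (#R : ℝ) := by
  have h := sum_stdAddChar_mul_normSq_zmodCharSum R 0
  simp only [mul_zero, AddChar.map_zero_eq_one, one_mul, add_zero, filter_mem_eq_inter,
    inter_self] at h
  exact_mod_cast h

lemma sum_mul_left_of_mul_mem {M : Type*} [AddCommMonoid M] {R : Finset (ZMod p)}
    (hmul : ∀ r ∈ R, ∀ u ∈ R, r * u ∈ R) {r : ZMod p} (hr : r ∈ R) (hr0 : r ≠ 0)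
    (f : ZMod p → M) : ∑ u ∈ R, f (r * u) = ∑ u ∈ R, f u := by
  have hinj : Set.InjOn (r * ·) (R : Set (ZMod p)) := (mul_right_injective₀ hr0).injOn
  have himg : R.image (r * ·) = R := by
    refine eq_of_subset_of_card_le ?_ ?_
    · intro x hx
      obtain ⟨u, hu, rfl⟩ := mem_image.1 hx
      exact hmul r hr u hu
    · rw [card_image_of_injOn hinj]
  conv_rhs => rw [← himg]
  rw [sum_image hinj]

lemma norm_zmodCharSum_le {R : Finset (ZMod p)} (hR : R.Nonempty) (h0 : (0 : ZMod p) ∉ R)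
    (hmul : ∀ r ∈ R, ∀ u ∈ R, r * u ∈ R) {b : ZMod p} (hb : b ≠ 0) :
    ‖zmodCharSum R b‖ ≤ √p := by
  have hcard : (0 : ℝ) < #R := by exact_mod_cast hR.card_pos
  have hconst : ∀ r ∈ R, zmodCharSum R (b * r) = zmodCharSum R b := by
    intro r hr
    simp only [zmodCharSum, mul_assoc]
    exact sum_mul_left_of_mul_mem hmul hr (fun h => h0 (h ▸ hr))
      (fun u => (ZMod.stdAddChar (b * u) : ℂ))
  have h1 : ∑ r ∈ R, ‖zmodCharSum R (b * r)‖ ^ 2 ≤ ∑ c, ‖zmodCharSum R c‖ ^ 2 := by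
    rw [← sum_image (s := R) (g := (b * ·)) (f := fun c => ‖zmodCharSum R c‖ ^ 2)
      (mul_right_injective₀ hb).injOn]
    exact sum_le_sum_of_subset_of_nonneg (subset_univ _) fun _ _ _ => by positivity
  rw [sum_normSq_zmodCharSum, sum_congr rfl fun r hr => by rw [hconst r hr], sum_const,
    nsmul_eq_mul, mul_comm] at h1
  exact Real.le_sqrt_of_sq_le (le_of_mul_le_mul_right h1 hcard)

lemma card_filter_add_mem_le {R : Finset (ZMod p)} (hR : R.Nonempty) (h0 : (0 : ZMod p) ∉ R)
    (hmul : ∀ r ∈ R, ∀ u ∈ R, r * u ∈ R) {s : ZMod p} (hs : s ≠ 0) :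
    (#{u ∈ R | u + s ∈ R} : ℝ) ≤ (#R : ℝ) ^ 2 / p + √p := by
  have hcard : (0 : ℝ) < #R := by exact_mod_cast hR.card_pos
  have hp : (0 : ℝ) < p := by exact_mod_cast (Fact.out : p.Prime).pos
  have hne : ∀ r ∈ R, r ≠ 0 := fun r hr h => h0 (h ▸ hr)
  have htot := sum_stdAddChar_mul_normSq_zmodCharSum R s
  rw [← add_sum_erase _ _ (mem_univ (0 : ZMod p))] at htot
  have hz : zmodCharSum R 0 = #R := by simp [zmodCharSum]
  rw [hz, zero_mul, AddChar.map_zero_eq_one, one_mul] at htot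
  set E : ℂ := ∑ b ∈ univ.erase (0 : ZMod p),
    ZMod.stdAddChar (b * s) * ((‖zmodCharSum R b‖ ^ 2 : ℝ) : ℂ) with hE
  have hconst : ∀ b, ∀ r ∈ R, zmodCharSum R (b * r) = zmodCharSum R b := by
    intro b r hr
    simp only [zmodCharSum, mul_assoc]
    exact sum_mul_left_of_mul_mem hmul hr (hne r hr)
      (fun u => (ZMod.stdAddChar (b * u) : ℂ))
  have hshift : ∀ r ∈ R, E = ∑ b ∈ univ.erase (0 : ZMod p),
      ZMod.stdAddChar (b * s * r) * ((‖zmodCharSum R b‖ ^ 2 : ℝ) : ℂ) := by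
    intro r hr
    rw [hE]
    symm
    refine sum_bij (fun b _ => b * r) ?_ ?_ ?_ ?_
    · intro b hb
      simp only [mem_erase, mem_univ, and_true] at hb ⊢
      exact mul_ne_zero hb (hne r hr)
    · intro a _ b _ h
      exact mul_right_cancel₀ (hne r hr) h
    · intro b hb
      simp only [mem_erase, mem_univ, and_true] at hb
      exact ⟨b * r⁻¹, by simp [hb, hne r hr], by simp [hne r hr]⟩
    · intro b _
      rw [hconst b r hr, mul_right_comm]
  have hEsum : (#R : ℂ) * E = ∑ b ∈ univ.erase (0 : ZMod p),
      zmodCharSum R (b * s) * ((‖zmodCharSum R b‖ ^ 2 : ℝ) : ℂ) := by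
    rw [← nsmul_eq_mul, ← sum_const, sum_congr rfl hshift, sum_comm]
    refine sum_congr rfl fun b _ => ?_
    rw [← sum_mul]
    rfl
  have hbound : (#R : ℝ) * ‖E‖ ≤ √p * (p * #R) := by
    calc (#R : ℝ) * ‖E‖ = ‖(#R : ℂ) * E‖ := by simp
      _ ≤ ∑ b ∈ univ.erase (0 : ZMod p), √p * ‖zmodCharSum R b‖ ^ 2 := by
        rw [hEsum]
        refine (norm_sum_le _ _).trans (sum_le_sum fun b hb => ?_)
        rw [norm_mul, Complex.norm_real, Real.norm_of_nonneg (by positivity)]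
        refine mul_le_mul_of_nonneg_right (norm_zmodCharSum_le hR h0 hmul ?_) (by positivity)
        exact mul_ne_zero (ne_of_mem_erase hb) hs
      _ ≤ √p * ∑ b, ‖zmodCharSum R b‖ ^ 2 := by
        rw [← mul_sum]
        exact mul_le_mul_of_nonneg_left (sum_le_sum_of_subset_of_nonneg (erase_subset _ _)
          fun _ _ _ => by positivity) (by positivity)
      _ = √p * (p * #R) := by rw [sum_normSq_zmodCharSum]
  have hE' : ‖E‖ ≤ √p * p := by
    refine le_of_mul_le_mul_left ?_ hcard
    linarith
  have hre : (p : ℝ) * #{u ∈ R | u + s ∈ R} = (#R : ℝ) ^ 2 + E.re := by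
    have := congrArg Complex.re htot
    simp only [Complex.add_re, Complex.ofReal_re, Complex.mul_re, Complex.natCast_re,
      Complex.natCast_im, zero_mul, sub_zero, Complex.norm_natCast] at this
    exact this.symm
  have hle : (p : ℝ) * #{u ∈ R | u + s ∈ R} ≤ (#R : ℝ) ^ 2 + √p * p := by
    rw [hre]
    linarith [Complex.re_le_norm E]
  rw [← sub_nonneg]
  have : (#R : ℝ) ^ 2 / p + √p - #{u ∈ R | u + s ∈ R} =
      ((#R : ℝ) ^ 2 + √p * p - p * #{u ∈ R | u + s ∈ R}) / p := by
    field_simp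
  rw [this]
  exact div_nonneg (by linarith) hp.le

end CharacterSums

section PowerResidues
open Finset

/-- The nonzero `k`-th powers modulo `p`. -/
noncomputable def powerResidues (k p : ℕ) [Fact p.Prime] : Finset (ZMod p) :=
  open Classical in {u | u ≠ 0 ∧ ∃ c, c ^ k = u}

variable {k p : ℕ} [Fact p.Prime]

lemma mem_powerResidues {u : ZMod p} : u ∈ powerResidues k p ↔ u ≠ 0 ∧ ∃ c, c ^ k = u := by
  simp [powerResidues]

lemma card_pow_eq_one (hpk : p ≡ 1 [MOD k]) : #{c : ZMod p | c ^ k = 1} = k := by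
  have hp := (Fact.out : p.Prime)
  have hdvd : k ∣ p - 1 := (Nat.modEq_iff_dvd' hp.one_lt.le).1 hpk.symm
  have hk0 : k ≠ 0 := by
    rintro rfl
    have := hp.one_lt
    have := Nat.eq_zero_of_zero_dvd hdvd
    omega
  have h := IsCyclic.card_powMonoidHom_ker (ZMod p)ˣ k
  rw [Nat.card_eq_fintype_card, Nat.card_eq_fintype_card, ZMod.card_units p,
    Nat.gcd_eq_right hdvd] at h
  conv_rhs => rw [← h]
  rw [← Fintype.card_coe]
  refine Fintype.card_congr
    { toFun := fun c => ⟨Units.ofPowEqOne c.1 k (mem_filter.1 c.2).2 hk0, ?_⟩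
      invFun := fun c => ⟨((c : (ZMod p)ˣ) : ZMod p), ?_⟩
      left_inv := ?_
      right_inv := ?_ }
  · simp [MonoidHom.mem_ker]
  · have := c.2
    simp only [MonoidHom.mem_ker, powMonoidHom_apply, Units.ext_iff] at this
    simpa using this
  · intro c
    simp
  · intro c
    ext
    simp

lemma card_pow_eq_of_mem (hpk : p ≡ 1 [MOD k]) {u : ZMod p} (hu : u ∈ powerResidues k p) :
    #{c : ZMod p | c ^ k = u} = k := by
  obtain ⟨hu0, c₀, rfl⟩ := mem_powerResidues.1 hu
  by_cases hk0 : k = 0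
  · subst hk0
    have hp := (Fact.out : p.Prime)
    have := (Nat.modEq_zero_iff.1 hpk)
    exact absurd this hp.ne_one
  have hc : c₀ ≠ 0 := fun h => hu0 (by rw [h, zero_pow hk0])
  conv_rhs => rw [← card_pow_eq_one hpk]
  symm
  refine card_bij (fun c _ => c₀ * c) ?_ ?_ ?_
  · intro c hcm
    simp only [mem_filter, mem_univ, true_and] at hcm ⊢
    rw [mul_pow, hcm, mul_one]
  · intro a _ b _ h
    exact mul_left_cancel₀ hc h
  · intro c hcm
    simp only [mem_filter, mem_univ, true_and] at hcm
    refine ⟨c₀⁻¹ * c, ?_, by simp [hc]⟩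
    simp only [mem_filter, mem_univ, true_and]
    rw [mul_pow, hcm, inv_pow, inv_mul_cancel₀ hu0]

lemma card_pow_eq_le (hpk : p ≡ 1 [MOD k]) (hk : 0 < k) (s : ZMod p) :
    #{c : ZMod p | c ^ k = s} ≤ k := by
  by_cases hs : s ∈ powerResidues k p
  · exact (card_pow_eq_of_mem hpk hs).le
  · by_cases hs0 : s = 0
    · subst hs0
      have : ({c : ZMod p | c ^ k = 0} : Finset (ZMod p)) ⊆ {0} := by
        intro c hc
        simp only [mem_filter, mem_univ, true_and] at hc
        simpa using eq_zero_of_pow_eq_zero hc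
      exact (card_le_card this).trans (by simpa using Nat.succ_le_of_lt hk)
    · rw [card_eq_zero.2]
      · exact hk.le
      · refine filter_eq_empty_iff.2 fun c _ hc => hs (mem_powerResidues.2 ⟨hs0, c, hc⟩)

lemma card_powerResidues_mul (hpk : p ≡ 1 [MOD k]) (hk : 0 < k) :
    #(powerResidues k p) * k = p - 1 := by
  have h : #({c : ZMod p | c ≠ 0} : Finset (ZMod p)) =
      ∑ u ∈ powerResidues k p, #{c ∈ ({c : ZMod p | c ≠ 0} : Finset (ZMod p)) | c ^ k = u} := by
    refine card_eq_sum_card_fiberwise fun c hc => ?_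
    simp only [coe_filter, mem_univ, true_and, Set.mem_ofPred_eq] at hc
    exact mem_powerResidues.2 ⟨pow_ne_zero _ hc, c, rfl⟩
  rw [filter_ne' univ (0 : ZMod p), card_erase_of_mem (mem_univ _), card_univ, ZMod.card] at h
  rw [h, ← smul_eq_mul, ← sum_const]
  refine sum_congr rfl fun u hu => ?_
  refine (card_pow_eq_of_mem hpk hu).symm.trans ?_
  congr 1
  ext c
  simp only [mem_filter, mem_univ, true_and, mem_erase, ne_eq, and_true]
  refine ⟨fun h => ⟨fun h0 => (mem_powerResidues.1 hu).1 ?_, h⟩, fun h => h.2⟩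
  rw [← h, h0, zero_pow hk.ne']

lemma powerResidues_nonempty (k : ℕ) : (powerResidues k p).Nonempty :=
  ⟨1, mem_powerResidues.2 ⟨one_ne_zero, 1, one_pow k⟩⟩

lemma zero_notMem_powerResidues (k : ℕ) : (0 : ZMod p) ∉ powerResidues k p :=
  fun h => (mem_powerResidues.1 h).1 rfl

lemma mul_mem_powerResidues : ∀ r ∈ powerResidues k p, ∀ u ∈ powerResidues k p,
    r * u ∈ powerResidues k p := by
  intro r hr u hu
  obtain ⟨hr0, c, rfl⟩ := mem_powerResidues.1 hr
  obtain ⟨hu0, d, rfl⟩ := mem_powerResidues.1 hu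
  exact mem_powerResidues.2 ⟨mul_ne_zero hr0 hu0, c * d, mul_pow _ _ _⟩

lemma card_powerResidues_le (hpk : p ≡ 1 [MOD k]) (hk : 0 < k) :
    (#(powerResidues k p) : ℝ) ≤ p / k := by
  rw [le_div_iff₀ (by exact_mod_cast hk)]
  have := card_powerResidues_mul hpk hk
  exact_mod_cast this.le.trans (Nat.sub_le _ _)

lemma card_powerResidues_add_le (hpk : p ≡ 1 [MOD k]) (hk : 0 < k) {s : ZMod p} (hs : s ≠ 0) :
    (#{u ∈ powerResidues k p | u + s ∈ powerResidues k p} : ℝ) ≤ p / k ^ 2 + √p := by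
  have hp : (0 : ℝ) < p := by exact_mod_cast (Fact.out : p.Prime).pos
  have hk' : (0 : ℝ) < k := by exact_mod_cast hk
  refine (card_filter_add_mem_le (powerResidues_nonempty k) (zero_notMem_powerResidues k)
    mul_mem_powerResidues hs).trans ?_
  have h : (#(powerResidues k p) : ℝ) ^ 2 ≤ (p / k) ^ 2 :=
    pow_le_pow_left₀ (by positivity) (card_powerResidues_le hpk hk) 2
  have : (#(powerResidues k p) : ℝ) ^ 2 / p ≤ (p / k) ^ 2 / p := by gcongr
  have e : ((p : ℝ) / k) ^ 2 / p = p / k ^ 2 := by field_simp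
  linarith

lemma sum_card_powerResidues_add_le (hpk : p ≡ 1 [MOD k]) (hk : 0 < k) (s : ZMod p) :
    (∑ c : ZMod p, #{u ∈ powerResidues k p | u + (s - c ^ k) ∈ powerResidues k p} : ℝ) ≤
      p * (p / k ^ 2 + √p) + p := by
  have hk' : (0 : ℝ) < k := by exact_mod_cast hk
  have h : ∀ c : ZMod p,
      (#{u ∈ powerResidues k p | u + (s - c ^ k) ∈ powerResidues k p} : ℝ) ≤
        (p / k ^ 2 + √p) + if c ^ k = s then (p / k : ℝ) else 0 := by
    intro c
    split_ifs with hc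
    · have h1 : (#{u ∈ powerResidues k p | u + (s - c ^ k) ∈ powerResidues k p} : ℝ) ≤
          #(powerResidues k p) := by exact_mod_cast card_filter_le _ _
      have := card_powerResidues_le hpk hk
      have : (0 : ℝ) ≤ p / k ^ 2 + √p := by positivity
      linarith
    · rw [add_zero]
      exact card_powerResidues_add_le hpk hk (sub_ne_zero.2 (Ne.symm hc))
  refine (sum_le_sum fun c _ => h c).trans ?_
  rw [sum_add_distrib, sum_const, card_univ, ZMod.card, nsmul_eq_mul, ← sum_filter, sum_const,
    nsmul_eq_mul]
  have h2 : (#{c : ZMod p | c ^ k = s} : ℝ) ≤ k := by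
    exact_mod_cast card_pow_eq_le hpk hk s
  have h3 : (#{c : ZMod p | c ^ k = s} : ℝ) * (p / k) ≤ k * (p / k) := by gcongr
  have h4 : (k : ℝ) * (p / k) = p := by field_simp
  linarith

end PowerResidues

section HitSet
open Finset
open scoped Classical in
/-- The points `x` with `t - x ∈ Λ` for some natural number `t < L`. -/
noncomputable def hitSet {H : Type*} [CommRing H] [Fintype H] (Λ : Finset H) (L : ℕ) :
    Finset H := {x | ∃ t < L, (t : H) - x ∈ Λ}

variable {H : Type*} [CommRing H] [Fintype H] [DecidableEq H] {Λ : Finset H} {L : ℕ}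

omit [DecidableEq H] in
lemma mem_hitSet {x : H} : x ∈ hitSet Λ L ↔ ∃ t < L, (t : H) - x ∈ Λ := by
  simp [hitSet]

lemma card_sub_mem_and_sub_mem (a b : H) :
    #{x : H | a - x ∈ Λ ∧ b - x ∈ Λ} = #{u ∈ Λ | u + (b - a) ∈ Λ} := by
  refine card_bij (fun x _ => a - x) ?_ ?_ ?_
  · intro x hx
    simp only [mem_filter, mem_univ, true_and] at hx ⊢
    exact ⟨hx.1, by simpa using hx.2⟩
  · intro x _ y _ h
    simpa using h
  · intro u hu
    simp only [mem_filter] at hu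
    refine ⟨a - u, ?_, by simp⟩
    simp only [mem_filter, mem_univ, true_and, sub_sub_cancel]
    refine ⟨hu.1, ?_⟩
    have : b - (a - u) = u + (b - a) := by ring
    rw [this]
    exact hu.2

lemma card_sub_mem (a : H) : #{x : H | a - x ∈ Λ} = #Λ := by
  simpa using card_sub_mem_and_sub_mem (Λ := Λ) a a

lemma card_hitSet_ge {B : ℝ} (hB : ∀ t < L, ∀ t' < L, t ≠ t' →
    (#{u ∈ Λ | u + ((t' : H) - t) ∈ Λ} : ℝ) ≤ B) (hB0 : 0 ≤ B) :
    (L : ℝ) * #Λ - L ^ 2 * B / 2 ≤ #(hitSet Λ L) := by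
  set Z : H → ℕ := fun x => #{t ∈ range L | ((t : ℕ) : H) - x ∈ Λ} with hZ
  have hZ1 : ∑ x, (Z x : ℝ) = L * #Λ := by
    have : ∑ x, Z x = L * #Λ := by
      simp_rw [hZ, card_filter]
      rw [sum_comm]
      simp_rw [← card_filter, card_sub_mem]
      simp
    exact_mod_cast this
  have hZ2 : ∑ x, (Z x : ℝ) ^ 2 ≤ L * #Λ + L ^ 2 * B := by
    have h1 : ∑ x, Z x ^ 2 = ∑ t ∈ range L, ∑ t' ∈ range L,
        #{u ∈ Λ | u + ((t' : H) - t) ∈ Λ} := by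
      simp_rw [hZ, card_filter, pow_two, sum_mul_sum]
      rw [sum_comm]
      refine sum_congr rfl fun t _ => ?_
      rw [sum_comm]
      refine sum_congr rfl fun t' _ => ?_
      rw [← card_filter, ← card_sub_mem_and_sub_mem, card_filter]
      refine sum_congr rfl fun x _ => ?_
      by_cases h1 : (t : H) - x ∈ Λ <;> simp [h1]
    have h2 : ∑ x, (Z x : ℝ) ^ 2 = ∑ t ∈ range L, ∑ t' ∈ range L,
        (#{u ∈ Λ | u + ((t' : H) - t) ∈ Λ} : ℝ) := by exact_mod_cast h1
    rw [h2]
    calc _ ≤ ∑ t ∈ range L, ∑ t' ∈ range L, ((if t = t' then (#Λ : ℝ) else 0) + B) := by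
          refine sum_le_sum fun t ht => sum_le_sum fun t' ht' => ?_
          split_ifs with h
          · have : (#{u ∈ Λ | u + ((t' : H) - t) ∈ Λ} : ℝ) ≤ #Λ := by
              exact_mod_cast card_filter_le _ _
            linarith
          · rw [zero_add]
            exact hB t (mem_range.1 ht) t' (mem_range.1 ht') h
      _ = L * #Λ + L ^ 2 * B := by
          simp only [sum_add_distrib, sum_ite_eq, sum_const, card_range, nsmul_eq_mul]
          rw [sum_congr rfl fun t ht => if_pos ht]
          simp only [sum_const, card_range, nsmul_eq_mul]
          ring
  have hpt : ∀ x, (3 * (Z x : ℝ) - (Z x : ℝ) ^ 2) / 2 ≤ if x ∈ hitSet Λ L then 1 else 0 := by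
    intro x
    split_ifs with hx
    · rcases le_or_gt (Z x) 1 with h | h
      · have : (Z x : ℝ) ≤ 1 := by exact_mod_cast h
        nlinarith [mul_nonneg (sub_nonneg.2 this) (by linarith : (0 : ℝ) ≤ 2 - Z x)]
      · have : (2 : ℝ) ≤ Z x := by exact_mod_cast h
        nlinarith
    · have : Z x = 0 := by
        refine card_eq_zero.2 (filter_eq_empty_iff.2 fun t ht h => hx ?_)
        exact mem_hitSet.2 ⟨t, mem_range.1 ht, h⟩
      simp [this]
  have hsum := sum_le_sum fun x (_ : x ∈ univ) => hpt x
  rw [sum_boole, ← sum_div, sum_sub_distrib, ← mul_sum, hZ1] at hsum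
  have : #{x | x ∈ hitSet Λ L} = #(hitSet Λ L) := by simp
  rw [this] at hsum
  linarith

lemma sum_card_add_pow_mem_hitSet_le (k : ℕ) :
    (∑ x ∈ hitSet Λ L, (#{c : H | x + c ^ k ∈ hitSet Λ L} : ℝ)) ≤
      ∑ t ∈ range L, ∑ t' ∈ range L, ∑ c : H,
        (#{u ∈ Λ | u + ((t' : H) - t - c ^ k) ∈ Λ} : ℝ) := by
  have hle : ∑ x ∈ hitSet Λ L, #{c : H | x + c ^ k ∈ hitSet Λ L} ≤
      ∑ t ∈ range L, ∑ t' ∈ range L, ∑ c : H,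
        #{u ∈ Λ | u + ((t' : H) - t - c ^ k) ∈ Λ} := by
    have hpt : ∀ x c : H, (if x ∈ hitSet Λ L then
        (if x + c ^ k ∈ hitSet Λ L then 1 else 0) else 0) ≤
        ∑ t ∈ range L, ∑ t' ∈ range L,
          if (t : H) - x ∈ Λ ∧ (t' : H) - c ^ k - x ∈ Λ then 1 else 0 := by
      intro x c
      split_ifs with h1 h2
      · obtain ⟨t, ht, h1⟩ := mem_hitSet.1 h1
        obtain ⟨t', ht', h2⟩ := mem_hitSet.1 h2
        have h3 : (t' : H) - c ^ k - x ∈ Λ := by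
          have : (t' : H) - c ^ k - x = t' - (x + c ^ k) := by ring
          rw [this]
          exact h2
        calc 1 = if (t : H) - x ∈ Λ ∧ (t' : H) - c ^ k - x ∈ Λ then 1 else 0 := by
              rw [if_pos ⟨h1, h3⟩]
          _ ≤ ∑ t' ∈ range L, if (t : H) - x ∈ Λ ∧ (t' : H) - c ^ k - x ∈ Λ then 1 else 0 :=
              single_le_sum (f := fun t' : ℕ =>
                if (t : H) - x ∈ Λ ∧ (t' : H) - c ^ k - x ∈ Λ then 1 else 0)
                (fun _ _ => Nat.zero_le _) (mem_range.2 ht')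
          _ ≤ _ := single_le_sum (f := fun t : ℕ => ∑ t' ∈ range L,
                if (t : H) - x ∈ Λ ∧ (t' : H) - c ^ k - x ∈ Λ then 1 else 0)
                (fun _ _ => Nat.zero_le _) (mem_range.2 ht)
      · exact Nat.zero_le _
      · exact Nat.zero_le _
    calc ∑ x ∈ hitSet Λ L, #{c : H | x + c ^ k ∈ hitSet Λ L}
        = ∑ x : H, ∑ c : H, (if x ∈ hitSet Λ L then
            (if x + c ^ k ∈ hitSet Λ L then 1 else 0) else 0) := by
          rw [← sum_filter_add_sum_filter_not univ (· ∈ hitSet Λ L) fun x : H => ∑ c : H,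
            (if x ∈ hitSet Λ L then (if x + c ^ k ∈ hitSet Λ L then 1 else 0) else 0)]
          rw [sum_congr (s₁ := univ.filter (· ∉ hitSet Λ L)) rfl fun x hx =>
            sum_congr rfl fun c _ => if_neg (mem_filter.1 hx).2]
          simp only [filter_univ_mem, sum_const_zero, add_zero]
          refine sum_congr rfl fun x hx => ?_
          rw [card_filter]
          exact sum_congr rfl fun c _ => (if_pos hx).symm
      _ ≤ ∑ x : H, ∑ c : H, ∑ t ∈ range L, ∑ t' ∈ range L,
          (if (t : H) - x ∈ Λ ∧ (t' : H) - c ^ k - x ∈ Λ then 1 else 0) :=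
          sum_le_sum fun x _ => sum_le_sum fun c _ => hpt x c
      _ = ∑ t ∈ range L, ∑ t' ∈ range L, ∑ c : H, ∑ x : H,
          (if (t : H) - x ∈ Λ ∧ (t' : H) - c ^ k - x ∈ Λ then 1 else 0) := by
          rw [sum_comm]
          simp_rw [sum_comm (s := (univ : Finset H)) (t := range L)]
      _ = _ := by
          refine sum_congr rfl fun t _ => sum_congr rfl fun t' _ => sum_congr rfl fun c _ => ?_
          rw [← card_filter, card_sub_mem_and_sub_mem]
          congr! 4
          ring
  exact_mod_cast hle

open scoped Classical in
lemma card_shift_mem_hitSet_le (S : ℕ) :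
    #{x : H | x ∉ hitSet Λ L ∧ ∃ s ≤ S, x + (s : H) ∈ hitSet Λ L} ≤ S * #Λ := by
  have hsub : ({x : H | x ∉ hitSet Λ L ∧ ∃ s ≤ S, x + (s : H) ∈ hitSet Λ L} : Finset H) ⊆
      (Icc 1 S).biUnion fun j => {x : H | -(j : H) - x ∈ Λ} := by
    intro x hx
    simp only [mem_filter, mem_univ, true_and] at hx
    obtain ⟨hx, s, hs, hxs⟩ := hx
    obtain ⟨t, ht, h⟩ := mem_hitSet.1 hxs
    simp only [mem_biUnion, mem_Icc, mem_filter, mem_univ, true_and]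
    rcases le_or_gt s t with hst | hst
    · refine absurd (mem_hitSet.2 ⟨t - s, by omega, ?_⟩) hx
      rw [Nat.cast_sub hst, sub_sub, add_comm (s : H)]
      exact h
    · refine ⟨s - t, by omega, ?_⟩
      rw [Nat.cast_sub hst.le]
      have : -((s : H) - t) - x = t - (x + s) := by ring
      rw [this]
      exact h
  refine (card_le_card hsub).trans (card_biUnion_le.trans ?_)
  simp_rw [card_sub_mem]
  simp

end HitSet

section ProductOfPrimeFields
open Finset

variable {ι : Type} [Fintype ι] [DecidableEq ι] {k : ℕ} {p : ι → ℕ} [∀ i, Fact (p i).Prime]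

variable (k p) in
/-- Elements of `∏ ZMod (p i)` all of whose coordinates are nonzero `k`-th powers. -/
noncomputable def piPowerResidues : Finset (∀ i, ZMod (p i)) :=
  Fintype.piFinset fun i => powerResidues k (p i)

lemma card_pow_eq_of_mem_pi (hpk : ∀ i, p i ≡ 1 [MOD k]) {u : ∀ i, ZMod (p i)}
    (hu : u ∈ piPowerResidues k p) :
    #{c : ∀ i, ZMod (p i) | c ^ k = u} = k ^ Fintype.card ι := by
  have : ({c : ∀ i, ZMod (p i) | c ^ k = u} : Finset _) =
      Fintype.piFinset fun i => {c : ZMod (p i) | c ^ k = u i} := by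
    ext c
    simp [funext_iff]
  rw [this, Fintype.card_piFinset,
    prod_congr rfl fun i _ => card_pow_eq_of_mem (hpk i) (Fintype.mem_piFinset.1 hu i)]
  simp

lemma card_piPowerResidues_mul (hpk : ∀ i, p i ≡ 1 [MOD k]) (hk : 0 < k) :
    #(piPowerResidues k p) * k ^ Fintype.card ι = ∏ i, (p i - 1) := by
  rw [piPowerResidues, Fintype.card_piFinset, ← card_univ, ← prod_const, ← prod_mul_distrib]
  exact prod_congr rfl fun i _ => card_powerResidues_mul (hpk i) hk

lemma card_piPowerResidues_mul_le (hpk : ∀ i, p i ≡ 1 [MOD k]) (hk : 0 < k) :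
    (#(piPowerResidues k p) : ℝ) * k ^ Fintype.card ι ≤ ∏ i, (p i : ℝ) := by
  have h := card_piPowerResidues_mul hpk hk
  have h2 : ∏ i, (p i - 1) ≤ ∏ i, p i := prod_le_prod' fun i _ => Nat.sub_le _ _
  exact_mod_cast h.le.trans h2

lemma card_piPowerResidues_mul_ge (hpk : ∀ i, p i ≡ 1 [MOD k]) (hk : 0 < k) {δ : ℝ}
    (hδ0 : 0 ≤ δ) (hδ : δ ≤ 1)
    (hp : ∀ i, 2 * (Fintype.card ι : ℝ) ≤ δ * p i) :
    (1 - δ / 2) * ∏ i, (p i : ℝ) ≤ (#(piPowerResidues k p) : ℝ) * k ^ Fintype.card ι := by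
  have h : (#(piPowerResidues k p) : ℝ) * k ^ Fintype.card ι = ∏ i, ((p i : ℝ) - 1) := by
    have h := congrArg (Nat.cast (R := ℝ)) (card_piPowerResidues_mul hpk hk)
    push_cast at h
    rw [h]
    exact prod_congr rfl fun i _ => by
      rw [Nat.cast_sub (Fact.out : (p i).Prime).one_lt.le, Nat.cast_one]
  rw [h]
  rcases isEmpty_or_nonempty ι with hι | hι
  · simpa using div_nonneg hδ0 zero_le_two
  set m : ℝ := (Fintype.card ι : ℝ) with hm
  have hm1 : (1 : ℝ) ≤ m := by
    rw [hm]
    exact_mod_cast Fintype.card_pos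
  calc (1 - δ / 2) * ∏ i, (p i : ℝ) ≤ (1 - δ / (2 * m)) ^ (Fintype.card ι) * ∏ i, (p i : ℝ) := by
        refine mul_le_mul_of_nonneg_right ?_ (by positivity)
        have := one_add_mul_le_pow (a := -(δ / (2 * m))) ?_ (Fintype.card ι)
        · have e : m * -(δ / (2 * m)) = -(δ / 2) := by field_simp
          rwa [← hm, e, ← sub_eq_add_neg, ← sub_eq_add_neg] at this
        · have : δ / (2 * m) ≤ 2 := by
            rw [div_le_iff₀ (by positivity)]
            nlinarith
          linarith
    _ = ∏ i, ((1 - δ / (2 * m)) * p i) := by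
        rw [prod_mul_distrib, prod_const, card_univ]
    _ ≤ ∏ i, ((p i : ℝ) - 1) := by
        refine prod_le_prod (fun i _ => ?_) fun i _ => ?_
        · refine mul_nonneg ?_ (by positivity)
          have : δ / (2 * m) ≤ 1 := by
            rw [div_le_iff₀ (by positivity)]
            nlinarith
          linarith
        · have h1 := hp i
          have : 1 ≤ δ / (2 * m) * p i := by
            rw [div_mul_eq_mul_div, le_div_iff₀ (by positivity)]
            linarith
          linarith

lemma card_filter_add_mem_piPowerResidues (s : ∀ i, ZMod (p i)) :
    #{u ∈ piPowerResidues k p | u + s ∈ piPowerResidues k p} =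
      ∏ i, #{u ∈ powerResidues k (p i) | u + s i ∈ powerResidues k (p i)} := by
  rw [← Fintype.card_piFinset]
  congr 1
  ext u
  simp only [piPowerResidues, mem_filter, Fintype.mem_piFinset, Pi.add_apply]
  exact forall_and.symm

lemma one_add_pow_card_le_two {x : ℝ} (hx : 0 ≤ x) {m : ℕ} (h : 2 * (m * x) ≤ 1) :
    (1 + x) ^ m ≤ 2 := by
  calc (1 + x) ^ m ≤ Real.exp x ^ m :=
        pow_le_pow_left₀ (by linarith) (by linarith [Real.add_one_le_exp x]) m
    _ = Real.exp (m * x) := (Real.exp_nat_mul x m).symm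
    _ ≤ Real.exp (1 / 2) := Real.exp_le_exp.2 (by linarith)
    _ ≤ 2 := by
        have h1 : Real.exp (1 / 2) ^ 2 = Real.exp 1 := by
          rw [← Real.exp_nat_mul]
          norm_num
        have h2 := Real.exp_one_lt_d9
        nlinarith [Real.exp_pos (1 / 2)]

omit [DecidableEq ι] [∀ i, Fact (p i).Prime] in
lemma prod_le_two_mul_of_sqrt_ge (hk : 0 < k)
    (hp : ∀ i, 4 * Fintype.card ι * (k : ℝ) ^ 2 ≤ √(p i)) :
    ∏ i, ((p i : ℝ) / k ^ 2 + 2 * √(p i)) ≤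
      2 * ((∏ i, (p i : ℝ)) / (k ^ Fintype.card ι) ^ 2) := by
  have hk' : (0 : ℝ) < k := by exact_mod_cast hk
  rcases isEmpty_or_nonempty ι with hι | hι
  · simp
  have hm : (1 : ℝ) ≤ Fintype.card ι := by exact_mod_cast Fintype.card_pos
  set x : ℝ := 1 / (2 * Fintype.card ι) with hx
  have hx0 : 0 ≤ x := by positivity
  calc ∏ i, ((p i : ℝ) / k ^ 2 + 2 * √(p i)) ≤ ∏ i, ((1 + x) * (p i / k ^ 2)) := by
        refine prod_le_prod (fun i _ => by positivity) fun i _ => ?_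
        have h1 : x * (p i / k ^ 2) - 2 * √(p i) =
            (√(p i) * (√(p i) - 4 * Fintype.card ι * (k : ℝ) ^ 2)) *
              (x / k ^ 2) := by
          have : (p i : ℝ) = √(p i) * √(p i) := (Real.mul_self_sqrt (by positivity)).symm
          rw [hx]
          field_simp
          nth_rewrite 1 [this]
          ring
        have h2 : 0 ≤ x * (p i / k ^ 2) - 2 * √(p i) := by
          rw [h1]
          have := sub_nonneg.2 (hp i)
          positivity
        linarith
    _ = (1 + x) ^ Fintype.card ι * ((∏ i, (p i : ℝ)) / (k ^ Fintype.card ι) ^ 2) := by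
        rw [prod_mul_distrib, prod_const, card_univ, prod_div_distrib, prod_const, card_univ,
          ← pow_mul, ← pow_mul, mul_comm 2]
    _ ≤ _ := by
        refine mul_le_mul_of_nonneg_right (one_add_pow_card_le_two hx0 ?_) (by positivity)
        rw [hx]
        field_simp
        rfl

lemma card_piPowerResidues_add_le (hpk : ∀ i, p i ≡ 1 [MOD k]) (hk : 0 < k)
    (hp : ∀ i, 4 * Fintype.card ι * (k : ℝ) ^ 2 ≤ √(p i)) {s : ∀ i, ZMod (p i)}
    (hs : ∀ i, s i ≠ 0) :
    (#{u ∈ piPowerResidues k p | u + s ∈ piPowerResidues k p} : ℝ) ≤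
      2 * ((∏ i, (p i : ℝ)) / (k ^ Fintype.card ι) ^ 2) := by
  rw [card_filter_add_mem_piPowerResidues]
  push_cast
  refine le_trans (prod_le_prod (fun i _ => by positivity) fun i _ => ?_)
    (prod_le_two_mul_of_sqrt_ge hk hp)
  have := card_powerResidues_add_le (hpk i) hk (hs i)
  linarith [Real.sqrt_nonneg (p i)]

lemma sum_card_piPowerResidues_add_le (hpk : ∀ i, p i ≡ 1 [MOD k]) (hk : 0 < k)
    (hp : ∀ i, 4 * Fintype.card ι * (k : ℝ) ^ 2 ≤ √(p i)) (s : ∀ i, ZMod (p i)) :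
    (∑ c : ∀ i, ZMod (p i),
      (#{u ∈ piPowerResidues k p | u + (s - c ^ k) ∈ piPowerResidues k p} : ℝ)) ≤
      2 * ((∏ i, (p i : ℝ)) / k ^ Fintype.card ι) ^ 2 := by
  simp_rw [card_filter_add_mem_piPowerResidues]
  push_cast
  have h := Fintype.prod_sum fun i (c : ZMod (p i)) =>
    (#{u ∈ powerResidues k (p i) | u + (s i - c ^ k) ∈ powerResidues k (p i)} : ℝ)
  simp only [Pi.sub_apply, Pi.pow_apply]
  rw [← h]
  have hle : ∀ i, (∑ c : ZMod (p i),
      (#{u ∈ powerResidues k (p i) | u + (s i - c ^ k) ∈ powerResidues k (p i)} : ℝ)) ≤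
      p i * ((p i : ℝ) / k ^ 2 + 2 * √(p i)) := by
    intro i
    have h1 := sum_card_powerResidues_add_le (hpk i) hk (s i)
    have h2 : (1 : ℝ) ≤ √(p i) := by
      rw [Real.one_le_sqrt]
      exact_mod_cast (Fact.out : (p i).Prime).one_lt.le
    nlinarith [(Nat.cast_nonneg (p i) : (0 : ℝ) ≤ p i)]
  refine (prod_le_prod (fun i _ => by positivity) fun i _ => hle i).trans ?_
  rw [prod_mul_distrib]
  refine (mul_le_mul_of_nonneg_left (prod_le_two_mul_of_sqrt_ge hk hp) (by positivity)).trans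
    (le_of_eq ?_)
  ring

end ProductOfPrimeFields

section ArithmeticConfiguration
open Finset
open scoped Classical

lemma exists_primes_modEq_one {k : ℕ} (hk : 0 < k) (m n : ℕ) :
    ∃ p : Fin m → ℕ, Function.Injective p ∧ ∀ i, (p i).Prime ∧ p i ≡ 1 [MOD k] ∧ n < p i := by
  have hinf : {q : ℕ | (q.Prime ∧ q ≡ 1 [MOD k]) ∧ n < q}.Infinite := by
    have h := Nat.infinite_setOfPred_prime_modEq_one hk.ne'
    refine (h.sdiff (Set.finite_Iic n)).mono ?_
    rintro q ⟨hq, hn⟩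
    exact ⟨hq, not_le.1 hn⟩
  refine ⟨fun i => (hinf.natEmbedding _ (i : ℕ)).1, ?_, fun i => ?_⟩
  · intro i j h
    exact Fin.ext ((hinf.natEmbedding _).injective (Subtype.ext h))
  · obtain ⟨⟨h1, h2⟩, h3⟩ := (hinf.natEmbedding _ (i : ℕ)).2
    exact ⟨h1, h2, h3⟩

lemma addOrderOf_one_pi_zmod {ι : Type} [Fintype ι] [DecidableEq ι] (p : ι → ℕ)
    [∀ i, NeZero (p i)]
    (hp : Pairwise (Function.onFun Nat.Coprime p)) :
    addOrderOf (1 : ∀ i, ZMod (p i)) = Fintype.card (∀ i, ZMod (p i)) := by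
  rw [← map_one (ZMod.prodEquivPi p hp)]
  have := addOrderOf_injective (ZMod.prodEquivPi p hp).toRingHom.toAddMonoidHom
    (ZMod.prodEquivPi p hp).injective 1
  refine this.trans ?_
  rw [ZMod.addOrderOf_one, Fintype.card_pi]
  simp [ZMod.card]

/-- In some finite cyclic ring there are a set `R` of density close to `δ` and a weight `w` of
mean at most `δ` whose averages along `x + c ^ k` are at least `1` for `x ∈ R`, while
`x + c ^ k` rarely returns to `R` and the complement of `R` is nearly invariant under small
shifts. -/
lemma exists_powerShift_configuration {k : ℕ} (hk : 2 ≤ k) {δ : ℝ} (hδ : 0 < δ)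
    (hδ7 : 7 * δ ≤ 1) (S B : ℕ) (hB : 0 < B) :
    ∃ (H : Type) (_ : CommRing H) (_ : Fintype H) (R : Finset H) (w : H → ℝ),
      addOrderOf (1 : H) = Fintype.card H ∧ (Fintype.card H).Coprime B ∧
      (∀ x, 0 ≤ w x) ∧ ∑ x, w x ≤ δ * Fintype.card H ∧
      (#R : ℝ) ≤ δ * Fintype.card H ∧ δ * (1 - 3 * δ) * Fintype.card H ≤ #R ∧
      (∀ x ∈ R, (Fintype.card H : ℝ) ≤ ∑ c, w (x + c ^ k)) ∧
      (∑ x ∈ R, (#{c : H | x + c ^ k ∈ R} : ℝ)) ≤ #R * Fintype.card H / 2 ∧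
      (#{x : H | x ∉ R ∧ ∃ s ≤ S, x + (s : H) ∈ R} : ℝ) ≤ δ ^ 2 * Fintype.card H := by
  have hk0 : 0 < k := by omega
  obtain ⟨m, hm⟩ : ∃ m : ℕ, max (2 / δ ^ 2) (S / δ ^ 2) ≤ (k : ℝ) ^ m := by
    obtain ⟨m, hm⟩ := pow_unbounded_of_one_lt (max (2 / δ ^ 2) (S / δ ^ 2))
      (by exact_mod_cast hk : (1 : ℝ) < k)
    exact ⟨m, hm.le⟩
  set K : ℝ := (k : ℝ) ^ m with hK
  have hKpos : 0 < K := by positivity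
  have hK2 : 2 ≤ δ ^ 2 * K := by
    have := (div_le_iff₀' (by positivity)).1 ((le_max_left _ _).trans hm)
    linarith
  have hKS : S ≤ δ ^ 2 * K := by
    have := (div_le_iff₀' (by positivity)).1 ((le_max_right _ _).trans hm)
    linarith
  set L : ℕ := ⌊δ * K⌋₊ with hL
  have hL1 : (L : ℝ) ≤ δ * K := Nat.floor_le (by positivity)
  have hL2 : δ * K - 1 ≤ L := (Nat.sub_one_lt_floor _).le
  obtain ⟨p, hpinj, hp⟩ := exists_primes_modEq_one hk0 m
    (B + L + (4 * m * k ^ 2) ^ 2 + ⌈2 * m / δ⌉₊)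
  have : ∀ i, Fact (p i).Prime := fun i => ⟨(hp i).1⟩
  have hpk : ∀ i, p i ≡ 1 [MOD k] := fun i => (hp i).2.1
  have hpB : ∀ i, B < p i := fun i => by have := (hp i).2.2; omega
  have hpL : ∀ i, L < p i := fun i => by have := (hp i).2.2; omega
  have hps : ∀ i, 4 * Fintype.card (Fin m) * (k : ℝ) ^ 2 ≤ √(p i) := fun i => by
    rw [Fintype.card_fin]
    refine Real.le_sqrt_of_sq_le ?_
    have h1 : (4 * m * k ^ 2) ^ 2 ≤ p i := by have := (hp i).2.2; omega
    exact_mod_cast h1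
  have hpδ : ∀ i, 2 * (Fintype.card (Fin m) : ℝ) ≤ δ * p i := fun i => by
    rw [Fintype.card_fin]
    have h1 : ⌈2 * m / δ⌉₊ ≤ p i := by have := (hp i).2.2; omega
    have h2 := Nat.ceil_le.1 h1
    rw [div_le_iff₀ hδ] at h2
    linarith
  have hcop : Pairwise (Function.onFun Nat.Coprime p) := fun i j hij =>
    (Nat.coprime_primes (hp i).1 (hp j).1).2 (hpinj.ne hij)
  set Q : ℝ := ∏ i, (p i : ℝ) with hQ
  have hQpos : 0 < Q := prod_pos fun i _ => by exact_mod_cast (hp i).1.pos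
  have hcard : Fintype.card (∀ i, ZMod (p i)) = ∏ i, p i := by
    rw [Fintype.card_pi]
    simp [ZMod.card]
  have hcardQ : (Fintype.card (∀ i, ZMod (p i)) : ℝ) = Q := by
    rw [hcard, hQ]
    push_cast
    rfl
  set Λ := piPowerResidues k p with hΛ
  have hΛ1 : (#Λ : ℝ) * K ≤ Q := by
    simpa [hK] using card_piPowerResidues_mul_le hpk hk0
  have hΛ2 : (1 - δ / 2) * Q ≤ (#Λ : ℝ) * K := by
    simpa [hK] using card_piPowerResidues_mul_ge hpk hk0 hδ.le (by linarith) hpδ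
  have hpair : ∀ t < L, ∀ t' < L, t ≠ t' →
      (#{u ∈ Λ | u + ((t' : ∀ i, ZMod (p i)) - t) ∈ Λ} : ℝ) ≤ 2 * (Q / K ^ 2) := by
    intro t ht t' ht' hne
    have := card_piPowerResidues_add_le hpk hk0 hps (s := (t' : ∀ i, ZMod (p i)) - t) ?_
    · rw [Fintype.card_fin] at this
      convert this
    · intro i h
      simp only [Pi.sub_apply, Pi.natCast_apply, sub_eq_zero] at h
      rw [ZMod.natCast_eq_natCast_iff'] at h
      rw [Nat.mod_eq_of_lt (ht.trans (hpL i)), Nat.mod_eq_of_lt (ht'.trans (hpL i))] at h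
      exact hne h.symm
  set R := hitSet Λ L with hR
  set w : (∀ i, ZMod (p i)) → ℝ := fun x => if ∃ t < L, x = (t : ∀ i, ZMod (p i)) then Q / K else 0
    with hw
  have hw0 : ∀ x, 0 ≤ w x := fun x => by
    simp only [hw]
    split_ifs <;> positivity
  have hwsum : ∑ x, w x ≤ δ * Q := by
    have h1 : #{x : ∀ i, ZMod (p i) | ∃ t < L, x = (t : ∀ i, ZMod (p i))} ≤ L := by
      have : ({x | ∃ t < L, x = (t : ∀ i, ZMod (p i))} : Finset (∀ i, ZMod (p i))) ⊆
          (range L).image fun t : ℕ => (t : ∀ i, ZMod (p i)) := by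
        intro x hx
        obtain ⟨t, ht, rfl⟩ := (mem_filter.1 hx).2
        exact mem_image.2 ⟨t, mem_range.2 ht, rfl⟩
      exact (card_le_card this).trans (card_image_le.trans (card_range L).le)
    have h2 : (#{x : ∀ i, ZMod (p i) | ∃ t < L, x = (t : ∀ i, ZMod (p i))} : ℝ) ≤ δ * K :=
      (by exact_mod_cast h1 : _ ≤ (L : ℝ)).trans hL1
    calc ∑ x, w x = #{x : ∀ i, ZMod (p i) | ∃ t < L, x = (t : ∀ i, ZMod (p i))} * (Q / K) := by
          simp only [hw]
          rw [← sum_filter, sum_const, nsmul_eq_mul]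
      _ ≤ δ * K * (Q / K) := mul_le_mul_of_nonneg_right h2 (by positivity)
      _ = δ * Q := by field_simp
  have hhit : ∀ x ∈ R, Q ≤ ∑ c, w (x + c ^ k) := by
    intro x hx
    obtain ⟨t, ht, hxt⟩ := mem_hitSet.1 hx
    have h1 := card_pow_eq_of_mem_pi hpk hxt
    rw [Fintype.card_fin] at h1
    calc Q = #{c : ∀ i, ZMod (p i) | c ^ k = (t : ∀ i, ZMod (p i)) - x} * (Q / K) := by
          have h2 : (#{c : ∀ i, ZMod (p i) | c ^ k = (t : ∀ i, ZMod (p i)) - x} : ℝ) = K := by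
            rw [hK]
            norm_cast
          rw [h2]
          field_simp
      _ = ∑ c : ∀ i, ZMod (p i), if c ^ k = (t : ∀ i, ZMod (p i)) - x then Q / K else 0 := by
          rw [← sum_filter, sum_const, nsmul_eq_mul]
      _ ≤ ∑ c, w (x + c ^ k) := by
          refine sum_le_sum fun c _ => ?_
          split_ifs with hc
          · simp only [hw]
            rw [if_pos ⟨t, ht, by rw [hc]; ring⟩]
          · exact hw0 _
  have hRge : δ * (1 - 3 * δ) * Q ≤ #R := by
    have h := card_hitSet_ge (Λ := Λ) (L := L) (B := 2 * (Q / K ^ 2)) ?_ (by positivity)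
    · have h1 : (L : ℝ) ^ 2 * (2 * (Q / K ^ 2)) / 2 ≤ δ ^ 2 * Q := by
        have : (L : ℝ) ^ 2 ≤ (δ * K) ^ 2 := pow_le_pow_left₀ (by positivity) hL1 2
        calc (L : ℝ) ^ 2 * (2 * (Q / K ^ 2)) / 2 = (L : ℝ) ^ 2 * (Q / K ^ 2) := by ring
          _ ≤ (δ * K) ^ 2 * (Q / K ^ 2) := mul_le_mul_of_nonneg_right this (by positivity)
          _ = δ ^ 2 * Q := by field_simp
      have h2 : (δ - δ ^ 2 / 2) * ((1 - δ / 2) * Q) ≤ L * #Λ := by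
        have h3 : (δ - δ ^ 2 / 2) * K ≤ L := by linarith
        calc (δ - δ ^ 2 / 2) * ((1 - δ / 2) * Q) ≤ (δ - δ ^ 2 / 2) * (#Λ * K) :=
              mul_le_mul_of_nonneg_left hΛ2 (by nlinarith)
          _ = ((δ - δ ^ 2 / 2) * K) * #Λ := by ring
          _ ≤ _ := mul_le_mul_of_nonneg_right h3 (by positivity)
      have h4 : δ * (1 - 3 * δ) * Q ≤ (δ - δ ^ 2 / 2) * ((1 - δ / 2) * Q) - δ ^ 2 * Q := by
        have : 0 ≤ (δ ^ 2 + δ ^ 3 / 4) * Q := by positivity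
        nlinarith
      linarith
    · intro t ht t' ht' hne
      convert hpair t ht t' ht' hne
  have hRle : (#R : ℝ) ≤ δ * Q := by
    have h1 : (#R : ℝ) * Q ≤ (δ * Q) * Q := by
      calc (#R : ℝ) * Q = ∑ x ∈ R, Q := by rw [sum_const, nsmul_eq_mul]
        _ ≤ ∑ x ∈ R, ∑ c, w (x + c ^ k) := sum_le_sum hhit
        _ ≤ ∑ x, ∑ c, w (x + c ^ k) := sum_le_sum_of_subset_of_nonneg (subset_univ _)
            fun _ _ _ => sum_nonneg fun _ _ => hw0 _
        _ = ∑ c : ∀ i, ZMod (p i), ∑ x, w x := by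
            rw [sum_comm]
            refine sum_congr rfl fun c _ => ?_
            exact Equiv.sum_comp (Equiv.addRight (c ^ k)) w
        _ = (∑ x, w x) * Q := by
            rw [sum_const, nsmul_eq_mul, card_univ, hcardQ, mul_comm]
        _ ≤ _ := mul_le_mul_of_nonneg_right hwsum hQpos.le
    exact le_of_mul_le_mul_right h1 hQpos
  refine ⟨∀ i, ZMod (p i), Pi.commRing, Pi.instFintype, R, w,
    addOrderOf_one_pi_zmod p hcop, ?_, hw0, ?_, ?_, ?_, ?_, ?_, ?_⟩
  · rw [hcard]
    exact Nat.Coprime.prod_left fun i _ => ((hp i).1.coprime_iff_not_dvd).2 fun h =>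
      absurd (Nat.le_of_dvd hB h) (not_le.2 (hpB i))
  · rwa [hcardQ]
  · rwa [hcardQ]
  · rwa [hcardQ]
  · rwa [hcardQ]
  · have h := sum_card_add_pow_mem_hitSet_le (Λ := Λ) (L := L) k
    rw [hcardQ]
    have h1 : ∑ t ∈ range L, ∑ t' ∈ range L, ∑ c : ∀ i, ZMod (p i),
        (#{u ∈ Λ | u + ((t' : ∀ i, ZMod (p i)) - t - c ^ k) ∈ Λ} : ℝ) ≤
        L ^ 2 * (2 * (Q / K) ^ 2) := by
      calc _ ≤ ∑ t ∈ range L, ∑ t' ∈ range L, (2 * (Q / K) ^ 2) := by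
            refine sum_le_sum fun t _ => sum_le_sum fun t' _ => ?_
            have := sum_card_piPowerResidues_add_le hpk hk0 hps
              ((t' : ∀ i, ZMod (p i)) - t)
            rw [Fintype.card_fin] at this
            convert this
        _ = _ := by
            simp only [sum_const, card_range, nsmul_eq_mul]
            ring
    have h2 : (L : ℝ) ^ 2 * (2 * (Q / K) ^ 2) ≤ 2 * δ ^ 2 * Q ^ 2 := by
      have : (L : ℝ) ^ 2 ≤ (δ * K) ^ 2 := pow_le_pow_left₀ (by positivity) hL1 2
      calc (L : ℝ) ^ 2 * (2 * (Q / K) ^ 2) ≤ (δ * K) ^ 2 * (2 * (Q / K) ^ 2) :=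
            mul_le_mul_of_nonneg_right this (by positivity)
        _ = 2 * δ ^ 2 * Q ^ 2 := by field_simp
    have h3 : 2 * δ ^ 2 * Q ^ 2 ≤ #R * Q / 2 := by
      have h4 : 4 * δ ^ 2 * Q ≤ #R := by
        refine le_trans ?_ hRge
        have : 0 ≤ δ * (1 - 7 * δ) * Q := by
          have := sub_nonneg.2 hδ7
          positivity
        linarith
      nlinarith
    refine le_trans (le_of_eq ?_) (h.trans (h1.trans (h2.trans h3)))
    congr!
  · rw [hcardQ]
    have h := card_shift_mem_hitSet_le (Λ := Λ) (L := L) S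
    have h1 : (S : ℝ) * #Λ ≤ δ ^ 2 * Q := by
      calc (S : ℝ) * #Λ ≤ δ ^ 2 * K * #Λ := mul_le_mul_of_nonneg_right hKS (by positivity)
        _ = δ ^ 2 * (#Λ * K) := by ring
        _ ≤ _ := mul_le_mul_of_nonneg_left hΛ1 (by positivity)
    refine le_trans ?_ h1
    rw [← Nat.cast_mul]
    refine Nat.cast_le.2 (le_trans (le_of_eq ?_) h)
    congr!

end ArithmeticConfiguration

section PowerAverages
open Finset

lemma sum_range_mul_eq {M : Type*} [AddCommMonoid M] (f : ℕ → M) (a b : ℕ) :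
    ∑ m ∈ range (a * b), f m = ∑ c ∈ range b, ∑ l ∈ range a, f (c + b * l) := by
  induction a with
  | zero => simp
  | succ a ih =>
    simp_rw [sum_range_succ, sum_add_distrib]
    rw [Nat.succ_mul, sum_range_add, ih]
    congr 1
    exact sum_congr rfl fun c _ => by rw [Nat.mul_comm, Nat.add_comm]

lemma sum_range_add_mul_of_periodic {M : Type*} [AddCommMonoid M] {φ : ℕ → M} {n : ℕ}
    (hn : 0 < n) (hφ : ∀ i j, i ≡ j [MOD n] → φ i = φ j) {q : ℕ} (hq : n.Coprime q) (a : ℕ) :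
    ∑ c ∈ range n, φ (a + q * c) = ∑ c ∈ range n, φ c := by
  have hinj : Set.InjOn (fun c => (a + q * c) % n) (range n : Set ℕ) := by
    intro c hc d hd h
    have h1 : q * c ≡ q * d [MOD n] := Nat.ModEq.add_left_cancel' a h
    have h2 : c ≡ d [MOD n] := Nat.ModEq.cancel_left_of_coprime hq h1
    exact Nat.ModEq.eq_of_lt_of_lt h2 (mem_range.1 hc) (mem_range.1 hd)
  have himg : (range n).image (fun c => (a + q * c) % n) = range n := by
    refine eq_of_subset_of_card_le ?_ (card_image_of_injOn hinj).ge
    intro x hx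
    obtain ⟨c, _, rfl⟩ := mem_image.1 hx
    exact mem_range.2 (Nat.mod_lt _ hn)
  conv_rhs => rw [← himg]
  rw [sum_image hinj]
  exact sum_congr rfl fun c _ => hφ _ _ (Nat.mod_modEq _ _).symm

lemma sum_range_card_nsmul {G M : Type*} [AddCommGroup G] [Fintype G] [AddCommMonoid M] {e : G}
    (he : addOrderOf e = Fintype.card G) (φ : G → M) :
    ∑ c ∈ range (Fintype.card G), φ (c • e) = ∑ x, φ x := by
  classical
  have hinj : Set.InjOn (fun c : ℕ => c • e) (range (Fintype.card G) : Set ℕ) := by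
    intro c hc d hd h
    refine nsmul_injOn_Iio_addOrderOf ?_ ?_ h
    · rw [he]; exact mem_range.1 hc
    · rw [he]; exact mem_range.1 hd
  have himg : (range (Fintype.card G)).image (fun c : ℕ => c • e) = univ := by
    refine eq_univ_of_card _ ?_
    rw [card_image_of_injOn hinj, card_range]
  rw [← himg, sum_image hinj]

lemma sum_range_mul_card_natCast {H M : Type*} [CommRing H] [Fintype H] [AddCommMonoid M]
    (h1 : addOrderOf (1 : H) = Fintype.card H) (A : ℕ) (φ : H → M) :
    ∑ c ∈ range (A * Fintype.card H), φ (c : H) = A • ∑ x, φ x := by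
  rw [sum_range_mul_eq, ← sum_range_card_nsmul h1, ← sum_nsmul]
  refine sum_congr rfl fun c _ => ?_
  rw [sum_congr rfl fun l _ => by
    rw [Nat.cast_add, Nat.cast_mul, Nat.cast_card_eq_zero, zero_mul, add_zero]]
  rw [sum_const, card_range, nsmul_one]

lemma pow_nsmul_eq_of_modEq {G : Type*} [AddCommGroup G] [Fintype G] (e : G) {n : ℕ}
    (hn : Fintype.card G ∣ n) {i j : ℕ} (h : i ≡ j [MOD n]) (k : ℕ) :
    i ^ k • e = j ^ k • e := by
  have h1 : i ^ k ≡ j ^ k [MOD addOrderOf e] :=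
    ((h.pow k).of_dvd hn).of_dvd addOrderOf_dvd_card
  exact (nsmul_eq_nsmul_iff_modEq).2 h1

/-- The average of `f` along `x + (a + q * m) ^ k • e` for `m < N`. -/
noncomputable def powerAvg {G : Type*} [AddCommGroup G] (k : ℕ) (e : G) (q a N : ℕ) (f : G → ℝ)
    (x : G) : ℝ :=
  (N : ℝ)⁻¹ * ∑ m ∈ range N, f (x + (a + q * m) ^ k • e)

lemma powerAvg_nonneg {G : Type*} [AddCommGroup G] {k : ℕ} {e : G} {q a N : ℕ} {f : G → ℝ}
    (hf : ∀ x, 0 ≤ f x) (x : G) : 0 ≤ powerAvg k e q a N f x :=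
  mul_nonneg (by positivity) (sum_nonneg fun _ _ => hf _)

lemma add_mul_le_average_of_periodic {φ ω h : ℕ → ℝ} {M q a N : ℕ} {s : ℝ} (hM : 0 < M)
    (hφ : ∀ i j, i ≡ j [MOD M] → φ i = φ j) (hω : ∀ i j, i ≡ j [MOD M] → ω i = ω j)
    (hω0 : ∀ i, 0 ≤ ω i) (hMq : M.Coprime q) (ha : 1 ≤ a) (haq : a ≤ q)
    (hs : ∀ b, 1 ≤ b → b ≤ q * M → s ≤ (N : ℝ)⁻¹ * ∑ l ∈ range N, h (b + q * M * l))
    (hN : 0 < N) :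
    (M : ℝ)⁻¹ * ∑ c ∈ range M, φ c + ((M : ℝ)⁻¹ * ∑ c ∈ range M, ω c) * s ≤
      ((N * M : ℕ) : ℝ)⁻¹ *
        ∑ m ∈ range (N * M), (φ (a + q * m) + ω (a + q * m) * h (a + q * m)) := by
  have hM' : (0 : ℝ) < M := by exact_mod_cast hM
  have hN' : (0 : ℝ) < N := by exact_mod_cast hN
  rw [sum_range_mul_eq, ← sum_range_add_mul_of_periodic hM hφ hMq a,
    ← sum_range_add_mul_of_periodic hM hω hMq a]
  have hmod : ∀ c l, a + q * (c + M * l) ≡ a + q * c [MOD M] := by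
    intro c l
    refine Nat.ModEq.add_left _ (Nat.ModEq.mul_left _ ?_)
    simp [Nat.ModEq]
  have hterm : ∀ c ∈ range M, N * φ (a + q * c) + ω (a + q * c) * (N * s) ≤
      ∑ l ∈ range N, (φ (a + q * (c + M * l)) + ω (a + q * (c + M * l)) *
        h (a + q * (c + M * l))) := by
    intro c hc
    rw [mem_range] at hc
    have h1 := hs (a + q * c) (by omega) (by nlinarith)
    rw [inv_mul_eq_div, le_div_iff₀' hN'] at h1
    calc N * φ (a + q * c) + ω (a + q * c) * (N * s)
        ≤ N * φ (a + q * c) + ω (a + q * c) * ∑ l ∈ range N, h (a + q * c + q * M * l) := by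
          gcongr
          exact hω0 _
      _ = _ := by
          rw [mul_sum, sum_add_distrib]
          congr 1
          · rw [sum_congr rfl fun l _ => hφ _ _ (hmod c l), sum_const, card_range, nsmul_eq_mul]
          · refine sum_congr rfl fun l _ => ?_
            rw [hω _ _ (hmod c l)]
            congr 2
            ring
  have := sum_le_sum hterm
  rw [sum_add_distrib, ← mul_sum, ← sum_mul] at this
  rw [inv_mul_eq_div, inv_mul_eq_div, inv_mul_eq_div, le_div_iff₀ (by push_cast; positivity)]
  push_cast
  refine le_trans (le_of_eq ?_) this
  field_simp

end PowerAverages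

section PowerAvgSystem
open Finset
open scoped Classical

/-- A finite cyclic group of order coprime to `q` with a function `f` whose averages along
`k`-th powers of any residue class modulo `q`, taken up to a time `N`, dominate `S`.
The mean of `f` is at most `U`, that of `exp (-S)` at most `Φ`, and `f` dominates a function
`g ≤ 1` of mean at least `γ`. -/
structure PowerAvgSystem (k q : ℕ) (U γ Φ : ℝ) where
  G : Type
  [addCommGroup : AddCommGroup G]
  [fintype : Fintype G]
  e : G
  f : G → ℝ
  g : G → ℝ
  S : G → ℝ
  N : G → ℕ
  addOrderOf_e : addOrderOf e = Fintype.card G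
  coprime : (Fintype.card G).Coprime q
  g_nonneg : ∀ x, 0 ≤ g x
  g_le_f : ∀ x, g x ≤ f x
  g_le_one : ∀ x, g x ≤ 1
  S_nonneg : ∀ x, 0 ≤ S x
  N_pos : ∀ x, 0 < N x
  sum_f_le : ∑ x, f x ≤ U * Fintype.card G
  le_sum_g : γ * Fintype.card G ≤ ∑ x, g x
  sum_exp_le : ∑ x, Real.exp (-S x) ≤ Φ * Fintype.card G
  S_le : ∀ x a, 1 ≤ a → a ≤ q → S x ≤ powerAvg k e q a (N x) f x

attribute [instance] PowerAvgSystem.addCommGroup PowerAvgSystem.fintype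

lemma PowerAvgSystem.f_nonneg {k q : ℕ} {U γ Φ : ℝ} (s : PowerAvgSystem k q U γ Φ) (x : s.G) :
    0 ≤ s.f x := (s.g_nonneg x).trans (s.g_le_f x)

section Core

variable {G H : Type} [AddCommGroup G] [Fintype G] [CommRing H] [Fintype H]

/-- The average over `n` modulo `|G| |H|` of `g (y + n ^ k • e)` restricted to those `n` for
which `x + n ^ k` lies outside `R`. -/
noncomputable def coreAvg (k : ℕ) (e : G) (g : G → ℝ) (R : Finset H) (y : G) (x : H) : ℝ :=
  ((Fintype.card G * Fintype.card H : ℕ) : ℝ)⁻¹ *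
    ∑ c ∈ range (Fintype.card G * Fintype.card H),
      if x + (c : H) ^ k ∈ R then 0 else g (y + c ^ k • e)

variable {k : ℕ} {e : G} {g : G → ℝ} {R : Finset H}

lemma coreAvg_nonneg (hg : ∀ y, 0 ≤ g y) (y : G) (x : H) : 0 ≤ coreAvg k e g R y x := by
  refine mul_nonneg (by positivity) (sum_nonneg fun c _ => ?_)
  split_ifs
  · exact le_rfl
  · exact hg _

lemma coreAvg_le_one (hg1 : ∀ y, g y ≤ 1) (y : G) (x : H) : coreAvg k e g R y x ≤ 1 := by
  have hM : (0 : ℝ) < (Fintype.card G * Fintype.card H : ℕ) := by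
    have h1 : 0 < Fintype.card G := Fintype.card_pos
    have h2 : 0 < Fintype.card H := Fintype.card_pos
    exact_mod_cast Nat.mul_pos h1 h2
  rw [coreAvg, inv_mul_eq_div, div_le_one hM]
  refine (sum_le_card_nsmul _ _ 1 fun c _ => ?_).trans (by simp)
  split_ifs
  · exact zero_le_one
  · exact hg1 _

lemma sum_coreAvg (h1 : addOrderOf (1 : H) = Fintype.card H) (x : H) :
    (∑ y, coreAvg k e g R y x) * Fintype.card H =
      (∑ y, g y) * #{c : H | x + c ^ k ∉ R} := by
  have hG : (Fintype.card G : ℝ) ≠ 0 := by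
    exact_mod_cast Fintype.card_ne_zero
  have hH : (Fintype.card H : ℝ) ≠ 0 := by
    exact_mod_cast Fintype.card_ne_zero
  simp_rw [coreAvg]
  rw [← mul_sum, sum_comm]
  set ψ : H → ℝ := fun c => if x + c ^ k ∈ R then 0 else ∑ y, g y with hψ
  have hc : ∀ c : ℕ, (∑ y, if x + (c : H) ^ k ∈ R then 0 else g (y + c ^ k • e)) = ψ c := by
    intro c
    simp only [hψ]
    split_ifs
    · simp
    · exact Equiv.sum_comp (Equiv.addRight (c ^ k • e)) g
  rw [sum_congr rfl fun c _ => hc c, sum_range_mul_card_natCast h1]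
  have : ∑ c, ψ c = (∑ y, g y) * #{c : H | x + c ^ k ∉ R} := by
    rw [sum_congr rfl fun c _ => (ite_not (x + c ^ k ∈ R) (∑ y, g y) 0).symm]
    rw [← sum_filter, sum_const, nsmul_eq_mul, mul_comm]
  rw [this, nsmul_eq_mul]
  push_cast
  field_simp

lemma sum_exp_neg_coreAvg_le (hg : ∀ y, 0 ≤ g y) (hg1 : ∀ y, g y ≤ 1) (x : H) :
    ∑ y, Real.exp (-coreAvg k e g R y x) ≤
      Fintype.card G - (∑ y, coreAvg k e g R y x) / 2 := by
  have h : ∀ y, Real.exp (-coreAvg k e g R y x) ≤ 1 - coreAvg k e g R y x / 2 := by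
    intro y
    set t := coreAvg k e g R y x with ht
    have h0 : 0 ≤ t := coreAvg_nonneg hg y x
    have h1 : t ≤ 1 := coreAvg_le_one hg1 y x
    have h2 : Real.exp (-t) * (1 + t) ≤ 1 := by
      calc Real.exp (-t) * (1 + t) ≤ Real.exp (-t) * Real.exp t := by
            gcongr
            linarith [Real.add_one_le_exp t]
        _ = 1 := by rw [← Real.exp_add]; simp
    have h3 : 1 ≤ (1 - t / 2) * (1 + t) := by nlinarith
    exact le_of_mul_le_mul_right (h2.trans h3) (by linarith)
  refine (sum_le_sum fun y _ => h y).trans (le_of_eq ?_)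
  rw [sum_sub_distrib, ← sum_div]
  simp

lemma sum_sum_exp_neg_coreAvg_le (h1 : addOrderOf (1 : H) = Fintype.card H)
    (hg : ∀ y, 0 ≤ g y) (hg1 : ∀ y, g y ≤ 1) {γ : ℝ}
    (hγ : γ * Fintype.card G ≤ ∑ y, g y)
    (hR : (∑ x ∈ R, (#{c : H | x + c ^ k ∈ R} : ℝ)) ≤ #R * Fintype.card H / 2) :
    ∑ x ∈ R, ∑ y, Real.exp (-coreAvg k e g R y x) ≤
      #R * Fintype.card G * (1 - γ / 4) := by
  have hH : (0 : ℝ) < Fintype.card H := by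
    exact_mod_cast Fintype.card_pos
  have hout : #R * Fintype.card H / 2 ≤ (∑ x ∈ R, (#{c : H | x + c ^ k ∉ R} : ℝ)) := by
    have : ∀ x ∈ R, (#{c : H | x + c ^ k ∉ R} : ℝ) =
        Fintype.card H - #{c : H | x + c ^ k ∈ R} := by
      intro x _
      rw [eq_sub_iff_add_eq, add_comm]
      exact_mod_cast card_filter_add_card_filter_not (s := (univ : Finset H)) fun c => x + c ^ k ∈ R
    rw [sum_congr rfl this, sum_sub_distrib, sum_const, nsmul_eq_mul]
    linarith
  have hsum : γ * Fintype.card G * #R / 2 ≤ ∑ x ∈ R, ∑ y, coreAvg k e g R y x := by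
    refine le_of_mul_le_mul_right ?_ hH
    rw [sum_mul, sum_congr rfl fun x _ => sum_coreAvg h1 x, ← mul_sum]
    calc γ * Fintype.card G * #R / 2 * Fintype.card H =
          γ * Fintype.card G * (#R * Fintype.card H / 2) := by ring
      _ ≤ _ := mul_le_mul hγ hout (by positivity) (sum_nonneg fun y _ => hg y)
  refine (sum_le_sum fun x _ => sum_exp_neg_coreAvg_le hg hg1 x).trans ?_
  rw [sum_sub_distrib, sum_const, nsmul_eq_mul, ← sum_div]
  linarith

end Core

end PowerAvgSystem

section Combine
open Finset
open scoped Classical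

variable {G H G' : Type} [AddCommGroup G] [Fintype G] [CommRing H] [Fintype H]
  [AddCommGroup G'] [Fintype G']

/-- The function equal to `f` outside `R`, plus the product of a weight on `H` and `f'`. -/
noncomputable def combineFun (R : Finset H) (w : H → ℝ) (f : G → ℝ) (f' : G' → ℝ) :
    G × H × G' → ℝ :=
  fun p => (if p.2.1 ∈ R then 0 else f p.1) + w p.2.1 * f' p.2.2

/-- The lower bound for the averages of `combineFun`. -/
noncomputable def combineBound (k : ℕ) (e : G) (g : G → ℝ) (R : Finset H) (n : ℕ) (S : G → ℝ)
    (S' : G' → ℝ) : G × H × G' → ℝ :=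
  fun p => if p.2.1 ∈ R then coreAvg k e g R p.1 p.2.1 + S' p.2.2 else
    if ∃ s ≤ n, p.2.1 + (s : H) ∈ R then 0 else S p.1

/-- The time at which the averages of `combineFun` exceed `combineBound`. -/
noncomputable def combineTime (R : Finset H) (n : ℕ) (N : G → ℕ) (N' : G' → ℕ) :
    G × H × G' → ℕ :=
  fun p => if p.2.1 ∈ R then N' p.2.2 * (Fintype.card G * Fintype.card H) else
    if ∃ s ≤ n, p.2.1 + (s : H) ∈ R then 1 else N p.1

variable {k n : ℕ} {e : G} {e' : G'} {R : Finset H} {w : H → ℝ} {f g S : G → ℝ} {f' S' : G' → ℝ}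
  {N : G → ℕ} {N' : G' → ℕ}

omit [CommRing H] in
lemma sum_ite_mem_zero (c : ℝ) :
    (∑ x : H, if x ∈ R then 0 else c) = (Fintype.card H - #R) * c := by
  have h : (∑ x : H, if x ∈ R then 0 else c) = ∑ x : H, (c - if x ∈ R then c else 0) :=
    sum_congr rfl fun x _ => by split_ifs <;> simp
  rw [h, sum_sub_distrib, sum_ite_mem]
  simp only [sum_const, card_univ, nsmul_eq_mul, univ_inter]
  ring

omit [AddCommGroup G] [CommRing H] [AddCommGroup G'] in
lemma sum_combineFun : ∑ p, combineFun R w f f' p =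
    (Fintype.card H - #R) * (∑ y, f y) * Fintype.card G' +
      Fintype.card G * (∑ x, w x) * ∑ z, f' z := by
  simp only [combineFun, sum_add_distrib]
  congr 1
  · have h : ∀ y, (∑ x : H, ∑ _z : G', if x ∈ R then 0 else f y) =
        (Fintype.card H - #R) * f y * Fintype.card G' := by
      intro y
      rw [sum_comm, sum_const, card_univ, nsmul_eq_mul, sum_ite_mem_zero, mul_comm]
    simp only [Fintype.sum_prod_type, h]
    rw [← sum_mul, ← mul_sum]
  · simp only [Fintype.sum_prod_type, sum_const, card_univ, nsmul_eq_mul, ← mul_sum,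
      ← sum_mul]
    ring

lemma sum_exp_neg_combineBound_le (h1 : addOrderOf (1 : H) = Fintype.card H)
    (hg : ∀ y, 0 ≤ g y) (hg1 : ∀ y, g y ≤ 1) {γ δ Φ Ψ : ℝ}
    (hγ : γ * Fintype.card G ≤ ∑ y, g y)
    (hR : (∑ x ∈ R, (#{c : H | x + c ^ k ∈ R} : ℝ)) ≤ #R * Fintype.card H / 2)
    (hbad : (#{x : H | x ∉ R ∧ ∃ s ≤ n, x + (s : H) ∈ R} : ℝ) ≤ δ * Fintype.card H)
    (hS : ∑ y, Real.exp (-S y) ≤ Ψ * Fintype.card G)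
    (hS' : ∑ z, Real.exp (-S' z) ≤ Φ * Fintype.card G') :
    ∑ p, Real.exp (-combineBound k e g R n S S' p) ≤
      ((Fintype.card H - #R) * Ψ + #R * (Φ * (1 - γ / 4)) + δ * Fintype.card H) *
        (Fintype.card G * Fintype.card G') := by
  have hexp : 0 ≤ Ψ * Fintype.card G := (sum_nonneg fun _ _ => (Real.exp_pos _).le).trans hS
  have hexp' : 0 ≤ Φ * Fintype.card G' := (sum_nonneg fun _ _ => (Real.exp_pos _).le).trans hS'
  have hpt : ∀ x, ∑ y, ∑ z, Real.exp (-combineBound k e g R n S S' (y, x, z)) ≤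
      (if x ∈ R then (∑ y, Real.exp (-coreAvg k e g R y x)) * (Φ * Fintype.card G') else 0) +
      (if x ∈ R then 0 else Ψ * Fintype.card G * Fintype.card G') +
      (if x ∉ R ∧ ∃ s ≤ n, x + (s : H) ∈ R then
        (Fintype.card G : ℝ) * Fintype.card G' else 0) := by
    intro x
    by_cases hx : x ∈ R
    · simp only [combineBound, hx, if_true, not_true_eq_false, false_and, if_false, add_zero,
        neg_add, Real.exp_add]
      rw [← sum_mul_sum]
      exact mul_le_mul_of_nonneg_left hS' (sum_nonneg fun _ _ => (Real.exp_pos _).le)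
    · by_cases hs : ∃ s ≤ n, x + (s : H) ∈ R
      · simp only [combineBound, hx, hs, if_true, if_false, not_false_eq_true, and_self, neg_zero,
          Real.exp_zero, sum_const, card_univ, nsmul_eq_mul, mul_one]
        have : 0 ≤ Ψ * Fintype.card G * Fintype.card G' := mul_nonneg hexp (by positivity)
        linarith
      · simp only [combineBound, hx, hs, if_false, and_false, sum_const, card_univ,
          nsmul_eq_mul, add_zero, zero_add, ← mul_sum]
        rw [mul_comm]
        exact mul_le_mul_of_nonneg_right hS (by positivity)
  calc ∑ p, Real.exp (-combineBound k e g R n S S' p)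
      = ∑ x, ∑ y, ∑ z, Real.exp (-combineBound k e g R n S S' (y, x, z)) := by
        simp_rw [Fintype.sum_prod_type]
        exact sum_comm
    _ ≤ _ := sum_le_sum fun x _ => hpt x
    _ = (∑ x ∈ R, ∑ y, Real.exp (-coreAvg k e g R y x)) * (Φ * Fintype.card G') +
        (Fintype.card H - #R) * (Ψ * Fintype.card G * Fintype.card G') +
        #{x : H | x ∉ R ∧ ∃ s ≤ n, x + (s : H) ∈ R} *
          ((Fintype.card G : ℝ) * Fintype.card G') := by
        rw [sum_add_distrib, sum_add_distrib, sum_ite_mem_zero, sum_ite_mem, univ_inter,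
          ← sum_mul, ← sum_filter, sum_const, nsmul_eq_mul]
    _ ≤ (#R * Fintype.card G * (1 - γ / 4)) * (Φ * Fintype.card G') +
        (Fintype.card H - #R) * (Ψ * Fintype.card G * Fintype.card G') +
        δ * Fintype.card H * ((Fintype.card G : ℝ) * Fintype.card G') := by
        gcongr
        exact sum_sum_exp_neg_coreAvg_le h1 hg hg1 hγ hR
    _ = _ := by ring

omit [Fintype G'] in
lemma combineBound_le_powerAvg (h1 : addOrderOf (1 : H) = Fintype.card H)
    (hw : ∀ x, 0 ≤ w x) (hhit : ∀ x ∈ R, (Fintype.card H : ℝ) ≤ ∑ c, w (x + c ^ k))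
    (hg : ∀ y, 0 ≤ g y) (hgf : ∀ y, g y ≤ f y) (hf' : ∀ z, 0 ≤ f' z) (hS'0 : ∀ z, 0 ≤ S' z)
    (hN' : ∀ z, 0 < N' z) {q a : ℕ} (ha : 1 ≤ a) (haq : a ≤ q)
    (hcop : (Fintype.card G * Fintype.card H).Coprime q)
    (hn : ∀ y, (q + q * N y) ^ k ≤ n)
    (hS : ∀ y, S y ≤ powerAvg k e q a (N y) f y)
    (hS' : ∀ z b, 1 ≤ b → b ≤ q * (Fintype.card G * Fintype.card H) →
      S' z ≤ powerAvg k e' (q * (Fintype.card G * Fintype.card H)) b (N' z) f' z)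
    (p : G × H × G') :
    combineBound k e g R n S S' p ≤
      powerAvg k ((e, 1, e') : G × H × G') q a (combineTime R n N N' p)
        (combineFun R w f f') p := by
  obtain ⟨y, x, z⟩ := p
  have hf : ∀ y, 0 ≤ f y := fun y => (hg y).trans (hgf y)
  have hGpos : 0 < Fintype.card G := Fintype.card_pos
  have hHpos : 0 < Fintype.card H := Fintype.card_pos
  have hval : ∀ i : ℕ, combineFun R w f f' ((y, x, z) + i ^ k • ((e, 1, e') : G × H × G')) =
      (if x + (i : H) ^ k ∈ R then 0 else f (y + i ^ k • e)) +
        w (x + (i : H) ^ k) * f' (z + i ^ k • e') := by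
    intro i
    simp [combineFun]
  have hnonneg : ∀ p, 0 ≤ combineFun R w f f' p := by
    intro p
    simp only [combineFun]
    have := mul_nonneg (hw p.2.1) (hf' p.2.2)
    split_ifs
    · linarith
    · linarith [hf p.1]
  by_cases hx : x ∈ R
  · simp only [combineBound, combineTime, hx, if_true, powerAvg]
    set M := Fintype.card G * Fintype.card H with hM
    have hMpos : 0 < M := Nat.mul_pos hGpos hHpos
    have hmod : ∀ i j, i ≡ j [MOD M] → ((i : H) ^ k = (j : H) ^ k ∧ i ^ k • e = j ^ k • e) := by
      intro i j hij
      refine ⟨?_, pow_nsmul_eq_of_modEq e (Dvd.intro _ rfl) hij k⟩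
      have := pow_nsmul_eq_of_modEq (1 : H) (Dvd.intro_left _ rfl) hij k
      simpa using this
    have key := add_mul_le_average_of_periodic (M := M) (q := q) (a := a) (N := N' z) (s := S' z)
      (φ := fun i => if x + (i : H) ^ k ∈ R then 0 else g (y + i ^ k • e))
      (ω := fun i => w (x + (i : H) ^ k)) (h := fun i => f' (z + i ^ k • e'))
      hMpos (fun i j hij => by simp only [hmod i j hij]) (fun i j hij => by
        simp only [(hmod i j hij).1]) (fun i => hw _) hcop ha haq (hS' z) (hN' z)
    have hone : 1 ≤ (M : ℝ)⁻¹ * ∑ c ∈ range M, w (x + (c : H) ^ k) := by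
      have := sum_range_mul_card_natCast h1 (Fintype.card G) (fun c : H => w (x + c ^ k))
      rw [hM, this, nsmul_eq_mul, inv_mul_eq_div, one_le_div (by exact_mod_cast hMpos)]
      push_cast
      exact mul_le_mul_of_nonneg_left (hhit x hx) (by positivity)
    have hcore : coreAvg k e g R y x = (M : ℝ)⁻¹ * ∑ c ∈ range M,
        (if x + (c : H) ^ k ∈ R then 0 else g (y + c ^ k • e)) := rfl
    calc coreAvg k e g R y x + S' z ≤ _ := by
          rw [hcore]
          exact add_le_add_right (le_mul_of_one_le_left (hS'0 z) hone) _
      _ ≤ _ := key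
      _ ≤ _ := by
          refine mul_le_mul_of_nonneg_left (sum_le_sum fun i _ => ?_) (by positivity)
          rw [hval]
          refine add_le_add_left ?_ _
          split_ifs
          · exact le_rfl
          · exact hgf _
  · by_cases hs : ∃ s ≤ n, x + (s : H) ∈ R
    · simp only [combineBound, hx, hs, if_true, if_false]
      exact powerAvg_nonneg hnonneg _
    · simp only [combineBound, combineTime, hx, hs, if_false]
      refine (hS y).trans ?_
      refine mul_le_mul_of_nonneg_left (sum_le_sum fun i hi => ?_) (by positivity)
      rw [hval, if_neg]
      · linarith [mul_nonneg (hw (x + ((a + q * i : ℕ) : H) ^ k))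
          (hf' (z + (a + q * i) ^ k • e'))]
      · intro hmem
        refine hs ⟨(a + q * i) ^ k, ?_, by simpa using hmem⟩
        refine le_trans (Nat.pow_le_pow_left ?_ k) (hn y)
        have := mem_range.1 hi
        exact Nat.add_le_add haq (Nat.mul_le_mul_left q this.le)

end Combine

section Step
open Finset
open scoped Classical

lemma addOrderOf_prod_eq_card {A B : Type*} [AddCommGroup A] [Fintype A] [AddCommGroup B]
    [Fintype B] {a : A} {b : B} (ha : addOrderOf a = Fintype.card A)
    (hb : addOrderOf b = Fintype.card B) (h : (Fintype.card A).Coprime (Fintype.card B)) :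
    addOrderOf (a, b) = Fintype.card (A × B) := by
  rw [Prod.addOrderOf_mk, ha, hb, h.lcm_eq_mul, Fintype.card_prod]

lemma PowerAvgSystem.nonneg {k q : ℕ} {U γ Φ : ℝ} (s : PowerAvgSystem k q U γ Φ) :
    0 ≤ U ∧ 0 ≤ Φ := by
  have hpos : (0 : ℝ) < Fintype.card s.G := by
    have : Nonempty s.G := ⟨0⟩
    exact_mod_cast Fintype.card_pos
  constructor
  · exact nonneg_of_mul_nonneg_left ((sum_nonneg fun x _ => s.f_nonneg x).trans s.sum_f_le) hpos
  · exact nonneg_of_mul_nonneg_left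
      ((sum_nonneg fun x _ => (Real.exp_pos _).le).trans s.sum_exp_le) hpos

lemma PowerAvgSystem.mono {k q : ℕ} {U γ Φ U' γ' Φ' : ℝ}
    (h : Nonempty (PowerAvgSystem k q U γ Φ)) (hU : U ≤ U') (hγ : γ' ≤ γ) (hΦ : Φ ≤ Φ') :
    Nonempty (PowerAvgSystem k q U' γ' Φ') := by
  obtain ⟨s⟩ := h
  exact ⟨{ s with
    sum_f_le := s.sum_f_le.trans (mul_le_mul_of_nonneg_right hU (by positivity))
    le_sum_g := (mul_le_mul_of_nonneg_right hγ (by positivity)).trans s.le_sum_g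
    sum_exp_le := s.sum_exp_le.trans (mul_le_mul_of_nonneg_right hΦ (by positivity)) }⟩

lemma PowerAvgSystem.exists_combine {k q : ℕ} (hk : 2 ≤ k) (hq : 0 < q) {δ U γ Ψ m Φ U' Ψ' : ℝ}
    (hδ : 0 < δ) (hδ7 : 7 * δ ≤ 1) (hγ : 0 ≤ γ) (s : PowerAvgSystem k q U γ Ψ)
    (F : ∀ q' > 0, Nonempty (PowerAvgSystem k q' m 0 Φ))
    (hU' : (1 - δ * (1 - 3 * δ)) * U + δ * m ≤ U')
    (hΨ' : ∀ r, δ * (1 - 3 * δ) ≤ r → r ≤ δ →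
      (1 - r) * Ψ + r * (Φ * (1 - γ / 4)) + δ ^ 2 ≤ Ψ') :
    Nonempty (PowerAvgSystem k q U' ((1 - δ) * γ) Ψ') := by
  have hGpos : 0 < Fintype.card s.G := Fintype.card_pos_iff.2 ⟨0⟩
  obtain ⟨H, _, _, R, w, h1, hcop, hw0, hw, hRle, hRge, hhit, hRR, hbad⟩ :=
    exists_powerShift_configuration hk hδ hδ7 (∑ y, (q + q * s.N y) ^ k)
      (q * Fintype.card s.G) (Nat.mul_pos hq hGpos)
  have hHpos : 0 < Fintype.card H := Fintype.card_pos
  obtain ⟨s'⟩ := F (q * (Fintype.card s.G * Fintype.card H))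
    (Nat.mul_pos hq (Nat.mul_pos hGpos hHpos))
  have hG'pos : 0 < Fintype.card s'.G := Fintype.card_pos_iff.2 ⟨0⟩
  have hG : (0 : ℝ) < Fintype.card s.G := by exact_mod_cast hGpos
  have hH : (0 : ℝ) < Fintype.card H := by exact_mod_cast hHpos
  have hG' : (0 : ℝ) < Fintype.card s'.G := by exact_mod_cast hG'pos
  have hcard : (Fintype.card (s.G × H × s'.G) : ℝ) =
      Fintype.card s.G * (Fintype.card H * Fintype.card s'.G) := by
    simp [Fintype.card_prod]
  have hcopHq : (Fintype.card H).Coprime q := hcop.coprime_mul_right_right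
  have hcopHG : (Fintype.card H).Coprime (Fintype.card s.G) := hcop.coprime_mul_left_right
  have hcopG'q := s'.coprime.coprime_mul_right_right
  have hcopG' := s'.coprime.coprime_mul_left_right
  have hRH : (#R : ℝ) ≤ Fintype.card H := by exact_mod_cast card_le_univ R
  refine ⟨{
    G := s.G × H × s'.G
    e := (s.e, 1, s'.e)
    f := combineFun R w s.f s'.f
    g := fun p => if p.2.1 ∈ R then 0 else s.g p.1
    S := combineBound k s.e s.g R (∑ y, (q + q * s.N y) ^ k) s.S s'.S
    N := combineTime R (∑ y, (q + q * s.N y) ^ k) s.N s'.N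
    addOrderOf_e := ?_
    coprime := ?_
    g_nonneg := ?_
    g_le_f := ?_
    g_le_one := ?_
    S_nonneg := ?_
    N_pos := ?_
    sum_f_le := ?_
    le_sum_g := ?_
    sum_exp_le := ?_
    S_le := ?_ }⟩
  · refine addOrderOf_prod_eq_card s.addOrderOf_e
      (addOrderOf_prod_eq_card h1 s'.addOrderOf_e hcopG'.coprime_mul_left_right.symm) ?_
    rw [Fintype.card_prod]
    exact hcopHG.symm.mul_right hcopG'.coprime_mul_right_right.symm
  · rw [Fintype.card_prod, Fintype.card_prod]
    exact s.coprime.mul_left (hcopHq.mul_left hcopG'q)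
  · intro p
    split_ifs
    · exact le_rfl
    · exact s.g_nonneg _
  · intro p
    have := mul_nonneg (hw0 p.2.1) (s'.f_nonneg p.2.2)
    simp only [combineFun]
    split_ifs
    · linarith
    · linarith [s.g_le_f p.1]
  · intro p
    split_ifs
    · exact zero_le_one
    · exact s.g_le_one _
  · intro p
    simp only [combineBound]
    split_ifs
    · exact add_nonneg (coreAvg_nonneg s.g_nonneg _ _) (s'.S_nonneg _)
    · exact le_rfl
    · exact s.S_nonneg _
  · intro p
    simp only [combineTime]
    split_ifs
    · exact Nat.mul_pos (s'.N_pos _) (Nat.mul_pos hGpos hHpos)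
    · exact Nat.one_pos
    · exact s.N_pos _
  · rw [sum_combineFun, hcard]
    have hU := s.nonneg.1
    have hm := s'.nonneg.1
    calc _ ≤ (Fintype.card H - #R) * (U * Fintype.card s.G) * Fintype.card s'.G +
          Fintype.card s.G * (δ * Fintype.card H) * (m * Fintype.card s'.G) := by
          refine add_le_add (mul_le_mul_of_nonneg_right
            (mul_le_mul_of_nonneg_left s.sum_f_le (sub_nonneg.2 hRH)) hG'.le) ?_
          exact mul_le_mul (mul_le_mul_of_nonneg_left hw hG.le) s'.sum_f_le
            (sum_nonneg fun x _ => s'.f_nonneg x) (by positivity)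
      _ ≤ (Fintype.card H - δ * (1 - 3 * δ) * Fintype.card H) * (U * Fintype.card s.G) *
            Fintype.card s'.G +
          Fintype.card s.G * (δ * Fintype.card H) * (m * Fintype.card s'.G) := by
          gcongr
      _ = ((1 - δ * (1 - 3 * δ)) * U + δ * m) *
            (Fintype.card s.G * (Fintype.card H * Fintype.card s'.G)) := by ring
      _ ≤ _ := by gcongr
  · have h : ∑ p : s.G × H × s'.G, (if p.2.1 ∈ R then 0 else s.g p.1) =
        (Fintype.card H - #R) * (∑ y, s.g y) * Fintype.card s'.G := by
      have := sum_combineFun (R := R) (w := fun _ => 0) (f := s.g) (f' := s'.f)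
      simpa [combineFun] using this
    rw [h, hcard]
    calc (1 - δ) * γ * (Fintype.card s.G * (Fintype.card H * Fintype.card s'.G)) =
          (Fintype.card H - δ * Fintype.card H) * (γ * Fintype.card s.G) *
            Fintype.card s'.G := by ring
      _ ≤ _ := by
          refine mul_le_mul_of_nonneg_right (mul_le_mul (by linarith) s.le_sum_g (by positivity)
            (sub_nonneg.2 hRH)) hG'.le
  · refine (sum_exp_neg_combineBound_le h1 s.g_nonneg s.g_le_one s.le_sum_g hRR hbad s.sum_exp_le
      s'.sum_exp_le).trans ?_
    have h2 := hΨ' (#R / Fintype.card H) ((le_div_iff₀ hH).2 hRge) ((div_le_iff₀ hH).2 hRle)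
    rw [hcard]
    calc _ = ((1 - #R / Fintype.card H) * Ψ + #R / Fintype.card H * (Φ * (1 - γ / 4)) + δ ^ 2) *
            (Fintype.card s.G * (Fintype.card H * Fintype.card s'.G)) := by
          field_simp
      _ ≤ _ := by gcongr
  · intro p a ha haq
    exact combineBound_le_powerAvg h1 hw0 hhit s.g_nonneg s.g_le_f s'.f_nonneg s'.S_nonneg
      s'.N_pos ha haq (s.coprime.mul_left hcopHq)
      (fun y => single_le_sum (f := fun y => (q + q * s.N y) ^ k) (fun _ _ => Nat.zero_le _)
        (mem_univ y))
      (fun y => s.S_le y a ha haq) (fun z b => s'.S_le z b) p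

end Step

section Iterate
open Finset
open scoped Classical

lemma PowerAvgSystem.exists_add_one {k q : ℕ} {m Φ : ℝ} (s : PowerAvgSystem k q m 0 Φ) :
    Nonempty (PowerAvgSystem k q (m + 1) 1 Φ) := by
  refine ⟨{ s with
    f := fun x => s.f x + 1
    g := fun _ => 1
    g_nonneg := fun _ => zero_le_one
    g_le_f := fun x => by linarith [s.f_nonneg x]
    g_le_one := fun _ => le_rfl
    sum_f_le := ?_
    le_sum_g := by simp
    S_le := fun x a ha haq => (s.S_le x a ha haq).trans ?_ }⟩
  · rw [sum_add_distrib]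
    simp only [sum_const, card_univ, nsmul_eq_mul, mul_one]
    linarith [s.sum_f_le]
  · refine mul_le_mul_of_nonneg_left (sum_le_sum fun i _ => ?_) (by positivity)
    linarith

lemma PowerAvgSystem.exists_iterate {k : ℕ} (hk : 2 ≤ k) {δ m Φ : ℝ} (hδ : 0 < δ)
    (hδ7 : 7 * δ ≤ 1) (F : ∀ q > 0, Nonempty (PowerAvgSystem k q m 0 Φ)) (j : ℕ) :
    ∀ q > 0, Nonempty (PowerAvgSystem k q (m / (1 - 3 * δ) + (1 - δ * (1 - 3 * δ)) ^ j)
      ((1 - δ) ^ j) (Φ * (1 - j * (δ * (1 - 3 * δ)) * (1 - δ) ^ j / 4) + j * δ ^ 2)) := by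
  obtain ⟨t⟩ := F 1 one_pos
  obtain ⟨hm, hΦ⟩ := t.nonneg
  have h3 : 0 < 1 - 3 * δ := by linarith
  induction j with
  | zero =>
    intro q hq
    obtain ⟨s⟩ := F q hq
    refine PowerAvgSystem.mono s.exists_add_one ?_ (by simp) (by simp)
    rw [pow_zero]
    gcongr
    exact le_div_self hm h3 (by linarith)
  | succ j ih =>
    intro q hq
    obtain ⟨s⟩ := ih q hq
    set γ := (1 - δ) ^ j with hγ
    have hγ0 : 0 ≤ γ := pow_nonneg (by linarith) _
    rw [pow_succ' (1 - δ)]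
    refine s.exists_combine hk hq hδ hδ7 hγ0 F (le_of_eq ?_) fun ρ h1 h2 => ?_
    · rw [pow_succ']
      linear_combination -δ * div_mul_cancel₀ m h3.ne'
    · set r := δ * (1 - 3 * δ) with hr
      have hr0 : 0 ≤ r := by positivity
      have hj : (0 : ℝ) ≤ j := by positivity
      have h4 : (j + 1) * r * ((1 - δ) * γ) ≤ (1 - ρ) * (j * r * γ) + ρ * γ := by
        have h5 : (1 - δ) * (j * r * γ) ≤ (1 - ρ) * (j * r * γ) := by gcongr
        have h6 : r * (1 - δ) * γ ≤ ρ * γ := by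
          gcongr
          nlinarith
        linarith
      have h7 := mul_le_mul_of_nonneg_left h4 hΦ
      have h8 : 0 ≤ ρ * (j * δ ^ 2) := mul_nonneg (hr0.trans h1) (by positivity)
      push_cast
      linarith

/-- Up to an arbitrarily small error there are systems with mean at most `m` and exponential mean
at most `Φ`, of order coprime to any prescribed modulus. -/
def HasPowerAvgSystems (k : ℕ) (m Φ : ℝ) : Prop :=
  ∀ ε > 0, ∀ q > 0, Nonempty (PowerAvgSystem k q (m + ε) 0 (Φ + ε))

lemma hasPowerAvgSystems_zero_one (k : ℕ) : HasPowerAvgSystems k 0 1 := by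
  intro ε hε q _
  refine ⟨{
    G := PUnit
    e := 0
    f := fun _ => 0
    g := fun _ => 0
    S := fun _ => 0
    N := fun _ => 1
    addOrderOf_e := by simp
    coprime := by simp
    g_nonneg := fun _ => le_rfl
    g_le_f := fun _ => le_rfl
    g_le_one := fun _ => zero_le_one
    S_nonneg := fun _ => le_rfl
    N_pos := fun _ => one_pos
    sum_f_le := by simp; linarith
    le_sum_g := by simp
    sum_exp_le := by simp; linarith
    S_le := fun _ _ _ _ => powerAvg_nonneg (fun _ => le_rfl) _ }⟩

lemma HasPowerAvgSystems.add_exp_neg {k : ℕ} (hk : 2 ≤ k) {m Φ : ℝ}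
    (h : HasPowerAvgSystems k m Φ) {A : ℝ} (hA : 0 < A) :
    HasPowerAvgSystems k (m + Real.exp (-A)) (Φ * (1 - A * Real.exp (-A) / 4)) := by
  intro ε hε q hq
  have hinv : Tendsto (fun j : ℕ => ((j : ℝ))⁻¹) atTop (nhds 0) := tendsto_inv_atTop_nhds_zero_nat
  have hδ : Tendsto (fun j : ℕ => A * (j : ℝ)⁻¹) atTop (nhds 0) := by
    simpa using hinv.const_mul A
  have h3 : Tendsto (fun j : ℕ => 1 - 3 * (A * (j : ℝ)⁻¹)) atTop (nhds 1) := by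
    simpa using (hδ.const_mul 3).const_sub 1
  have hj : ∀ᶠ j : ℕ in atTop, (j : ℝ) ≠ 0 := by
    filter_upwards [eventually_ne_atTop 0] with j hj
    exact_mod_cast hj
  have hr : Tendsto (fun j : ℕ => (j : ℝ) * (A * (j : ℝ)⁻¹ * (1 - 3 * (A * (j : ℝ)⁻¹)))) atTop
      (nhds A) := by
    have : Tendsto (fun j : ℕ => A * (1 - 3 * (A * (j : ℝ)⁻¹))) atTop (nhds (A * 1)) :=
      h3.const_mul A
    rw [mul_one] at this
    refine this.congr' ?_
    filter_upwards [hj] with j hj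
    field_simp
  have hpow1 : Tendsto
      (fun j : ℕ => (1 - A * (j : ℝ)⁻¹ * (1 - 3 * (A * (j : ℝ)⁻¹))) ^ j) atTop
      (nhds (Real.exp (-A))) := by
    simp_rw [sub_eq_add_neg (1 : ℝ) (_ * _)]
    refine Real.tendsto_one_add_pow_exp_of_tendsto ?_
    simpa only [mul_neg, sub_eq_add_neg] using hr.neg
  have hpow2 : Tendsto (fun j : ℕ => (1 - A * (j : ℝ)⁻¹) ^ j) atTop
      (nhds (Real.exp (-A))) := by
    simp_rw [sub_eq_add_neg (1 : ℝ) (_ * _)]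
    refine Real.tendsto_one_add_pow_exp_of_tendsto (tendsto_const_nhds.congr' ?_)
    filter_upwards [hj] with j hj
    field_simp
  have hsq : Tendsto (fun j : ℕ => (j : ℝ) * (A * (j : ℝ)⁻¹) ^ 2) atTop (nhds 0) := by
    have : Tendsto (fun j : ℕ => A * (A * (j : ℝ)⁻¹)) atTop (nhds 0) := by
      simpa using hδ.const_mul A
    refine this.congr' ?_
    filter_upwards [hj] with j hj
    field_simp
  have hU : Tendsto (fun j : ℕ => (m + (j : ℝ)⁻¹) / (1 - 3 * (A * (j : ℝ)⁻¹)) +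
      (1 - A * (j : ℝ)⁻¹ * (1 - 3 * (A * (j : ℝ)⁻¹))) ^ j) atTop
      (nhds (m + Real.exp (-A))) := by
    have := ((hinv.const_add m).div h3 one_ne_zero).add hpow1
    simpa using this
  have hΦ : Tendsto (fun j : ℕ => (Φ + (j : ℝ)⁻¹) *
      (1 - j * (A * (j : ℝ)⁻¹ * (1 - 3 * (A * (j : ℝ)⁻¹))) * (1 - A * (j : ℝ)⁻¹) ^ j / 4) +
        j * (A * (j : ℝ)⁻¹) ^ 2) atTop (nhds (Φ * (1 - A * Real.exp (-A) / 4))) := by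
    have := ((hinv.const_add Φ).mul (((hr.mul hpow2).div_const 4).const_sub 1)).add hsq
    simpa using this
  have h7 : Tendsto (fun j : ℕ => 7 * (A * (j : ℝ)⁻¹)) atTop (nhds 0) := by
    simpa using hδ.const_mul 7
  obtain ⟨j, hj1, hj2, hj3, hj4⟩ := ((hU.eventually_lt_const (lt_add_of_pos_right _ hε)).and
    ((hΦ.eventually_lt_const (lt_add_of_pos_right _ hε)).and
      ((h7.eventually_lt_const one_pos).and (eventually_gt_atTop 0)))).exists
  have hjpos : (0 : ℝ) < (j : ℝ)⁻¹ := by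
    have : (0 : ℝ) < j := by exact_mod_cast hj4
    positivity
  refine PowerAvgSystem.mono (PowerAvgSystem.exists_iterate hk (mul_pos hA hjpos) hj3.le
    (h _ hjpos) j q hq) hj1.le (pow_nonneg ?_ _) hj2.le
  linarith

lemma hasPowerAvgSystems_iterate {k : ℕ} (hk : 2 ≤ k) {A : ℝ} (hA : 0 < A) (K : ℕ) :
    HasPowerAvgSystems k (K * Real.exp (-A)) ((1 - A * Real.exp (-A) / 4) ^ K) := by
  induction K with
  | zero => simpa using hasPowerAvgSystems_zero_one k
  | succ K ih =>
    have := ih.add_exp_neg hk hA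
    rw [pow_succ]
    push_cast
    rwa [add_mul, one_mul]

lemma exists_powerAvgSystem {k : ℕ} (hk : 2 ≤ k) {ε : ℝ} (hε : 0 < ε) {q : ℕ} (hq : 0 < q) :
    Nonempty (PowerAvgSystem k q ε 0 ε) := by
  set η := ε / 2 with hη
  have hη0 : 0 < η := by positivity
  set A := (1 + 4 / η) / η with hA
  have hA0 : 0 < A := by positivity
  set K := ⌊η * Real.exp A⌋₊ with hK
  have hAe : A * Real.exp (-A) ≤ 1 := by
    rw [Real.exp_neg, mul_inv_le_iff₀ (Real.exp_pos A)]
    linarith [Real.add_one_le_exp A]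
  have hexp : Real.exp A * Real.exp (-A) = 1 := by rw [← Real.exp_add]; simp
  have hK1 : K * Real.exp (-A) ≤ η := by
    calc K * Real.exp (-A) ≤ η * Real.exp A * Real.exp (-A) :=
          mul_le_mul_of_nonneg_right (Nat.floor_le (by positivity)) (Real.exp_pos _).le
      _ = η := by rw [mul_assoc, hexp, mul_one]
  have hK2 : 1 / η ≤ K * (A * Real.exp (-A) / 4) := by
    have h1 : η * Real.exp A - 1 ≤ K := by
      linarith [Nat.lt_floor_add_one (η * Real.exp A)]
    calc 1 / η = (η * A * (Real.exp A * Real.exp (-A)) - 1) / 4 := by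
          rw [hexp, hA]
          field_simp
          ring
      _ ≤ (η * A * (Real.exp A * Real.exp (-A)) - A * Real.exp (-A)) / 4 := by gcongr
      _ = (η * Real.exp A - 1) * (A * Real.exp (-A) / 4) := by ring
      _ ≤ _ := by gcongr
  have hK3 : (1 - A * Real.exp (-A) / 4) ^ K ≤ η := by
    calc (1 - A * Real.exp (-A) / 4) ^ K ≤ Real.exp (-(A * Real.exp (-A) / 4)) ^ K := by
          refine pow_le_pow_left₀ (by linarith) ?_ K
          linarith [Real.add_one_le_exp (-(A * Real.exp (-A) / 4))]
      _ = Real.exp (-(K * (A * Real.exp (-A) / 4))) := by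
          rw [← Real.exp_nat_mul]
          congr 1
          ring
      _ ≤ Real.exp (-(1 / η)) := Real.exp_le_exp.2 (neg_le_neg hK2)
      _ ≤ η := by
          rw [Real.exp_neg, inv_le_comm₀ (Real.exp_pos _) hη0, ← one_div]
          linarith [Real.add_one_le_exp (1 / η)]
  exact PowerAvgSystem.mono (hasPowerAvgSystems_iterate hk hA0 K η hη0 q hq) (by linarith) le_rfl
    (by linarith)

end Iterate

section ErgodicRotation

lemma exists_ergodic_rotation : ∃ (X : Type) (_ : AddCommGroup X) (_ : MeasurableSpace X)
    (μ : Measure X) (t : X), IsProbabilityMeasure μ ∧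
      (∀ a : X, MeasurePreserving (a + ·) μ μ) ∧ Ergodic (t + ·) μ ∧
      ∀ n > 0, ∃ π : X →+ ZMod n, (∀ s, MeasurableSet (π ⁻¹' s)) ∧ π t = 1 := by
  let P := ∀ n : ℕ, ZMod (n + 1)
  let K : AddSubgroup P := (AddSubgroup.zmultiples (1 : P)).topologicalClosure
  have : ∀ n : ℕ, SecondCountableTopology (ZMod (n + 1)) := fun n =>
    DiscreteTopology.secondCountableTopology_of_countable
  have : SecondCountableTopology P := inferInstance
  have hK : IsClosed (K : Set P) := AddSubgroup.isClosed_topologicalClosure _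
  have : CompactSpace K := isCompact_iff_compactSpace.1 hK.isCompact
  let t : K := ⟨1, AddSubgroup.le_topologicalClosure _ (AddSubgroup.mem_zmultiples _)⟩
  have hdense : DenseRange (fun n : ℤ => n • t) := by
    rw [DenseRange, Subtype.dense_iff]
    intro x hx
    refine closure_mono ?_ (show x ∈ closure (AddSubgroup.zmultiples (1 : P) : Set P) from hx)
    rintro _ ⟨n, rfl⟩
    exact ⟨n • t, ⟨n, rfl⟩, rfl⟩
  have : SecondCountableTopology K :=
    TopologicalSpace.Subtype.secondCountableTopology (K : Set P)
  let _ : MeasurableSpace K := borel K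
  have : BorelSpace K := ⟨rfl⟩
  let μ : Measure K := Measure.addHaarMeasure ⊤
  have hμ : IsProbabilityMeasure μ := ⟨Measure.addHaarMeasure_self⟩
  refine ⟨K, inferInstance, inferInstance, μ, t, hμ, measurePreserving_add_left μ,
    ergodic_add_left_of_denseRange_zsmul hdense μ, ?_⟩
  intro n hn
  obtain ⟨n, rfl⟩ := Nat.exists_eq_succ_of_ne_zero hn.ne'
  refine ⟨(Pi.evalAddMonoidHom (fun n : ℕ => ZMod (n + 1)) n).comp K.subtype, fun s => ?_, rfl⟩
  have hc : Continuous fun x : K => (x : P) n := (continuous_apply n).comp continuous_subtype_val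
  exact ((isOpen_discrete s).preimage hc).measurableSet

lemma exists_addMonoidHom_of_addOrderOf_eq {X G : Type*} [AddCommGroup X] [MeasurableSpace X]
    [AddCommGroup G] [Fintype G] {t : X}
    (h : ∀ n > 0, ∃ π : X →+ ZMod n, (∀ s, MeasurableSet (π ⁻¹' s)) ∧ π t = 1) (e : G) :
    ∃ θ : X →+ G, (∀ s, MeasurableSet (θ ⁻¹' s)) ∧ θ t = e := by
  obtain ⟨π, hπ, hπt⟩ := h (Fintype.card G) Fintype.card_pos
  let l : ZMod (Fintype.card G) →+ G :=
    ZMod.lift _ ⟨zmultiplesHom G e, by simp⟩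
  refine ⟨l.comp π, fun s => hπ (l ⁻¹' s), ?_⟩
  have := ZMod.lift_coe (Fintype.card G)
    (⟨zmultiplesHom G e, by simp⟩ : { f : ℤ →+ G // f (Fintype.card G) = 0 }) 1
  simpa [l, hπt] using this

lemma lintegral_comp_addMonoidHom {X G : Type*} [AddCommGroup X] [MeasurableSpace X]
    {μ : Measure X} [IsProbabilityMeasure μ] (hμ : ∀ a, MeasurePreserving (a + ·) μ μ)
    [AddCommGroup G] [Fintype G] {e : G} (he : addOrderOf e = Fintype.card G) {t : X}
    {θ : X →+ G} (hθ : ∀ s, MeasurableSet (θ ⁻¹' s)) (hθt : θ t = e) (F : G → ℝ≥0∞) :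
    Fintype.card G * ∫⁻ x, F (θ x) ∂μ = ∑ y, F y := by
  have hmeas : ∀ F : G → ℝ≥0∞, Measurable fun x => F (θ x) := fun F s _ => hθ (F ⁻¹' s)
  have h : ∀ c : ℕ, ∫⁻ x, F (c • e + θ x) ∂μ = ∫⁻ x, F (θ x) ∂μ := by
    intro c
    rw [← (hμ (c • t)).lintegral_comp (hmeas F)]
    simp [hθt]
  calc Fintype.card G * ∫⁻ x, F (θ x) ∂μ =
        ∑ c ∈ Finset.range (Fintype.card G), ∫⁻ x, F (c • e + θ x) ∂μ := by
        rw [Finset.sum_congr rfl fun c _ => h c]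
        simp
    _ = ∫⁻ x, ∑ c ∈ Finset.range (Fintype.card G), F (c • e + θ x) ∂μ :=
        (lintegral_finsetSum _ fun c _ => hmeas fun y => F (c • e + y)).symm
    _ = ∫⁻ _, ∑ y, F y ∂μ := by
        congr 1
        ext x
        rw [sum_range_card_nsmul he fun y => F (y + θ x)]
        exact Equiv.sum_comp (Equiv.addRight (θ x)) F
    _ = ∑ y, F y := by simp

lemma lintegral_ofReal_comp_le {X G : Type*} [AddCommGroup X] [MeasurableSpace X]
    {μ : Measure X} [IsProbabilityMeasure μ] (hμ : ∀ a, MeasurePreserving (a + ·) μ μ)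
    [AddCommGroup G] [Fintype G] {e : G} (he : addOrderOf e = Fintype.card G) {t : X}
    {θ : X →+ G} (hθ : ∀ s, MeasurableSet (θ ⁻¹' s)) (hθt : θ t = e) {F : G → ℝ}
    (hF : ∀ y, 0 ≤ F y) {c : ℝ} (hc : ∑ y, F y ≤ c * Fintype.card G) :
    ∫⁻ x, ENNReal.ofReal (F (θ x)) ∂μ ≤ ENNReal.ofReal c := by
  have h := lintegral_comp_addMonoidHom hμ he hθ hθt fun y => ENNReal.ofReal (F y)
  have hG : (Fintype.card G : ℝ≥0∞) ≠ 0 := by simp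
  rw [← ENNReal.mul_le_mul_iff_right hG (by simp), h,
    ← ENNReal.ofReal_sum_of_nonneg fun y _ => hF y, ← ENNReal.ofReal_natCast,
    ← ENNReal.ofReal_mul (by positivity), mul_comm]
  exact ENNReal.ofReal_le_ofReal hc

end ErgodicRotation

section Divergence
open scoped Classical

lemma PowerAvgSystem.measure_lt_one_le {X : Type*} [AddCommGroup X] [MeasurableSpace X]
    {μ : Measure X} [IsProbabilityMeasure μ] (hμ : ∀ a : X, MeasurePreserving (a + ·) μ μ)
    {k q : ℕ} {U γ Φ : ℝ} (s : PowerAvgSystem k q U γ Φ) {t : X} {θ : X →+ s.G}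
    (hθ : ∀ s, MeasurableSet (θ ⁻¹' s)) (hθt : θ t = s.e) :
    μ {x | s.S (θ x) < 1} ≤ ENNReal.ofReal (Real.exp 1 * Φ) := by
  have h1 := lintegral_ofReal_comp_le hμ s.addOrderOf_e hθ hθt (fun _ => (Real.exp_pos _).le)
    s.sum_exp_le
  have hmeas : Measurable fun x => ENNReal.ofReal (Real.exp (-s.S (θ x))) := fun u _ =>
    hθ ((fun y => ENNReal.ofReal (Real.exp (-s.S y))) ⁻¹' u)
  have h2 := (mul_meas_ge_le_lintegral (μ := μ) hmeas (ENNReal.ofReal (Real.exp (-1)))).trans h1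
  calc μ {x | s.S (θ x) < 1} ≤
        μ {x | ENNReal.ofReal (Real.exp (-1)) ≤ ENNReal.ofReal (Real.exp (-s.S (θ x)))} := by
        refine measure_mono fun x (hx : s.S (θ x) < 1) => ?_
        exact ENNReal.ofReal_le_ofReal (Real.exp_le_exp.2 (neg_le_neg hx.le))
    _ = ENNReal.ofReal (Real.exp 1) * (ENNReal.ofReal (Real.exp (-1)) *
        μ {x | ENNReal.ofReal (Real.exp (-1)) ≤ ENNReal.ofReal (Real.exp (-s.S (θ x)))}) := by
        rw [← mul_assoc, ← ENNReal.ofReal_mul (Real.exp_pos _).le, ← Real.exp_add]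
        simp
    _ ≤ ENNReal.ofReal (Real.exp 1) * ENNReal.ofReal Φ := by gcongr
    _ = _ := (ENNReal.ofReal_mul (Real.exp_pos _).le).symm

lemma exists_integrable_unbounded_averages {X : Type*} [AddCommGroup X] [MeasurableSpace X]
    {μ : Measure X} [IsProbabilityMeasure μ] (hμ : ∀ a : X, MeasurePreserving (a + ·) μ μ) {t : X}
    (hX : ∀ n > 0, ∃ π : X →+ ZMod n, (∀ s, MeasurableSet (π ⁻¹' s)) ∧ π t = 1)
    {k : ℕ} (hk : 2 ≤ k) :
    ∃ f : X → ℝ, Integrable f μ ∧ ∀ᵐ x ∂μ, ∀ C : ℝ, ∃ N : ℕ,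
      C < (N : ℝ)⁻¹ * ∑ m ∈ Finset.range N, f (x + (1 + m) ^ k • t) := by
  have hpow : ∀ i : ℕ, (0 : ℝ) < (1 / 4) ^ i := fun i => by positivity
  have s := fun i => (exists_powerAvgSystem hk (hpow i) one_pos).some
  choose θ hθ hθt using fun i => exists_addMonoidHom_of_addOrderOf_eq hX (s i).e
  set F : ℕ → X → ℝ≥0∞ := fun i x => ENNReal.ofReal (2 ^ i * (s i).f (θ i x)) with hF
  have hFmeas : ∀ i, Measurable (F i) := fun i u _ =>
    hθ i ((fun y => ENNReal.ofReal (2 ^ i * (s i).f y)) ⁻¹' u)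
  have hFint : ∀ i, ∫⁻ x, F i x ∂μ ≤ ENNReal.ofReal ((1 / 2) ^ i) := by
    intro i
    refine lintegral_ofReal_comp_le hμ (s i).addOrderOf_e (hθ i) (hθt i)
      (F := fun y => 2 ^ i * (s i).f y) (fun y => mul_nonneg (by positivity) ((s i).f_nonneg y)) ?_
    rw [← Finset.mul_sum]
    calc (2 : ℝ) ^ i * ∑ y, (s i).f y ≤ 2 ^ i * ((1 / 4) ^ i * Fintype.card (s i).G) := by
          gcongr
          exact (s i).sum_f_le
      _ = _ := by
          rw [← mul_assoc, ← mul_pow]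
          norm_num
  have hsum : ∀ c : ℝ, 0 ≤ c → ∀ r : ℝ, 0 ≤ r → r < 1 →
      ∑' i : ℕ, ENNReal.ofReal (c * r ^ i) ≠ ∞ := by
    intro c hc r hr0 hr1
    exact ((summable_geometric_of_lt_one hr0 hr1).mul_left c).tsum_ofReal_ne_top
  have hint : ∫⁻ x, ∑' i, F i x ∂μ ≠ ∞ := by
    rw [lintegral_tsum fun i => (hFmeas i).aemeasurable]
    refine ne_top_of_le_ne_top (hsum 1 zero_le_one (1 / 2) (by norm_num) (by norm_num))
      (ENNReal.tsum_le_tsum fun i => ?_)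
    rw [one_mul]
    exact hFint i
  have hmeas : Measurable fun x => ∑' i, F i x := Measurable.tsum hFmeas
  have hfin : ∀ᵐ x ∂μ, ∀ m : ℕ, ∑' i, F i ((1 + m) ^ k • t + x) < ∞ :=
    ae_all_iff.2 fun m => (hμ ((1 + m) ^ k • t)).quasiMeasurePreserving.ae (ae_lt_top hmeas hint)
  have hbad : ∀ᵐ x ∂μ, ∀ᶠ i in atTop, x ∉ {x | (s i).S (θ i x) < 1} := by
    refine ae_eventually_notMem (ne_top_of_le_ne_top
      (hsum (Real.exp 1) (Real.exp_pos 1).le (1 / 4) (by norm_num) (by norm_num))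
      (ENNReal.tsum_le_tsum fun i => ?_))
    exact (s i).measure_lt_one_le hμ (hθ i) (hθt i)
  refine ⟨fun x => (∑' i, F i x).toReal,
    integrable_toReal_of_lintegral_ne_top hmeas.aemeasurable hint, ?_⟩
  filter_upwards [hfin, hbad] with x hx1 hx2 C
  obtain ⟨i, hi1, hi2⟩ := (hx2.and
    ((tendsto_pow_atTop_atTop_of_one_lt one_lt_two).eventually_gt_atTop C)).exists
  have hS : 1 ≤ (s i).S (θ i x) := not_lt.1 hi1
  refine ⟨(s i).N (θ i x), hi2.trans_le ?_⟩
  have havg := hS.trans ((s i).S_le (θ i x) 1 le_rfl le_rfl)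
  rw [powerAvg] at havg
  calc (2 : ℝ) ^ i ≤ 2 ^ i * _ := le_mul_of_one_le_right (by positivity) havg
    _ = ((s i).N (θ i x) : ℝ)⁻¹ * ∑ m ∈ Finset.range ((s i).N (θ i x)),
        2 ^ i * (s i).f (θ i x + (1 + 1 * m) ^ k • (s i).e) := by
        rw [mul_left_comm, Finset.mul_sum]
    _ ≤ _ := by
        refine mul_le_mul_of_nonneg_left (Finset.sum_le_sum fun m _ => ?_) (by positivity)
        rw [one_mul, ← ENNReal.ofReal_le_iff_le_toReal]
        · refine le_trans (le_of_eq ?_) (ENNReal.le_tsum i)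
          simp [hF, hθt]
        · rw [add_comm]
          exact (hx1 m).ne

end Divergence

/-- **Failure of the pointwise ergodic theorem along `k`-th powers on `L¹`**
(Buczolich–Mauldin for `k = 2`, LaVictoire for all `k ≥ 2`).
For every integer `k ≥ 2` there exist a probability space `(X, B, μ)`, an invertible
ergodic measure-preserving transformation `T : X → X`, and `f ∈ L¹(X, μ)` such that the
set of points `x ∈ X` at which the averages `(1/N) ∑_{n=1}^N f (T^{n^k} x)` converge as
`N → ∞` does not have full μ-measure. -/
theorem pointwise_ergodic_along_kth_powers_fails_on_L1
    (k : ℕ) (hk : 2 ≤ k) :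
    ∃ (X : Type) (_ : MeasurableSpace X) (μ : Measure X) (T : Equiv.Perm X),
      IsProbabilityMeasure μ ∧
      MeasurePreserving T μ μ ∧ MeasurePreserving T.symm μ μ ∧
      Ergodic T μ ∧
      ∃ f : X → ℝ, Integrable f μ ∧
        ¬ (∀ᵐ x ∂μ, ∃ l : ℝ,
            Tendsto
              (fun N : ℕ => (N : ℝ)⁻¹ * ∑ n ∈ Finset.Icc 1 N, f ((T ^ (n ^ k)) x))
              atTop (nhds l)) := by
  obtain ⟨X, _, _, μ, t, _, hμ, herg, hX⟩ := exists_ergodic_rotation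
  obtain ⟨f, hf, hdiv⟩ := exists_integrable_unbounded_averages hμ hX hk
  refine ⟨X, inferInstance, μ, Equiv.addLeft t, inferInstance, hμ t, hμ (-t), herg, f, hf, ?_⟩
  intro hconv
  obtain ⟨x, ⟨l, hl⟩, hx⟩ := (hconv.and hdiv).exists
  obtain ⟨C, hC⟩ := hl.bddAbove_range
  obtain ⟨N, hN⟩ := hx C
  refine (hC ⟨N, rfl⟩).not_gt (hN.trans_eq ?_)
  dsimp only
  congr 1
  rw [← Finset.Ico_add_one_right_eq_Icc, Finset.sum_Ico_eq_sum_range, Nat.add_sub_cancel]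
  refine Finset.sum_congr rfl fun m _ => ?_
  rw [Equiv.nsmul_addLeft, Equiv.coe_addLeft, add_comm]
end

section
/- For every r ∈ (2, ∞) and every p ∈ (1, ∞) there exists a constant C_{p,r} ∈ ℝ₊ such that for every probability space (X, B, μ) with a filtration (F_n)_{n ∈ ℤ₊} and every martingale (𝔣_n)_{n ∈ ℤ₊} adapted to (F_n) with sup_{n ∈ ℤ₊} ‖𝔣_n‖_{L^p(X,μ)} < ∞, one has ‖ V^r(𝔣_n : n ∈ ℤ₊) ‖_{L^p(X,μ)} ≤ C_{p,r} sup_{n ∈ ℤ₊} ‖𝔣_n‖_{L^p(X,μ)} (Lépingle's inequality). -/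
open MeasureTheory Filter
open scoped ENNReal NNReal

/-- The `L^p(μ)` norm of an `ℝ≥0∞`-valued function. -/
noncomputable def lpNormENNReal {X : Type*} [MeasurableSpace X]
    (p : ℝ≥0∞) (g : X → ℝ≥0∞) (μ : Measure X) : ℝ≥0∞ :=
  if p = ∞ then essSup g μ else (∫⁻ x, g x ^ p.toReal ∂μ) ^ (1 / p.toReal)

/-- The `r`-variation seminorm of a sequence `a : ℕ → ℝ`:
`V^r(a) = sup_{J} sup_{t_0 < t_1 < ⋯ < t_J} (∑_{j=0}^{J-1} |a_{t_{j+1}} - a_{t_j}|^r)^{1/r}`,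
valued in `ℝ≥0∞`. -/
noncomputable def rVariation (r : ℝ) (a : ℕ → ℝ) : ℝ≥0∞ :=
  ⨆ (J : ℕ) (t : ℕ → ℕ) (_ : StrictMonoOn t (Set.Iic J)),
    (∑ j ∈ Finset.range J, (‖a (t (j + 1)) - a (t j)‖₊ : ℝ≥0∞) ^ r) ^ (1 / r)

namespace Lepingle

/-- The running maximum of `|f|`. -/
noncomputable def runMax (f : ℕ → ℝ) : ℕ → ℝ
  | 0 => |f 0|
  | n + 1 => max (runMax f n) |f (n + 1)|

lemma runMax_mono (f : ℕ → ℝ) : Monotone (runMax f) :=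
  monotone_nat_of_le_succ fun _ => le_max_left _ _

lemma abs_le_runMax_self (f : ℕ → ℝ) (n : ℕ) : |f n| ≤ runMax f n := by
  cases n with
  | zero => exact le_rfl
  | succ n => exact le_max_right _ _

lemma abs_le_runMax (f : ℕ → ℝ) {k n : ℕ} (h : k ≤ n) : |f k| ≤ runMax f n :=
  (abs_le_runMax_self f k).trans (runMax_mono f h)

lemma runMax_nonneg (f : ℕ → ℝ) (n : ℕ) : 0 ≤ runMax f n :=
  (abs_nonneg _).trans (abs_le_runMax_self f n)

lemma exists_abs_eq_runMax (f : ℕ → ℝ) (n : ℕ) : ∃ v ≤ n, |f v| = runMax f n := by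
  induction n with
  | zero => exact ⟨0, le_rfl, rfl⟩
  | succ n ih =>
    obtain ⟨v, hv, h⟩ := ih
    rcases le_total (runMax f n) |f (n + 1)| with h1 | h1
    · exact ⟨n + 1, le_rfl, (max_eq_right h1).symm⟩
    · exact ⟨v, hv.trans n.le_succ, h.trans (max_eq_left h1).symm⟩

/-- A sequence `a` samples `f` if it starts at `f 0` and, at each step, either keeps its value
or is updated to the current value of `f`. -/
structure Samples (f a : ℕ → ℝ) : Prop where
  zero : a 0 = f 0
  succ : ∀ n, a (n + 1) = f (n + 1) ∨ a (n + 1) = a n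

lemma Samples.abs_apply_le {f a : ℕ → ℝ} (h : Samples f a) (n : ℕ) : |a n| ≤ runMax f n := by
  induction n with
  | zero => rw [h.zero]; exact le_rfl
  | succ n ih =>
    rcases h.succ n with h1 | h1 <;> rw [h1]
    · exact abs_le_runMax_self f _
    · exact ih.trans (runMax_mono f n.le_succ)

/-- The sum of the squared increments of `a` up to time `n`. -/
noncomputable def sqVar (a : ℕ → ℝ) (n : ℕ) : ℝ :=
  ∑ k ∈ Finset.range n, (a (k + 1) - a k) ^ 2

lemma sqVar_succ (a : ℕ → ℝ) (n : ℕ) : sqVar a (n + 1) = sqVar a n + (a (n + 1) - a n) ^ 2 :=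
  Finset.sum_range_succ _ _

lemma sqVar_mono (a : ℕ → ℝ) : Monotone (sqVar a) :=
  monotone_nat_of_le_succ fun n => by rw [sqVar_succ]; nlinarith [sq_nonneg (a (n + 1) - a n)]

lemma sqVar_nonneg (a : ℕ → ℝ) (n : ℕ) : 0 ≤ sqVar a n :=
  Finset.sum_nonneg fun _ _ => sq_nonneg _

lemma Samples.sqVar_le {f a : ℕ → ℝ} (h : Samples f a) (n : ℕ) :
    sqVar a n ≤ 4 * n * runMax f n ^ 2 := by
  have : ∀ k ∈ Finset.range n, (a (k + 1) - a k) ^ 2 ≤ 4 * runMax f n ^ 2 := by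
    intro k hk
    have hk : k + 1 ≤ n := Finset.mem_range.1 hk
    have h1 := abs_le.1 ((h.abs_apply_le (k + 1)).trans (runMax_mono f hk))
    have h2 := abs_le.1 ((h.abs_apply_le k).trans (runMax_mono f (k.le_succ.trans hk)))
    nlinarith
  refine (Finset.sum_le_sum this).trans ?_
  simp only [Finset.sum_const, Finset.card_range, nsmul_eq_mul]
  linarith

lemma young_rpow {p x y : ℝ} (hp : 1 ≤ p) (hx : 0 ≤ x) (hy : 0 ≤ y) :
    p * y * x ^ (p - 1) ≤ y ^ p + (p - 1) * x ^ p := by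
  have hp0 : 0 < p := by linarith
  have h := Real.geom_mean_le_arith_mean2_weighted (w₁ := 1 / p) (w₂ := (p - 1) / p)
    (by positivity) (div_nonneg (by linarith) hp0.le) (Real.rpow_nonneg hy p)
    (Real.rpow_nonneg hx p) (by field_simp; ring)
  rw [← Real.rpow_mul hy, ← Real.rpow_mul hx, mul_one_div_cancel hp0.ne', Real.rpow_one,
    mul_div_cancel₀ _ hp0.ne'] at h
  calc p * y * x ^ (p - 1) = p * (y * x ^ (p - 1)) := by ring
    _ ≤ p * (1 / p * y ^ p + (p - 1) / p * x ^ p) := by gcongr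
    _ = _ := by field_simp

lemma mul_rpow_sub_one {x p : ℝ} (hx : 0 ≤ x) (hp : p ≠ 0) : x ^ (p - 1) * x = x ^ p := by
  have := Real.rpow_add_one' hx (y := p - 1) (by simpa using hp)
  simpa using this.symm

/-- Pathwise version of Doob's maximal inequality. -/
lemma runMax_rpow_le_aux {p : ℝ} (hp : 1 < p) (f : ℕ → ℝ) (n : ℕ) :
    (p - 1) * runMax f n ^ p ≤ p * (runMax f n ^ (p - 1) * |f n|) -
      p * ∑ k ∈ Finset.range n, (runMax f k ^ (p - 1) * SignType.sign (f k)) *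
        (f (k + 1) - f k) := by
  induction n with
  | zero =>
    simp only [runMax, Finset.range_zero, Finset.sum_empty, mul_zero, sub_zero]
    rw [mul_rpow_sub_one (abs_nonneg _) (by linarith)]
    nlinarith [Real.rpow_nonneg (abs_nonneg (f 0)) p]
  | succ n ih =>
    rw [Finset.sum_range_succ]
    set m := runMax f n
    have hm : 0 ≤ m := runMax_nonneg f n
    have hmp : 0 ≤ m ^ (p - 1) := Real.rpow_nonneg hm _
    have hs : (SignType.sign (f n) : ℝ) * (f (n + 1) - f n) ≤ |f (n + 1)| - |f n| := by
      rcases lt_trichotomy (f n) 0 with h | h | h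
      · simp [sign_neg h, abs_of_neg h]; linarith [neg_abs_le (f (n + 1))]
      · simp [h]
      · simp [sign_pos h, abs_of_pos h]; linarith [le_abs_self (f (n + 1))]
    have hs' : p * (m ^ (p - 1) * SignType.sign (f n) * (f (n + 1) - f n)) ≤
        p * (m ^ (p - 1) * (|f (n + 1)| - |f n|)) := by
      rw [mul_assoc (m ^ (p - 1))]; gcongr
    rcases le_total m |f (n + 1)| with h1 | h1
    · have e : runMax f (n + 1) = |f (n + 1)| := max_eq_right h1
      rw [e, mul_rpow_sub_one (abs_nonneg _) (by linarith)]
      have := young_rpow hp.le hm (abs_nonneg (f (n + 1)))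
      nlinarith
    · have e : runMax f (n + 1) = m := max_eq_left h1
      rw [e]
      nlinarith

lemma runMax_rpow_le {p : ℝ} (hp : 1 < p) (f : ℕ → ℝ) (n : ℕ) :
    runMax f n ^ p ≤ (p / (p - 1)) ^ p * |f n| ^ p -
      ∑ k ∈ Finset.range n, (p ^ 2 / (p - 1) * (runMax f k ^ (p - 1) * SignType.sign (f k))) *
        (f (k + 1) - f k) := by
  have h := runMax_rpow_le_aux hp f n
  have hp1 : 0 < p - 1 := by linarith
  have hK : 0 < p / (p - 1) := by positivity
  have hy := young_rpow hp.le (runMax_nonneg f n) (mul_nonneg hK.le (abs_nonneg (f n)))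
  rw [Real.mul_rpow hK.le (abs_nonneg _)] at hy
  simp_rw [mul_assoc (p ^ 2 / (p - 1))]
  rw [← Finset.mul_sum]
  set T := ∑ k ∈ Finset.range n, (runMax f k ^ (p - 1) * SignType.sign (f k)) *
        (f (k + 1) - f k)
  have e1 : p * (p / (p - 1) * |f n|) * runMax f n ^ (p - 1) =
    p / (p - 1) * (p * (runMax f n ^ (p - 1) * |f n|)) := by ring
  have e2 : p / (p - 1) * ((p - 1) * runMax f n ^ p) = p * runMax f n ^ p := by field_simp
  have e3 : p ^ 2 / (p - 1) * T = p / (p - 1) * (p * T) := by ring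
  have := mul_le_mul_of_nonneg_left h hK.le
  rw [e2, mul_sub] at this
  rw [e3]
  linarith

/-- Pathwise square function estimate, exponents at least two. -/
lemma Samples.sqVar_rpow_le_aux {q : ℝ} (hq : 1 ≤ q) {f a : ℕ → ℝ} (h : Samples f a) (n : ℕ) :
    sqVar a n ^ q + q * (sqVar a n ^ (q - 1) *
        ((f n - a n) ^ 2 - f n ^ 2 - 4 * runMax f n ^ 2)) ≤
      - (q * ∑ k ∈ Finset.range n, (2 * (sqVar a k ^ (q - 1) * a k)) * (f (k + 1) - f k)) := by
  induction n with
  | zero =>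
    have : sqVar a 0 = 0 := by simp [sqVar]
    simp only [this, h.zero, Finset.range_zero, Finset.sum_empty]
    rw [Real.zero_rpow (by linarith)]
    have h0 : (0 : ℝ) ≤ 0 ^ (q - 1) := Real.rpow_nonneg le_rfl _
    have : 0 ≤ q * (0 ^ (q - 1) * (f 0 ^ 2 + 4 * runMax f 0 ^ 2)) := by positivity
    nlinarith
  | succ n ih =>
    rw [Finset.sum_range_succ]
    have hQ := sqVar_succ a n
    have hQ0 := sqVar_nonneg a n
    have hQ1 := sqVar_nonneg a (n + 1)
    have hw : sqVar a n ^ (q - 1) ≤ sqVar a (n + 1) ^ (q - 1) :=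
      Real.rpow_le_rpow hQ0 (sqVar_mono a n.le_succ) (by linarith)
    have hw0 : 0 ≤ sqVar a n ^ (q - 1) := Real.rpow_nonneg hQ0 _
    have hy := young_rpow hq hQ1 hQ0
    have hQq := mul_rpow_sub_one hQ1 (p := q) (by linarith)
    have hM : runMax f n ≤ runMax f (n + 1) := runMax_mono f n.le_succ
    have hM0 := runMax_nonneg f n
    have key : (a (n + 1) - a n) ^ 2 + (f (n + 1) - a (n + 1)) ^ 2 = (f (n + 1) - a n) ^ 2 := by
      rcases h.succ n with h1 | h1 <;> rw [h1] <;> ring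
    have h4 : (f (n + 1) - a n) ^ 2 ≤ 4 * runMax f (n + 1) ^ 2 := by
      have h1 := abs_le.1 (abs_le_runMax_self f (n + 1))
      have h2 := abs_le.1 ((h.abs_apply_le n).trans hM)
      nlinarith
    set w := sqVar a n ^ (q - 1)
    set w' := sqVar a (n + 1) ^ (q - 1)
    set m := runMax f n
    set m' := runMax f (n + 1)
    have hy' : sqVar a (n + 1) ^ q - sqVar a n ^ q ≤ q * (w' * (a (n + 1) - a n) ^ 2) := by
      have : (a (n + 1) - a n) ^ 2 = sqVar a (n + 1) - sqVar a n := by linarith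
      rw [this]
      linear_combination hy - q * hQq
    have hd : 0 ≤ q * ((w' - w) * (f (n + 1) ^ 2 + 4 * m' ^ 2 - (f (n + 1) - a n) ^ 2)) := by
      refine mul_nonneg (by linarith) (mul_nonneg (by linarith) ?_)
      nlinarith [sq_nonneg (f (n + 1))]
    have hm : 0 ≤ q * (w * (4 * (m' ^ 2 - m ^ 2))) := by
      refine mul_nonneg (by linarith) (mul_nonneg hw0 ?_)
      nlinarith
    linear_combination ih + hy' + hd + hm + (q * w') * key

lemma Samples.sqVar_rpow_le_of_one_le {q : ℝ} (hq : 1 ≤ q) {f a : ℕ → ℝ} (h : Samples f a)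
    (n : ℕ) :
    sqVar a n ^ q ≤ (5 * q) ^ q * runMax f n ^ (2 * q) -
      ∑ k ∈ Finset.range n, (q ^ 2 * (2 * (sqVar a k ^ (q - 1) * a k))) * (f (k + 1) - f k) := by
  have h1 := h.sqVar_rpow_le_aux hq n
  have hQ0 := sqVar_nonneg a n
  have hy := young_rpow hq hQ0 (y := 5 * q * runMax f n ^ 2) (by positivity)
  rw [Real.mul_rpow (by positivity) (by positivity), ← Real.rpow_natCast, ← Real.rpow_mul
    (runMax_nonneg f n)] at hy
  simp_rw [mul_assoc (q ^ 2)]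
  rw [← Finset.mul_sum]
  set T := ∑ k ∈ Finset.range n, (2 * (sqVar a k ^ (q - 1) * a k)) * (f (k + 1) - f k)
  have hw0 : 0 ≤ sqVar a n ^ (q - 1) := Real.rpow_nonneg hQ0 _
  set w := sqVar a n ^ (q - 1)
  have hM : f n ^ 2 ≤ runMax f n ^ 2 := sq_le_sq' (abs_le.1 (abs_le_runMax_self f n)).1
    (abs_le.1 (abs_le_runMax_self f n)).2
  have h2 : q * (q * (w * (f n ^ 2 + 4 * runMax f n ^ 2 - (f n - a n) ^ 2))) ≤
      q * (q * (w * (5 * runMax f n ^ 2))) := by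
    gcongr
    nlinarith [sq_nonneg (f n - a n)]
  have h3 := mul_le_mul_of_nonneg_left h1 (by linarith : 0 ≤ q)
  push_cast at hy
  rw [Real.rpow_two] at hy
  linear_combination hy + h2 + h3

lemma rpow_sub_one_monotone {p R x y : ℝ} (hp : 1 < p) (hp2 : p ≤ 2) (hx : |x| ≤ R)
    (hy : |y| ≤ R) (hxy : x ≤ y) :
    (p - 1) * (y - x) ≤ R ^ (2 - p) * (|y| ^ (p - 2) * y - |x| ^ (p - 2) * x) := by
  have pos : ∀ u v : ℝ, 0 ≤ u → u ≤ v → v ≤ R →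
      (p - 1) * (v - u) ≤ R ^ (2 - p) * (v ^ (p - 1) - u ^ (p - 1)) := by
    intro u v hu huv hv
    have h0v := hu.trans huv
    have h := Real.geom_mean_le_arith_mean2_weighted (w₁ := p - 1) (w₂ := 2 - p)
      (by linarith) (by linarith) hu h0v (by ring)
    have e : v ^ (2 - p) * v ^ (p - 1) = v := by
      rw [← Real.rpow_add' h0v (by norm_num)]; norm_num
    have h1 : v ^ (2 - p) * (v ^ (p - 1) - u ^ (p - 1)) ≤
        R ^ (2 - p) * (v ^ (p - 1) - u ^ (p - 1)) := by
      gcongr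
      exact sub_nonneg.2 (Real.rpow_le_rpow hu huv (by linarith))
    linarith
  have id : ∀ u : ℝ, 0 ≤ u → |u| ^ (p - 2) * u = u ^ (p - 1) := by
    intro u hu
    rw [abs_of_nonneg hu]
    have := mul_rpow_sub_one hu (p := p - 1) (by linarith)
    rwa [show p - 1 - 1 = p - 2 by ring] at this
  have idn : ∀ u : ℝ, u ≤ 0 → |u| ^ (p - 2) * u = - (-u) ^ (p - 1) := by
    intro u hu
    have := id (-u) (by linarith)
    rw [abs_neg] at this
    linarith
  have hx' := abs_le.1 hx
  have hy' := abs_le.1 hy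
  have z : (0 : ℝ) ^ (p - 1) = 0 := Real.zero_rpow (by linarith)
  rcases le_total 0 x with h0 | h0
  · rw [id x h0, id y (h0.trans hxy)]
    exact pos x y h0 hxy hy'.2
  rcases le_total 0 y with h1 | h1
  · rw [idn x h0, id y h1]
    have a1 := pos 0 y le_rfl h1 hy'.2
    have a2 := pos 0 (-x) le_rfl (by linarith) (by linarith)
    rw [z] at a1 a2
    linarith
  · rw [idn x h0, idn y h1]
    have := pos (-y) (-x) (by linarith) (by linarith) (by linarith)
    linarith

/-- Strong convexity of `|x| ^ p` on bounded sets for `1 < p ≤ 2`. -/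
lemma sq_le_bregman {p R x y : ℝ} (hp : 1 < p) (hp2 : p ≤ 2) (hx : |x| ≤ R) (hy : |y| ≤ R) :
    p * (p - 1) / 2 * (y - x) ^ 2 ≤
      R ^ (2 - p) * (|y| ^ p - |x| ^ p - p * |x| ^ (p - 2) * x * (y - x)) := by
  have main : ∀ x y : ℝ, |x| ≤ R → |y| ≤ R → x < y → p * (p - 1) / 2 * (y - x) ^ 2 ≤
      R ^ (2 - p) * (|y| ^ p - |x| ^ p - p * |x| ^ (p - 2) * x * (y - x)) := by
    intro x y hx hy hxy
    set F : ℝ → ℝ := fun t => R ^ (2 - p) * (|t| ^ p - |x| ^ p - p * |x| ^ (p - 2) * x * (t - x))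
      - p * (p - 1) / 2 * (t - x) ^ 2
    have hF : ∀ t, HasDerivAt F (R ^ (2 - p) * (p * |t| ^ (p - 2) * t - p * |x| ^ (p - 2) * x)
      - p * (p - 1) * (t - x)) t := by
      intro t
      have h1 := hasDerivAt_abs_rpow t hp
      have h2 : HasDerivAt (fun t => t - x) 1 t := (hasDerivAt_id t).sub_const x
      have h3 := (((h1.sub_const (|x| ^ p)).sub (h2.const_mul (p * |x| ^ (p - 2) * x))).const_mul
        (R ^ (2 - p))).sub ((h2.pow 2).const_mul (p * (p - 1) / 2))
      refine h3.congr_deriv ?_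
      norm_num
      ring
    obtain ⟨t, ht, he⟩ := exists_hasDerivAt_eq_slope F _ hxy
      (fun t _ => (hF t).continuousAt.continuousWithinAt) (fun t _ => hF t)
    have hx' := abs_le.1 hx
    have hy' := abs_le.1 hy
    have hm := rpow_sub_one_monotone hp hp2 hx (y := t)
      (abs_le.2 ⟨by linarith [ht.1], by linarith [ht.2]⟩) ht.1.le
    have h0 : 0 ≤ (F y - F x) / (y - x) := by
      rw [← he]
      have := mul_le_mul_of_nonneg_left hm (by linarith : 0 ≤ p)
      linear_combination this
    have h1 : 0 ≤ F y - F x := by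
      rcases div_nonneg_iff.1 h0 with h | h
      · exact h.1
      · linarith [h.2]
    have h2 : F x = 0 := by simp [F]
    have h3 : 0 ≤ F y := by linarith
    simpa [F] using h3
  rcases lt_trichotomy x y with h | h | h
  · exact main x y hx hy h
  · subst h; simp
  · have := main (-x) (-y) (by rwa [abs_neg]) (by rwa [abs_neg]) (by linarith)
    simp only [abs_neg] at this
    linear_combination this

lemma Samples.sqVar_le_bregman {p : ℝ} (hp : 1 < p) (hp2 : p ≤ 2) {f a : ℕ → ℝ}
    (h : Samples f a) (n : ℕ) :
    ∃ K : ℝ, 0 ≤ K ∧ p * (p - 1) / 2 * sqVar a n ≤ runMax f n ^ (2 - p) * K ∧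
      K + (|f n| ^ p - |a n| ^ p - p * |a n| ^ (p - 2) * a n * (f n - a n)) =
        |f n| ^ p - |f 0| ^ p -
        ∑ k ∈ Finset.range n, (p * |a k| ^ (p - 2) * a k) * (f (k + 1) - f k) := by
  induction n with
  | zero => exact ⟨0, le_rfl, by simp [sqVar], by simp [h.zero]⟩
  | succ n ih =>
    obtain ⟨K, hK, h1, h2⟩ := ih
    rw [Finset.sum_range_succ, sqVar_succ]
    have hM := Real.rpow_le_rpow (z := 2 - p) (runMax_nonneg f n) (runMax_mono f n.le_succ)
      (by linarith)
    have hM0 : 0 ≤ runMax f n ^ (2 - p) := Real.rpow_nonneg (runMax_nonneg f n) _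
    have hMK := mul_le_mul_of_nonneg_right hM hK
    rcases h.succ n with h3 | h3
    · have hb := sq_le_bregman hp hp2 ((h.abs_apply_le n).trans (runMax_mono f n.le_succ))
        (abs_le_runMax_self f (n + 1))
      set D := |f (n + 1)| ^ p - |a n| ^ p - p * |a n| ^ (p - 2) * a n * (f (n + 1) - a n) with hD
      have hD0 : 0 ≤ D := by
        have hb' := sq_le_bregman (x := a n) (y := f (n + 1)) (R := runMax f (n + 1) + 1) hp hp2
          (((h.abs_apply_le n).trans (runMax_mono f n.le_succ)).trans (by linarith))
          ((abs_le_runMax_self f (n + 1)).trans (by linarith))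
        have hR : 0 < (runMax f (n + 1) + 1) ^ (2 - p) :=
          Real.rpow_pos_of_pos (by linarith [runMax_nonneg f (n + 1)]) _
        have h0 : 0 ≤ p * (p - 1) / 2 * (f (n + 1) - a n) ^ 2 := by
          have : 0 < p - 1 := by linarith
          positivity
        exact nonneg_of_mul_nonneg_right (h0.trans hb') hR
      refine ⟨K + D, by positivity, ?_, ?_⟩
      · rw [h3]; linear_combination h1 + hb + hMK
      · rw [h3]; linear_combination h2
    · refine ⟨K, hK, ?_, ?_⟩
      · rw [h3]; linear_combination h1 + hMK
      · rw [h3]; linear_combination h2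

/-- Pathwise square function estimate, exponents at most two. -/
lemma Samples.sqVar_rpow_le_of_le_two {p : ℝ} (hp : 1 < p) (hp2 : p ≤ 2) {f a : ℕ → ℝ}
    (h : Samples f a) (n : ℕ) :
    sqVar a n ^ (p / 2) ≤ (p * (p - 1) / 2) ^ (-(p / 2)) * (runMax f n ^ p + |f n| ^ p) -
      ∑ k ∈ Finset.range n, ((p * (p - 1) / 2) ^ (-(p / 2)) * (p * |a k| ^ (p - 2) * a k)) *
        (f (k + 1) - f k) := by
  obtain ⟨K, hK, h1, h2⟩ := h.sqVar_le_bregman hp hp2 n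
  have hp1 : 0 < p - 1 := by linarith
  set c := p * (p - 1) / 2
  have hc : 0 < c := by positivity
  have hM := runMax_nonneg f n
  have hb := sq_le_bregman hp hp2 (R := runMax f n + 1)
    ((h.abs_apply_le n).trans (by linarith)) ((abs_le_runMax_self f n).trans (by linarith))
  have hR : 0 < (runMax f n + 1) ^ (2 - p) := Real.rpow_pos_of_pos (by linarith) _
  have hD := nonneg_of_mul_nonneg_right ((by positivity : (0:ℝ) ≤ c * (f n - a n) ^ 2).trans hb) hR
  have hf0 : 0 ≤ |f 0| ^ p := by positivity
  simp_rw [mul_assoc (c ^ (-(p / 2)))]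
  rw [← Finset.mul_sum, ← mul_sub]
  have h3 : (c * sqVar a n) ^ (p / 2) ≤ runMax f n ^ p + K := by
    have hg := Real.geom_mean_le_arith_mean2_weighted (w₁ := 1 - p / 2) (w₂ := p / 2)
      (by linarith) (by linarith) (Real.rpow_nonneg hM p) hK (by ring)
    calc (c * sqVar a n) ^ (p / 2) ≤ (runMax f n ^ (2 - p) * K) ^ (p / 2) :=
          Real.rpow_le_rpow (mul_nonneg hc.le (sqVar_nonneg a n)) h1 (by linarith)
      _ = (runMax f n ^ p) ^ (1 - p / 2) * K ^ (p / 2) := by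
          rw [Real.mul_rpow (Real.rpow_nonneg hM _) hK, ← Real.rpow_mul hM, ← Real.rpow_mul hM]
          ring_nf
      _ ≤ _ := hg
      _ ≤ runMax f n ^ p + K := by
          have := Real.rpow_nonneg hM p
          nlinarith
  have h4 : sqVar a n ^ (p / 2) = c ^ (-(p / 2)) * (c * sqVar a n) ^ (p / 2) := by
    rw [Real.mul_rpow hc.le (sqVar_nonneg a n), ← mul_assoc, ← Real.rpow_add hc]
    simp
  rw [h4]
  gcongr
  linarith

/-- The value of `f` at the last time it moved by at least `δ` times its running maximum. -/
noncomputable def anchor (δ : ℝ) (f : ℕ → ℝ) : ℕ → ℝ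
  | 0 => f 0
  | n + 1 => if δ * runMax f (n + 1) ≤ |f (n + 1) - anchor δ f n| then f (n + 1)
      else anchor δ f n

lemma anchor_samples (δ : ℝ) (f : ℕ → ℝ) : Samples f (anchor δ f) where
  zero := rfl
  succ n := by
    rw [anchor]
    split_ifs
    · exact Or.inl rfl
    · exact Or.inr rfl

lemma abs_sub_anchor_le {δ : ℝ} (hδ : 0 ≤ δ) (f : ℕ → ℝ) (n : ℕ) :
    |f n - anchor δ f n| ≤ δ * runMax f n := by
  have h0 := mul_nonneg hδ (runMax_nonneg f n)
  cases n with
  | zero => simpa [anchor] using h0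
  | succ n =>
    rw [anchor]
    split_ifs with h
    · simpa using h0
    · exact (not_le.1 h).le

/-- If `f` moves by more than `2 δ` times its running maximum, then the anchored sequence makes
an increment which is comparable to `δ` times the running maximum. -/
lemma abs_sub_le_or_sqVar {δ : ℝ} (hδ : 0 ≤ δ) (hδ2 : δ ≤ 1 / 2) (f : ℕ → ℝ) {s T : ℕ}
    (hsT : s ≤ T) :
    |f T - f s| ≤ 2 * (δ * runMax f T) ∨
      (δ * runMax f T) ^ 2 / 4 ≤ sqVar (anchor δ f) T - sqVar (anchor δ f) s := by
  set a := anchor δ f with ha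
  set M := runMax f T
  have hM : 0 ≤ M := runMax_nonneg f T
  have key : ∀ t, s ≤ t → (δ * M) ^ 2 / 4 ≤ sqVar a t - sqVar a s ∨ a t = a s ∨
      (|a t| < M / 2 ∧ runMax f s < M / 2) := by
    intro t ht
    induction t, ht using Nat.le_induction with
    | base => exact Or.inr (Or.inl rfl)
    | succ t ht ih =>
      have hm : sqVar a t ≤ sqVar a (t + 1) := sqVar_mono a t.le_succ
      by_cases hj : δ * runMax f (t + 1) ≤ |f (t + 1) - a t|
      · have hat : a (t + 1) = f (t + 1) := by rw [ha, anchor, if_pos hj]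
        by_cases hlt : runMax f (t + 1) < M / 2
        · right; right
          rw [hat]
          exact ⟨(abs_le_runMax_self f _).trans_lt hlt,
            (runMax_mono f (ht.trans t.le_succ)).trans_lt hlt⟩
        · left
          have h1 : δ * M / 2 ≤ |f (t + 1) - a t| := by
            refine le_trans ?_ hj
            have := mul_le_mul_of_nonneg_left (not_lt.1 hlt) hδ
            linarith
          have h2 : (δ * M / 2) ^ 2 ≤ (f (t + 1) - a t) ^ 2 := by
            rw [← sq_abs (f (t + 1) - a t)]
            gcongr
          have h3 := sqVar_mono a ht
          rw [sqVar_succ, hat]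
          linarith
      · have hat : a (t + 1) = a t := by rw [ha, anchor, if_neg hj]
        rw [hat]
        rcases ih with h | h
        · exact Or.inl (by linarith)
        · exact Or.inr h
  have hs := abs_le.1 (abs_sub_anchor_le hδ f s)
  have hT := abs_le.1 (abs_sub_anchor_le hδ f T)
  rw [← ha] at hs hT
  have hsM : δ * runMax f s ≤ δ * M := mul_le_mul_of_nonneg_left (runMax_mono f hsT) hδ
  by_cases hms : runMax f s < M / 2
  · right
    obtain ⟨v, hvT, hv⟩ := exists_abs_eq_runMax f T
    have hsv : s ≤ v := by
      by_contra hlt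
      have := abs_le_runMax f (not_le.1 hlt).le
      rw [hv] at this
      linarith
    have hav := (abs_sub_anchor_le hδ f v)
    rw [← ha] at hav
    have h1 : M / 2 ≤ |a v| := by
      have h2 := abs_sub_abs_le_abs_sub (f v) (a v)
      have h3 : δ * runMax f v ≤ 1 / 2 * M :=
        mul_le_mul hδ2 (runMax_mono f hvT) (runMax_nonneg f v) (by norm_num)
      rw [hv] at h2
      linarith
    rcases key v hsv with h | h | h
    · exact h.trans (by linarith [sqVar_mono a hvT])
    · have := (anchor_samples δ f).abs_apply_le s
      rw [← ha, ← h] at this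
      linarith
    · linarith [h.1]
  · rcases key T hsT with h | h | h
    · exact Or.inr h
    · left
      rw [h] at hT
      exact abs_le.2 ⟨by linarith, by linarith⟩
    · exact absurd h.2 hms

/-- The dyadic thresholds. -/
noncomputable def thr (m : ℕ) : ℝ := (1 / 2) ^ (m + 1)

lemma thr_pos (m : ℕ) : 0 < thr m := by unfold thr; positivity

lemma thr_le (m : ℕ) : thr m ≤ 1 / 2 := by
  unfold thr
  rw [pow_succ]
  have := pow_le_one₀ (n := m) (by norm_num : (0:ℝ) ≤ 1 / 2) (by norm_num)
  linarith

lemma exists_scale {d M : ℝ} (hd : 0 < d) (hdM : d ≤ 2 * M) :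
    ∃ m : ℕ, 2 * (thr m * M) < d ∧ d ≤ 4 * (thr m * M) := by
  have hM : 0 < M := by linarith
  have hex : ∃ m : ℕ, 2 * (thr m * M) < d := by
    obtain ⟨m, hm⟩ := exists_pow_lt_of_lt_one (show 0 < d / M by positivity)
      (by norm_num : (1 / 2 : ℝ) < 1)
    refine ⟨m, ?_⟩
    rw [lt_div_iff₀ hM] at hm
    unfold thr
    rw [pow_succ]
    linarith
  classical
  refine ⟨Nat.find hex, Nat.find_spec hex, ?_⟩
  rcases h : Nat.find hex with _ | m
  · unfold thr; norm_num; linarith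
  · have := Nat.find_min hex (m := m) (by omega)
    unfold thr at this ⊢
    rw [pow_succ]
    linarith

lemma exists_rpow_le_sqVar {r : ℝ} (hr : 2 < r) (f : ℕ → ℝ) {s t n : ℕ} (hst : s ≤ t)
    (htn : t ≤ n) (hne : f t ≠ f s) :
    ∃ m : ℕ, |f t - f s| ^ r ≤ 64 * (4 * (thr m * runMax f n)) ^ (r - 2) *
      (sqVar (anchor (thr m) f) t - sqVar (anchor (thr m) f) s) := by
  have hd : 0 < |f t - f s| := abs_pos.2 (sub_ne_zero.2 hne)
  have hdM : |f t - f s| ≤ 2 * runMax f t := by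
    have h1 := abs_sub (f t) (f s)
    have h2 := abs_le_runMax_self f t
    have h3 := abs_le_runMax f hst
    linarith
  obtain ⟨m, h1, h2⟩ := exists_scale hd hdM
  refine ⟨m, ?_⟩
  have h3 := (abs_sub_le_or_sqVar (thr_pos m).le (thr_le m) f hst).resolve_left (not_le.2 h1)
  have hM := runMax_mono f htn
  have hM0 := runMax_nonneg f t
  have ht := thr_pos m
  have e : |f t - f s| ^ r = |f t - f s| ^ (r - 2) * |f t - f s| ^ 2 := by
    rw [← Real.rpow_natCast, ← Real.rpow_add hd]
    norm_num
  have h4 : |f t - f s| ^ 2 ≤ (4 * (thr m * runMax f t)) ^ 2 := by gcongr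
  have h5 : |f t - f s| ^ (r - 2) ≤ (4 * (thr m * runMax f n)) ^ (r - 2) := by
    refine Real.rpow_le_rpow hd.le (h2.trans ?_) (by linarith)
    gcongr
  calc |f t - f s| ^ r = |f t - f s| ^ (r - 2) * |f t - f s| ^ 2 := e
    _ ≤ (4 * (thr m * runMax f n)) ^ (r - 2) *
        (64 * (sqVar (anchor (thr m) f) t - sqVar (anchor (thr m) f) s)) := by
      refine mul_le_mul h5 (by linarith) (by positivity) (Real.rpow_nonneg ?_ _)
      have := runMax_nonneg f n
      positivity
    _ = _ := by ring

/-- The pathwise variation bound in terms of the square functions at all scales. -/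
lemma sum_rpow_le_tsum {r : ℝ} (hr : 2 < r) (f : ℕ → ℝ) {J : ℕ} {t : ℕ → ℕ}
    (ht : StrictMonoOn t (Set.Iic J)) :
    ∑ j ∈ Finset.range J, (‖f (t (j + 1)) - f (t j)‖₊ : ℝ≥0∞) ^ r ≤
      ∑' m : ℕ, ENNReal.ofReal (64 * (4 * (thr m * runMax f (t J))) ^ (r - 2) *
        sqVar (anchor (thr m) f) (t J)) := by
  set B : ℕ → ℝ := fun m => 64 * (4 * (thr m * runMax f (t J))) ^ (r - 2)
  have hB : ∀ m, 0 ≤ B m := fun m => by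
    have := runMax_nonneg f (t J)
    have := thr_pos m
    positivity
  set Q : ℕ → ℕ → ℝ := fun m n => sqVar (anchor (thr m) f) n
  have hmono : ∀ j < J, t j ≤ t (j + 1) := fun j hj =>
    (ht (Set.mem_Iic.2 hj.le) (Set.mem_Iic.2 hj) j.lt_succ_self).le
  have hlast : ∀ j ≤ J, t j ≤ t J := fun j hj =>
    ht.monotoneOn (Set.mem_Iic.2 hj) (Set.mem_Iic.2 le_rfl) hj
  have h1 : ∀ j ∈ Finset.range J, (‖f (t (j + 1)) - f (t j)‖₊ : ℝ≥0∞) ^ r ≤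
      ∑' m, ENNReal.ofReal (B m * (Q m (t (j + 1)) - Q m (t j))) := by
    intro j hj
    have hj := Finset.mem_range.1 hj
    by_cases hne : f (t (j + 1)) = f (t j)
    · simp [hne, ENNReal.zero_rpow_of_pos (by linarith : 0 < r)]
    · obtain ⟨m, hm⟩ := exists_rpow_le_sqVar hr f (hmono j hj) (hlast (j + 1) hj) hne
      have e : (‖f (t (j + 1)) - f (t j)‖₊ : ℝ≥0∞) ^ r =
          ENNReal.ofReal (|f (t (j + 1)) - f (t j)| ^ r) := by
        rw [← ENNReal.ofReal_rpow_of_nonneg (abs_nonneg _) (by linarith), ← Real.norm_eq_abs,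
          ofReal_norm]
        rfl
      rw [e]
      exact (ENNReal.ofReal_le_ofReal hm).trans
        (ENNReal.le_tsum (f := fun m => ENNReal.ofReal (B m * (Q m (t (j + 1)) - Q m (t j)))) m)
  refine (Finset.sum_le_sum h1).trans ?_
  rw [← Summable.tsum_finsetSum fun _ _ => ENNReal.summable]
  refine ENNReal.tsum_le_tsum fun m => ?_
  rw [← ENNReal.ofReal_sum_of_nonneg, ← Finset.mul_sum, Finset.sum_range_sub fun j => Q m (t j)]
  · refine ENNReal.ofReal_le_ofReal (mul_le_mul_of_nonneg_left ?_ (hB m))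
    linarith [sqVar_nonneg (anchor (thr m) f) (t 0)]
  · intro j hj
    exact mul_nonneg (hB m) (sub_nonneg.2 (sqVar_mono _ (hmono j (Finset.mem_range.1 hj))))

lemma iSup_rpow_le_tsum {z : ℕ → ℝ≥0∞} {e : ℝ} (he : 0 < e) :
    (⨆ m, z m) ^ e ≤ ∑' m, z m ^ e := by
  rw [← ENNReal.le_rpow_inv_iff he]
  refine iSup_le fun m => ?_
  rw [ENNReal.le_rpow_inv_iff he]
  exact ENNReal.le_tsum (f := fun m => z m ^ e) m

lemma mul_rpow_le_add {M Z : ℝ≥0∞} {r p : ℝ} (hr : 2 < r) (hp : 0 < p) :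
    (M ^ (r - 2) * Z) ^ (p / r) ≤ M ^ p + Z ^ (p / 2) := by
  have hr0 : 0 < r := by linarith
  set u := max M (Z ^ (1 / 2 : ℝ))
  have hZ : Z ≤ u ^ (2 : ℝ) := by
    calc Z = (Z ^ (1 / 2 : ℝ)) ^ (2 : ℝ) := by rw [← ENNReal.rpow_mul]; norm_num
      _ ≤ u ^ (2 : ℝ) := ENNReal.rpow_le_rpow (le_max_right _ _) (by norm_num)
  have h1 : M ^ (r - 2) * Z ≤ u ^ r := by
    calc M ^ (r - 2) * Z ≤ u ^ (r - 2) * u ^ (2 : ℝ) :=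
          mul_le_mul' (ENNReal.rpow_le_rpow (le_max_left _ _) (by linarith)) hZ
      _ = u ^ r := by
          rw [← ENNReal.rpow_add_of_nonneg _ _ (by linarith) (by norm_num)]; norm_num
  calc (M ^ (r - 2) * Z) ^ (p / r) ≤ (u ^ r) ^ (p / r) := ENNReal.rpow_le_rpow h1 (by positivity)
    _ = u ^ p := by rw [← ENNReal.rpow_mul, mul_div_cancel₀ _ hr0.ne']
    _ ≤ M ^ p + Z ^ (p / 2) := by
      rcases le_total M (Z ^ (1 / 2 : ℝ)) with h | h
      · simp only [u, max_eq_right h, ← ENNReal.rpow_mul]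
        rw [one_div_mul_eq_div]
        exact le_add_self
      · simp only [u, max_eq_left h]
        exact le_self_add

/-- A constant in the pathwise variation bound. -/
noncomputable def varConst (r : ℝ) : ℝ≥0∞ :=
  ENNReal.ofReal (64 * 2 ^ (r - 2)) * (1 - ENNReal.ofReal ((1 / 2) ^ ((r - 2) / 2)))⁻¹

lemma varConst_ne_top {r : ℝ} (hr : 2 < r) : varConst r ≠ ∞ := by
  refine ENNReal.mul_ne_top ENNReal.ofReal_ne_top (ENNReal.inv_ne_top.2 ?_)
  rw [← ENNReal.ofReal_one, ← ENNReal.ofReal_sub _ (by positivity)]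
  refine (ENNReal.ofReal_pos.2 (sub_pos.2 ?_)).ne'
  exact Real.rpow_lt_one (by norm_num) (by norm_num) (by linarith)

/-- The majorant of the `p`-th power of the `r`-variation up to time `n`. -/
noncomputable def majorant (r p : ℝ) (f : ℕ → ℝ) (n : ℕ) : ℝ≥0∞ :=
  varConst r ^ (p / r) * (ENNReal.ofReal (runMax f n ^ p) +
    ∑' m : ℕ, ENNReal.ofReal (((1 / 2) ^ ((r - 2) / 2 * (p / 2))) ^ m) *
      ENNReal.ofReal (sqVar (anchor (thr m) f) n ^ (p / 2)))

lemma sum_rpow_rpow_le_majorant {r p : ℝ} (hr : 2 < r) (hp : 0 < p) (f : ℕ → ℝ) {J : ℕ}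
    {t : ℕ → ℕ} (ht : StrictMonoOn t (Set.Iic J)) :
    (∑ j ∈ Finset.range J, (‖f (t (j + 1)) - f (t j)‖₊ : ℝ≥0∞) ^ r) ^ (p / r) ≤
      majorant r p f (t J) := by
  set n := t J
  set σ : ℝ := (1 / 2) ^ ((r - 2) / 2) with hσ
  have hσ0 : 0 ≤ σ := by positivity
  set Q : ℕ → ℝ := fun m => sqVar (anchor (thr m) f) n
  have hQ : ∀ m, 0 ≤ Q m := fun m => sqVar_nonneg _ _
  have hM := runMax_nonneg f n
  set Z : ℝ≥0∞ := ⨆ m, ENNReal.ofReal (σ ^ m * Q m)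
  have hσσ : ∀ m, (4 * (thr m * runMax f n)) ^ (r - 2) =
      2 ^ (r - 2) * runMax f n ^ (r - 2) * (σ ^ m * σ ^ m) := by
    intro m
    have e1 : 4 * (thr m * runMax f n) = 2 * runMax f n * (1 / 2) ^ m := by
      unfold thr; rw [pow_succ]; ring
    have e2 : ((1 / 2 : ℝ) ^ m) ^ (r - 2) = σ ^ m * σ ^ m := by
      rw [hσ, ← Real.rpow_natCast, ← Real.rpow_natCast, ← Real.rpow_mul (by norm_num),
        ← Real.rpow_mul (by norm_num), ← Real.rpow_add (by norm_num)]
      congr 1; ring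
    rw [e1, Real.mul_rpow (by positivity) (by positivity), Real.mul_rpow (by norm_num) hM, e2]
  have h1 : ∑ j ∈ Finset.range J, (‖f (t (j + 1)) - f (t j)‖₊ : ℝ≥0∞) ^ r ≤
      varConst r * (ENNReal.ofReal (runMax f n) ^ (r - 2) * Z) := by
    refine (sum_rpow_le_tsum hr f ht).trans ?_
    calc _ ≤ ∑' m : ℕ, ENNReal.ofReal (64 * 2 ^ (r - 2)) *
          (ENNReal.ofReal (runMax f n) ^ (r - 2) * Z) * ENNReal.ofReal σ ^ m := by
          refine ENNReal.tsum_le_tsum fun m => ?_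
          have e : 64 * (4 * (thr m * runMax f n)) ^ (r - 2) * Q m =
              64 * 2 ^ (r - 2) * (runMax f n ^ (r - 2) * (σ ^ m * Q m)) * σ ^ m := by
            rw [hσσ]; ring
          have hq := hQ m
          have hMr : 0 ≤ runMax f n ^ (r - 2) := Real.rpow_nonneg hM _
          change ENNReal.ofReal (64 * (4 * (thr m * runMax f n)) ^ (r - 2) * Q m) ≤ _
          rw [e, ENNReal.ofReal_mul (by positivity), ENNReal.ofReal_mul (by positivity),
            ENNReal.ofReal_mul hMr, ENNReal.ofReal_pow hσ0,
            ENNReal.ofReal_rpow_of_nonneg hM (by linarith)]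
          gcongr
          exact le_iSup (fun m => ENNReal.ofReal (σ ^ m * Q m)) m
      _ = _ := by
          rw [ENNReal.tsum_mul_left, ENNReal.tsum_geometric, varConst]
          ring
  calc _ ≤ (varConst r * (ENNReal.ofReal (runMax f n) ^ (r - 2) * Z)) ^ (p / r) :=
        ENNReal.rpow_le_rpow h1 (div_nonneg hp.le (by linarith))
    _ = varConst r ^ (p / r) * (ENNReal.ofReal (runMax f n) ^ (r - 2) * Z) ^ (p / r) :=
        ENNReal.mul_rpow_of_nonneg _ _ (div_nonneg hp.le (by linarith))
    _ ≤ varConst r ^ (p / r) * (ENNReal.ofReal (runMax f n) ^ p + Z ^ (p / 2)) := by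
        gcongr
        exact mul_rpow_le_add hr hp
    _ ≤ majorant r p f n := by
        unfold majorant
        rw [ENNReal.ofReal_rpow_of_nonneg hM hp.le]
        gcongr
        refine (iSup_rpow_le_tsum (half_pos hp)).trans (ENNReal.tsum_le_tsum fun m => ?_)
        rw [ENNReal.ofReal_rpow_of_nonneg (mul_nonneg (pow_nonneg hσ0 m) (hQ m)) (by positivity),
          Real.mul_rpow (pow_nonneg hσ0 m) (hQ m),
          ENNReal.ofReal_mul (Real.rpow_nonneg (pow_nonneg hσ0 m) _)]
        refine le_of_eq ?_
        congr 2
        rw [hσ, ← Real.rpow_natCast, ← Real.rpow_natCast, ← Real.rpow_mul (by positivity),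
          ← Real.rpow_mul (by norm_num), ← Real.rpow_mul (by norm_num)]
        congr 1; ring

lemma rVariation_rpow_le_majorant {r p : ℝ} (hr : 2 < r) (hp : 0 < p) (f : ℕ → ℝ) :
    rVariation r f ^ p ≤ ⨆ n, majorant r p f n := by
  rw [← ENNReal.le_rpow_inv_iff hp]
  refine iSup_le fun J => iSup_le fun t => iSup_le fun ht => ?_
  rw [ENNReal.le_rpow_inv_iff hp, ← ENNReal.rpow_mul, one_div_mul_eq_div]
  exact (sum_rpow_rpow_le_majorant hr hp f ht).trans (le_iSup (majorant r p f) (t J))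

lemma majorant_mono {r p : ℝ} (hp : 0 ≤ p) (f : ℕ → ℝ) : Monotone (majorant r p f) := by
  intro i j hij
  unfold majorant
  gcongr with m
  · exact runMax_nonneg f i
  · exact runMax_mono f hij
  · exact sqVar_nonneg _ i
  · exact sqVar_mono _ hij

section Measurability

variable {X : Type*} [MeasurableSpace X] {f : ℕ → X → ℝ} {n : ℕ}

lemma measurable_runMax (hf : ∀ k ≤ n, Measurable (f k)) :
    Measurable fun x => runMax (fun k => f k x) n := by
  induction n with
  | zero => exact (hf 0 le_rfl).abs
  | succ n ih =>
    exact (ih fun k hk => hf k (hk.trans n.le_succ)).max (hf (n + 1) le_rfl).abs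

lemma measurable_anchor (δ : ℝ) (hf : ∀ k ≤ n, Measurable (f k)) :
    Measurable fun x => anchor δ (fun k => f k x) n := by
  induction n with
  | zero => exact hf 0 le_rfl
  | succ n ih =>
    have h := ih fun k hk => hf k (hk.trans n.le_succ)
    have h1 := hf (n + 1) le_rfl
    exact Measurable.ite (measurableSet_le ((measurable_runMax hf).const_mul δ)
      (h1.sub h).abs) h1 h

lemma measurable_sqVar_anchor (δ : ℝ) (hf : ∀ k ≤ n, Measurable (f k)) :
    Measurable fun x => sqVar (anchor δ fun k => f k x) n := by
  unfold sqVar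
  refine Finset.measurable_sum _ fun k hk => ?_
  have hk := Finset.mem_range.1 hk
  exact ((measurable_anchor δ fun i hi => hf i (hi.trans hk)).sub
    (measurable_anchor δ fun i hi => hf i (hi.trans hk.le))).pow_const 2

lemma measurable_majorant (r p : ℝ) (hf : ∀ k ≤ n, Measurable (f k)) :
    Measurable fun x => majorant r p (fun k => f k x) n := by
  unfold majorant
  have hM := ((measurable_runMax hf).pow_const p).ennreal_ofReal
  have hQ := fun m : ℕ =>
    (((measurable_sqVar_anchor (thr m) hf).pow_const (p / 2)).ennreal_ofReal.const_mul
      (ENNReal.ofReal (((1 / 2) ^ ((r - 2) / 2 * (p / 2))) ^ m)))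
  exact (hM.add (Measurable.tsum (L := .unconditional ℕ) hQ)).const_mul _

end Measurability

section Martingale

variable {X : Type*} {m0 : MeasurableSpace X} {μ : Measure X} {ℱ : Filtration ℕ m0}
  {𝔣 : ℕ → X → ℝ} {p : ℝ}

lemma measurable_of_martingale (h : Martingale 𝔣 ℱ μ) (n : ℕ) :
    ∀ k ≤ n, Measurable[ℱ n] (𝔣 k) := fun k hk =>
  ((h.stronglyMeasurable k).mono (ℱ.mono hk)).measurable

lemma integrable_runMax_rpow (hp : 1 < p) (hL : ∀ n, Integrable (fun x => |𝔣 n x| ^ p) μ)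
    (n : ℕ) : Integrable (fun x => runMax (fun k => 𝔣 k x) n ^ p) μ := by
  induction n with
  | zero => exact hL 0
  | succ n ih =>
    refine (ih.sup (hL (n + 1))).congr (ae_of_all _ fun x => ?_)
    exact ((Real.monotoneOn_rpow_Ici_of_exponent_nonneg (by linarith : 0 ≤ p)).map_max
      (runMax_nonneg (fun k => 𝔣 k x) n) (abs_nonneg (𝔣 (n + 1) x))).symm

variable [IsProbabilityMeasure μ]

lemma integral_mul_increment (h : Martingale 𝔣 ℱ μ) (hp : 1 < p)
    (hL : ∀ n, Integrable (fun x => |𝔣 n x| ^ p) μ) {k : ℕ} {g : X → ℝ}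
    (hg : Measurable[ℱ k] g)
    (hb : ∃ C : ℝ, ∀ x, |g x| ≤ C * runMax (fun k => 𝔣 k x) k ^ (p - 1)) :
    Integrable (fun x => g x * (𝔣 (k + 1) x - 𝔣 k x)) μ ∧
      ∫ x, g x * (𝔣 (k + 1) x - 𝔣 k x) ∂μ = 0 := by
  obtain ⟨C, hC⟩ := hb
  have hd : Integrable (𝔣 (k + 1) - 𝔣 k) μ := (h.integrable _).sub (h.integrable _)
  have hgd : Integrable (g * (𝔣 (k + 1) - 𝔣 k)) μ := by
    refine ((integrable_runMax_rpow hp hL (k + 1)).const_mul (2 * |C|)).mono'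
      ((hg.mono (ℱ.le k) le_rfl).aestronglyMeasurable.mul hd.aestronglyMeasurable)
      (ae_of_all _ fun x => ?_)
    set f : ℕ → ℝ := fun k => 𝔣 k x
    have h1 : |f (k + 1) - f k| ≤ 2 * runMax f (k + 1) := by
      have h1 := abs_sub (f (k + 1)) (f k)
      have h2 := abs_le_runMax_self f (k + 1)
      have h3 := abs_le_runMax f k.le_succ
      linarith
    have hM := runMax_nonneg f (k + 1)
    have h2 : |g x| ≤ |C| * runMax f (k + 1) ^ (p - 1) := by
      refine (hC x).trans (mul_le_mul (le_abs_self C) ?_ ?_ (abs_nonneg C))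
      · exact Real.rpow_le_rpow (runMax_nonneg f k) (runMax_mono f k.le_succ) (by linarith)
      · exact Real.rpow_nonneg (runMax_nonneg f k) _
    calc ‖(g * (𝔣 (k + 1) - 𝔣 k)) x‖ = |g x| * |f (k + 1) - f k| := by
          simp [f]
      _ ≤ |C| * runMax f (k + 1) ^ (p - 1) * (2 * runMax f (k + 1)) := by gcongr
      _ = 2 * |C| * (runMax f (k + 1) ^ (p - 1) * runMax f (k + 1)) := by ring
      _ = 2 * |C| * runMax f (k + 1) ^ p := by rw [mul_rpow_sub_one hM (by linarith)]
  refine ⟨hgd, ?_⟩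
  have hz : μ[𝔣 (k + 1) - 𝔣 k | ℱ k] =ᵐ[μ] 0 := by
    refine (condExp_sub (h.integrable _) (h.integrable _) _).trans ?_
    filter_upwards [h.condExp_ae_eq k.le_succ, h.condExp_ae_eq (le_refl k)] with x h1 h2
    simp [h1, h2]
  have hc := condExp_mul_of_stronglyMeasurable_left hg.stronglyMeasurable hgd hd
  change ∫ x, (g * (𝔣 (k + 1) - 𝔣 k)) x ∂μ = 0
  rw [← integral_condExp (ℱ.le k)]
  refine integral_eq_zero_of_ae ?_
  filter_upwards [hc, hz] with x h1 h2
  simp [h1, h2]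

lemma integral_transform (h : Martingale 𝔣 ℱ μ) (hp : 1 < p)
    (hL : ∀ n, Integrable (fun x => |𝔣 n x| ^ p) μ) {g : ℕ → X → ℝ}
    (hg : ∀ k, Measurable[ℱ k] (g k))
    (hb : ∀ k, ∃ C : ℝ, ∀ x, |g k x| ≤ C * runMax (fun k => 𝔣 k x) k ^ (p - 1)) (n : ℕ) :
    Integrable (fun x => ∑ k ∈ Finset.range n, g k x * (𝔣 (k + 1) x - 𝔣 k x)) μ ∧
      ∫ x, ∑ k ∈ Finset.range n, g k x * (𝔣 (k + 1) x - 𝔣 k x) ∂μ = 0 := by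
  have hi := fun k => integral_mul_increment h hp hL (hg k) (hb k)
  refine ⟨integrable_finsetSum _ fun k _ => (hi k).1, ?_⟩
  rw [integral_finsetSum _ fun k _ => (hi k).1]
  exact Finset.sum_eq_zero fun k _ => (hi k).2

/-- Pathwise inequalities with a martingale transform as error term can be integrated. -/
lemma lintegral_le_of_pathwise (h : Martingale 𝔣 ℱ μ) (hp : 1 < p)
    (hL : ∀ n, Integrable (fun x => |𝔣 n x| ^ p) μ) {g : ℕ → X → ℝ}
    (hg : ∀ k, Measurable[ℱ k] (g k))
    (hb : ∀ k, ∃ C : ℝ, ∀ x, |g k x| ≤ C * runMax (fun k => 𝔣 k x) k ^ (p - 1)) {n : ℕ}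
    {F G : X → ℝ} (hG : Integrable G μ) (hF : ∀ x, 0 ≤ F x)
    (hFG : ∀ x, F x ≤ G x - ∑ k ∈ Finset.range n, g k x * (𝔣 (k + 1) x - 𝔣 k x)) :
    ∫⁻ x, ENNReal.ofReal (F x) ∂μ ≤ ENNReal.ofReal (∫ x, G x ∂μ) := by
  obtain ⟨h1, h2⟩ := integral_transform h hp hL hg hb n
  calc ∫⁻ x, ENNReal.ofReal (F x) ∂μ ≤ ∫⁻ x, ENNReal.ofReal
        (G x - ∑ k ∈ Finset.range n, g k x * (𝔣 (k + 1) x - 𝔣 k x)) ∂μ :=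
        lintegral_mono fun x => ENNReal.ofReal_le_ofReal (hFG x)
    _ = ENNReal.ofReal (∫ x, G x ∂μ) := by
        have h3 := ofReal_integral_eq_lintegral_ofReal (hG.sub h1)
          (ae_of_all _ fun x => (hF x).trans (hFG x))
        simp only [Pi.sub_apply] at h3
        rw [← h3, integral_sub hG h1, h2, sub_zero]

lemma doob_integral_le (h : Martingale 𝔣 ℱ μ) (hp : 1 < p)
    (hL : ∀ n, Integrable (fun x => |𝔣 n x| ^ p) μ) (n : ℕ) :
    ∫ x, runMax (fun k => 𝔣 k x) n ^ p ∂μ ≤ (p / (p - 1)) ^ p * ∫ x, |𝔣 n x| ^ p ∂μ := by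
  have hp1 : 0 < p - 1 := by linarith
  have hF : ∀ x, 0 ≤ runMax (fun k => 𝔣 k x) n ^ p := fun x =>
    Real.rpow_nonneg (runMax_nonneg _ n) _
  have key := lintegral_le_of_pathwise h hp hL (n := n)
    (g := fun k x => p ^ 2 / (p - 1) * (runMax (fun k => 𝔣 k x) k ^ (p - 1) *
      SignType.sign (𝔣 k x)))
    (fun k => by
      have h1 := @measurable_runMax X (ℱ k) 𝔣 k (measurable_of_martingale h k)
      have h2 : Measurable fun y : ℝ => ((SignType.sign y : SignType) : ℝ) := by
        have : (fun y : ℝ => ((SignType.sign y : SignType) : ℝ)) =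
            fun y => if 0 < y then 1 else if y < 0 then -1 else 0 := by
          funext y
          rcases lt_trichotomy y 0 with hy | hy | hy
          · simp [sign_neg hy, hy, hy.not_gt]
          · simp [hy]
          · simp [sign_pos hy, hy]
        rw [this]
        exact Measurable.ite measurableSet_Ioi measurable_const
          (Measurable.ite measurableSet_Iio measurable_const measurable_const)
      exact ((h1.pow_const _).mul (h2.comp (measurable_of_martingale h k k le_rfl))).const_mul _)
    (fun k => ⟨p ^ 2 / (p - 1), fun x => by
      have h0 := Real.rpow_nonneg (runMax_nonneg (fun k => 𝔣 k x) k) (p - 1)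
      have hs : |((SignType.sign (𝔣 k x) : SignType) : ℝ)| ≤ 1 := by
        rcases lt_trichotomy (𝔣 k x) 0 with hy | hy | hy
        · simp [sign_neg hy]
        · simp [hy]
        · simp [sign_pos hy]
      rw [abs_mul, abs_mul, abs_of_nonneg h0, abs_of_nonneg (by positivity)]
      exact mul_le_mul_of_nonneg_left (mul_le_of_le_one_right h0 hs) (by positivity)⟩)
    ((hL n).const_mul ((p / (p - 1)) ^ p)) hF
    (fun x => runMax_rpow_le hp (fun k => 𝔣 k x) n)
  rw [← ofReal_integral_eq_lintegral_ofReal (integrable_runMax_rpow hp hL n) (ae_of_all _ hF),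
    ENNReal.ofReal_le_ofReal_iff (integral_nonneg fun x => by positivity),
    integral_const_mul] at key
  exact key

lemma lintegral_sqVar_le (hp : 1 < p) : ∃ C : ℝ, 0 ≤ C ∧
    ∀ {X : Type*} {m0 : MeasurableSpace X} {μ : Measure X} [IsProbabilityMeasure μ]
      {ℱ : Filtration ℕ m0} {𝔣 : ℕ → X → ℝ}, Martingale 𝔣 ℱ μ →
      (∀ n, Integrable (fun x => |𝔣 n x| ^ p) μ) → ∀ (δ : ℝ) (n : ℕ),
      ∫⁻ x, ENNReal.ofReal (sqVar (anchor δ fun k => 𝔣 k x) n ^ (p / 2)) ∂μ ≤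
        ENNReal.ofReal (C * ∫ x, |𝔣 n x| ^ p ∂μ) := by
  have hp1 : 0 < p - 1 := by linarith
  set K := (p / (p - 1)) ^ p
  have hK : 0 ≤ K := by positivity
  rcases le_total p 2 with hp2 | hp2
  · set c : ℝ := (p * (p - 1) / 2) ^ (-(p / 2))
    have hc : 0 ≤ c := by positivity
    refine ⟨c * (K + 1), by positivity, fun {X m0 μ _ ℱ 𝔣} h hL δ n => ?_⟩
    have hMi := integrable_runMax_rpow hp hL n
    refine (lintegral_le_of_pathwise h hp hL (n := n)
      (g := fun k x => c * (p * |anchor δ (fun k => 𝔣 k x) k| ^ (p - 2) *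
        anchor δ (fun k => 𝔣 k x) k))
      (fun k => ?_) (fun k => ⟨c * p, fun x => ?_⟩) ((hMi.add (hL n)).const_mul c)
      (fun x => Real.rpow_nonneg (sqVar_nonneg _ _) _)
      (fun x => (anchor_samples δ fun k => 𝔣 k x).sqVar_rpow_le_of_le_two hp hp2 n)).trans ?_
    · have h1 := @measurable_anchor X (ℱ k) 𝔣 k δ (measurable_of_martingale h k)
      exact ((((continuous_abs.measurable.comp h1).pow_const _).const_mul p).mul h1).const_mul c
    · set a := anchor δ (fun k => 𝔣 k x) k
      have ha : |a| ≤ runMax (fun k => 𝔣 k x) k := (anchor_samples δ _).abs_apply_le k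
      have e : |a| ^ (p - 2) * |a| = |a| ^ (p - 1) := by
        have := mul_rpow_sub_one (abs_nonneg a) (p := p - 1) (by linarith)
        rwa [show p - 1 - 1 = p - 2 by ring] at this
      calc |c * (p * |a| ^ (p - 2) * a)| = c * p * (|a| ^ (p - 2) * |a|) := by
            rw [abs_mul, abs_mul, abs_mul, abs_of_nonneg hc, abs_of_nonneg (by linarith : 0 ≤ p),
              abs_of_nonneg (Real.rpow_nonneg (abs_nonneg a) _)]
            ring
        _ ≤ _ := by
            rw [e]
            have := Real.rpow_le_rpow (z := p - 1) (abs_nonneg a) ha hp1.le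
            gcongr
    · refine ENNReal.ofReal_le_ofReal ?_
      have := doob_integral_le h hp hL n
      rw [integral_const_mul, mul_assoc]
      refine mul_le_mul_of_nonneg_left ?_ hc
      calc _ = ∫ x, runMax (fun k => 𝔣 k x) n ^ p ∂μ + ∫ x, |𝔣 n x| ^ p ∂μ :=
            integral_add hMi (hL n)
        _ ≤ _ := by linarith
  · set q := p / 2 with hq
    have hq1 : 1 ≤ q := by rw [hq]; linarith
    set c : ℝ := (5 * q) ^ q
    have hc : 0 ≤ c := by positivity
    refine ⟨c * K, by positivity, fun {X m0 μ _ ℱ 𝔣} h hL δ n => ?_⟩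
    have hMi := integrable_runMax_rpow hp hL n
    refine (lintegral_le_of_pathwise h hp hL (n := n)
      (g := fun k x => q ^ 2 * (2 * (sqVar (anchor δ fun k => 𝔣 k x) k ^ (q - 1) *
        anchor δ (fun k => 𝔣 k x) k)))
      (fun k => ?_) (fun k => ⟨q ^ 2 * (2 * (4 * k) ^ (q - 1)), fun x => ?_⟩) (hMi.const_mul c)
      (fun x => Real.rpow_nonneg (sqVar_nonneg _ _) _)
      (fun x => ?_)).trans ?_
    · have h1 := @measurable_anchor X (ℱ k) 𝔣 k δ (measurable_of_martingale h k)
      have h2 := @measurable_sqVar_anchor X (ℱ k) 𝔣 k δ (measurable_of_martingale h k)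
      exact (((h2.pow_const _).mul h1).const_mul 2).const_mul (q ^ 2)
    · have hs := anchor_samples δ fun k => 𝔣 k x
      have hQ := hs.sqVar_le k
      have hQ0 := sqVar_nonneg (anchor δ fun k => 𝔣 k x) k
      have ha := hs.abs_apply_le k
      have hM := runMax_nonneg (fun k => 𝔣 k x) k
      set a := anchor δ (fun k => 𝔣 k x) k
      set Q := sqVar (anchor δ fun k => 𝔣 k x) k
      set M := runMax (fun k => 𝔣 k x) k
      have h1 : Q ^ (q - 1) ≤ (4 * k) ^ (q - 1) * M ^ (p - 2) := by
        calc Q ^ (q - 1) ≤ (4 * k * M ^ 2) ^ (q - 1) :=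
              Real.rpow_le_rpow hQ0 hQ (by linarith)
          _ = _ := by
              rw [Real.mul_rpow (by positivity) (by positivity), ← Real.rpow_natCast M 2,
                ← Real.rpow_mul hM]
              congr 2; push_cast; rw [hq]; ring
      have e : M ^ (p - 2) * M = M ^ (p - 1) := by
        have := mul_rpow_sub_one hM (p := p - 1) (by linarith)
        rwa [show p - 1 - 1 = p - 2 by ring] at this
      calc |q ^ 2 * (2 * (Q ^ (q - 1) * a))| = q ^ 2 * (2 * (Q ^ (q - 1) * |a|)) := by
            rw [abs_mul, abs_mul, abs_mul, abs_of_nonneg (by positivity : 0 ≤ q ^ 2),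
              abs_of_nonneg (by norm_num : (0 : ℝ) ≤ 2), abs_of_nonneg (Real.rpow_nonneg hQ0 _)]
        _ ≤ q ^ 2 * (2 * ((4 * k) ^ (q - 1) * M ^ (p - 2) * M)) := by gcongr
        _ = _ := by rw [← e]; ring
    · have := (anchor_samples δ fun k => 𝔣 k x).sqVar_rpow_le_of_one_le hq1 n
      rwa [show 2 * q = p by rw [hq]; ring] at this
    · refine ENNReal.ofReal_le_ofReal ?_
      have := doob_integral_le h hp hL n
      rw [integral_const_mul, mul_assoc]
      exact mul_le_mul_of_nonneg_left this hc

end Martingale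

lemma lintegral_majorant_le {r p : ℝ} (hr : 2 < r) (hp : 1 < p) : ∃ C : ℝ≥0∞, C ≠ ∞ ∧
    ∀ {X : Type*} {m0 : MeasurableSpace X} {μ : Measure X} [IsProbabilityMeasure μ]
      {ℱ : Filtration ℕ m0} {𝔣 : ℕ → X → ℝ}, Martingale 𝔣 ℱ μ →
      (∀ n, Integrable (fun x => |𝔣 n x| ^ p) μ) → ∀ n : ℕ,
      ∫⁻ x, majorant r p (fun k => 𝔣 k x) n ∂μ ≤
        C * ENNReal.ofReal (∫ x, |𝔣 n x| ^ p ∂μ) := by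
  obtain ⟨C, hC, hsq⟩ := lintegral_sqVar_le hp
  have hp1 : 0 < p - 1 := by linarith
  set K := (p / (p - 1)) ^ p
  have hK : 0 ≤ K := by positivity
  set ρ : ℝ := (1 / 2) ^ ((r - 2) / 2 * (p / 2))
  have hρ : 0 ≤ ρ := by positivity
  have hρ1 : ρ < 1 := Real.rpow_lt_one (by norm_num) (by norm_num)
    (mul_pos (by linarith) (by linarith))
  refine ⟨varConst r ^ (p / r) * (ENNReal.ofReal K +
    (1 - ENNReal.ofReal ρ)⁻¹ * ENNReal.ofReal C), ?_, fun {X m0 μ _ ℱ 𝔣} h hL n => ?_⟩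
  · refine ENNReal.mul_ne_top (ENNReal.rpow_ne_top_of_nonneg
      (div_nonneg (by linarith) (by linarith)) (varConst_ne_top hr)) (ENNReal.add_ne_top.2
      ⟨ENNReal.ofReal_ne_top, ENNReal.mul_ne_top (ENNReal.inv_ne_top.2 ?_)
        ENNReal.ofReal_ne_top⟩)
    rw [← ENNReal.ofReal_one, ← ENNReal.ofReal_sub _ hρ]
    exact (ENNReal.ofReal_pos.2 (sub_pos.2 hρ1)).ne'
  · have hm : ∀ k ≤ n, Measurable (𝔣 k) := fun k hk =>
      (measurable_of_martingale h n k hk).mono (ℱ.le n) le_rfl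
    have hM : Measurable fun x => ENNReal.ofReal (runMax (fun k => 𝔣 k x) n ^ p) :=
      ((measurable_runMax hm).pow_const p).ennreal_ofReal
    have hQ : ∀ m, Measurable fun x =>
        ENNReal.ofReal (sqVar (anchor (thr m) fun k => 𝔣 k x) n ^ (p / 2)) := fun m =>
      ((measurable_sqVar_anchor _ hm).pow_const _).ennreal_ofReal
    have hQ' : ∀ m, Measurable fun x => ENNReal.ofReal (ρ ^ m) *
        ENNReal.ofReal (sqVar (anchor (thr m) fun k => 𝔣 k x) n ^ (p / 2)) := fun m =>
      (hQ m).const_mul _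
    have hdoob : ∫⁻ x, ENNReal.ofReal (runMax (fun k => 𝔣 k x) n ^ p) ∂μ ≤
        ENNReal.ofReal K * ENNReal.ofReal (∫ x, |𝔣 n x| ^ p ∂μ) := by
      rw [← ofReal_integral_eq_lintegral_ofReal (integrable_runMax_rpow hp hL n)
        (ae_of_all _ fun x => Real.rpow_nonneg (runMax_nonneg _ n) _), ← ENNReal.ofReal_mul hK]
      exact ENNReal.ofReal_le_ofReal (doob_integral_le h hp hL n)
    have hadd : Measurable fun x => ENNReal.ofReal (runMax (fun k => 𝔣 k x) n ^ p) +
        ∑' m : ℕ, ENNReal.ofReal (ρ ^ m) *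
          ENNReal.ofReal (sqVar (anchor (thr m) fun k => 𝔣 k x) n ^ (p / 2)) :=
      hM.add (Measurable.tsum (L := .unconditional ℕ) hQ')
    change ∫⁻ x, varConst r ^ (p / r) *
      (ENNReal.ofReal (runMax (fun k => 𝔣 k x) n ^ p) + ∑' m : ℕ, ENNReal.ofReal (ρ ^ m) *
        ENNReal.ofReal (sqVar (anchor (thr m) fun k => 𝔣 k x) n ^ (p / 2))) ∂μ ≤ _
    rw [lintegral_const_mul _ hadd, lintegral_add_left hM,
      lintegral_tsum fun m => (hQ' m).aemeasurable, mul_assoc, add_mul]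
    gcongr
    calc ∑' m, ∫⁻ x, ENNReal.ofReal (ρ ^ m) *
          ENNReal.ofReal (sqVar (anchor (thr m) fun k => 𝔣 k x) n ^ (p / 2)) ∂μ
        ≤ ∑' m, ENNReal.ofReal ρ ^ m *
          (ENNReal.ofReal C * ENNReal.ofReal (∫ x, |𝔣 n x| ^ p ∂μ)) := by
          refine ENNReal.tsum_le_tsum fun m => ?_
          rw [lintegral_const_mul _ (hQ m), ENNReal.ofReal_pow hρ, ← ENNReal.ofReal_mul hC]
          gcongr
          exact hsq h hL _ n
      _ = _ := by rw [ENNReal.tsum_mul_right, ENNReal.tsum_geometric, mul_assoc]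

end Lepingle

/-- **Lépingle's inequality.**
For every `r ∈ (2, ∞)` and `p ∈ (1, ∞)` there is a constant `C_{p,r} > 0` such that for
every probability space with a filtration `(F_n)_n` and every martingale `(𝔣_n)_n` with
`sup_n ‖𝔣_n‖_{L^p} < ∞`, one has
`‖ V^r(𝔣_n : n ∈ ℤ₊) ‖_{L^p(X,μ)} ≤ C_{p,r} sup_n ‖𝔣_n‖_{L^p(X,μ)}`. -/
theorem lepingle_inequality
    (r p : ℝ) (hr : 2 < r) (hp : 1 < p) :
    ∃ C : ℝ, 0 < C ∧
      ∀ (X : Type) (m0 : MeasurableSpace X) (μ : Measure X), IsProbabilityMeasure μ →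
        ∀ (ℱ : Filtration ℕ m0) (𝔣 : ℕ → X → ℝ), Martingale 𝔣 ℱ μ →
          (⨆ n : ℕ, eLpNorm (𝔣 n) (ENNReal.ofReal p) μ) < ⊤ →
          lpNormENNReal (ENNReal.ofReal p)
              (fun x => rVariation r (fun n => 𝔣 n x)) μ
            ≤ ENNReal.ofReal C * ⨆ n : ℕ, eLpNorm (𝔣 n) (ENNReal.ofReal p) μ := by
  have hp0 : 0 < p := by linarith
  obtain ⟨C, hC, hmaj⟩ := Lepingle.lintegral_majorant_le hr hp
  refine ⟨(C ^ (1 / p)).toReal + 1, by positivity, ?_⟩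
  intro X m0 μ _ ℱ 𝔣 h hS
  set S := ⨆ n : ℕ, eLpNorm (𝔣 n) (ENNReal.ofReal p) μ
  have hpne : ENNReal.ofReal p ≠ 0 := (ENNReal.ofReal_pos.2 hp0).ne'
  have hpr : (ENNReal.ofReal p).toReal = p := ENNReal.toReal_ofReal hp0.le
  have hm : ∀ k, Measurable (𝔣 k) := fun k =>
    ((h.stronglyMeasurable k).mono (ℱ.le k)).measurable
  have hLp : ∀ n, MemLp (𝔣 n) (ENNReal.ofReal p) μ := fun n =>
    ⟨(hm n).aestronglyMeasurable,
      (le_iSup (fun n => eLpNorm (𝔣 n) (ENNReal.ofReal p) μ) n).trans_lt hS⟩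
  have hL : ∀ n, Integrable (fun x => |𝔣 n x| ^ p) μ := fun n => by
    have := (hLp n).integrable_norm_rpow hpne ENNReal.ofReal_ne_top
    rwa [hpr] at this
  have hI : ∀ n, ENNReal.ofReal (∫ x, |𝔣 n x| ^ p ∂μ) ≤ S ^ p := by
    intro n
    have e : eLpNorm (𝔣 n) (ENNReal.ofReal p) μ ^ p = ENNReal.ofReal (∫ x, |𝔣 n x| ^ p ∂μ) := by
      rw [eLpNorm_eq_lintegral_rpow_enorm_toReal hpne ENNReal.ofReal_ne_top, hpr,
        ← ENNReal.rpow_mul, one_div_mul_cancel hp0.ne', ENNReal.rpow_one,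
        ofReal_integral_eq_lintegral_ofReal (hL n)
          (ae_of_all _ fun x => Real.rpow_nonneg (abs_nonneg _) _)]
      refine lintegral_congr fun x => ?_
      rw [← ENNReal.ofReal_rpow_of_nonneg (abs_nonneg _) hp0.le, ← Real.norm_eq_abs, ofReal_norm]
    rw [← e]
    exact ENNReal.rpow_le_rpow
      (le_iSup (fun n => eLpNorm (𝔣 n) (ENNReal.ofReal p) μ) n) hp0.le
  have key : ∫⁻ x, rVariation r (fun n => 𝔣 n x) ^ p ∂μ ≤ C * S ^ p := by
    calc ∫⁻ x, rVariation r (fun n => 𝔣 n x) ^ p ∂μ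
        ≤ ∫⁻ x, ⨆ n, Lepingle.majorant r p (fun k => 𝔣 k x) n ∂μ :=
          lintegral_mono fun x => Lepingle.rVariation_rpow_le_majorant hr hp0 _
      _ = ⨆ n, ∫⁻ x, Lepingle.majorant r p (fun k => 𝔣 k x) n ∂μ :=
          lintegral_iSup (fun n => Lepingle.measurable_majorant r p fun k _ => hm k)
            fun i j hij x => Lepingle.majorant_mono hp0.le _ hij
      _ ≤ C * S ^ p := iSup_le fun n => (hmaj h hL n).trans (by gcongr; exact hI n)
  rw [lpNormENNReal, if_neg ENNReal.ofReal_ne_top, hpr]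
  calc (∫⁻ x, rVariation r (fun n => 𝔣 n x) ^ p ∂μ) ^ (1 / p) ≤ (C * S ^ p) ^ (1 / p) :=
        ENNReal.rpow_le_rpow key (by positivity)
    _ = C ^ (1 / p) * S := by
        rw [ENNReal.mul_rpow_of_nonneg _ _ (by positivity), ← ENNReal.rpow_mul,
          mul_one_div_cancel hp0.ne', ENNReal.rpow_one]
    _ ≤ ENNReal.ofReal ((C ^ (1 / p)).toReal + 1) * S := by
        gcongr
        have hfin : C ^ (1 / p) ≠ ∞ := ENNReal.rpow_ne_top_of_nonneg (by positivity) hC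
        calc C ^ (1 / p) = ENNReal.ofReal (C ^ (1 / p)).toReal := (ENNReal.ofReal_toReal hfin).symm
          _ ≤ _ := ENNReal.ofReal_le_ofReal (by linarith)
end
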